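/- arXiv:1006.4853 — 5 statements merged into one kernel-verified Lean document; each statement's English description precedes it below -/
import Mathlib

section
/- Let F = F(X) with X finite, and let (v, w) be a good pair of nontrivial cyclic words that does not have minimal length in its Aut(F)-orbit. Then there exists a Whitehead automorphism τ such that (τ(v), τ(w)) is also good and |τ(v)| + |τ(w)| < |v| + |w|. -/
open FreeGroup

/-- The length of a cyclic word (conjugacy class): the minimal word length of a representative. -/
noncomputable def cycLen {X : Type} [DecidableEq X] (c : ConjClasses (FreeGroup X)) : ℕ :=
  sInf {n | ∃ g : FreeGroup X, ConjClasses.mk g = c ∧ (FreeGroup.toWord g).length = n}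

/-- An element of a free group is cyclically reduced if its first letter is not
the inverse of its last letter. -/
def IsCycRed {X : Type} [DecidableEq X] (g : FreeGroup X) : Prop :=
  ∀ x : X × Bool, (FreeGroup.toWord g).head? = some x →
    (FreeGroup.toWord g).getLast? ≠ some (x.1, !x.2)

/-- The set `L(c)` of letters of `X` occurring (up to inversion) in the cyclic word `c`. -/
def usedLetters {X : Type} [DecidableEq X] (c : ConjClasses (FreeGroup X)) : Set X :=
  {x | ∃ g : FreeGroup X, ConjClasses.mk g = c ∧ IsCycRed g ∧ ∃ b : Bool, (x, b) ∈ FreeGroup.toWord g}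

/-- The action of an automorphism of the free group on cyclic words (conjugacy classes). -/
def actC {X : Type} (φ : FreeGroup X ≃* FreeGroup X) (c : ConjClasses (FreeGroup X)) :
    ConjClasses (FreeGroup X) :=
  ConjClasses.map (φ : FreeGroup X →* FreeGroup X) c

/-- `τ` is a Whitehead automorphism of the second kind with multiplier `a ∈ X ∪ X⁻¹`. -/
def IsWhiteheadMult {X : Type} (a : X × Bool) (τ : FreeGroup X ≃* FreeGroup X) : Prop :=
  ∀ x : X, τ (of x) ∈ ({of x, of x * FreeGroup.mk [a],
      (FreeGroup.mk [a])⁻¹ * of x, (FreeGroup.mk [a])⁻¹ * of x * FreeGroup.mk [a]} :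
      Set (FreeGroup X))

/-- `τ` is a relabeling automorphism: it permutes the set `X ∪ X⁻¹`. -/
def IsRelabeling {X : Type} (τ : FreeGroup X ≃* FreeGroup X) : Prop :=
  ∀ x : X, ∃ y : X × Bool, τ (of x) = FreeGroup.mk [y]

/-- Whitehead automorphisms. -/
def IsWhitehead {X : Type} (τ : FreeGroup X ≃* FreeGroup X) : Prop :=
  IsRelabeling τ ∨ ∃ a : X × Bool, IsWhiteheadMult a τ

open FreeGroup

/-- `(A, B)` is a free splitting of `F`: the natural map from the free product `A ∗ B`
to `F` is an isomorphism (internal free product). -/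
def IsFreeSplitting {F : Type} [Group F] (A B : Subgroup F) : Prop :=
  Function.Bijective (Monoid.Coprod.lift A.subtype B.subtype)

/-- `g` is elliptic to the splitting `A * B`: `g` lies in a conjugate of `A` or of `B`. -/
def Elliptic {F : Type} [Group F] (A B : Subgroup F) (g : F) : Prop :=
  ∃ y : F, y * g * y⁻¹ ∈ A ∨ y * g * y⁻¹ ∈ B

/-- A cyclic word (conjugacy class) is elliptic to `A * B` if some representative lies in
`A` or in `B`. -/
def EllipticC {F : Type} [Group F] (A B : Subgroup F) (c : ConjClasses F) : Prop :=
  ∃ g : F, ConjClasses.mk g = c ∧ (g ∈ A ∨ g ∈ B)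

/-- The pair of cyclic words `(v, w)` is frugal: together they do not use all letters of `X`. -/
def Frugal {X : Type} [DecidableEq X] (v w : ConjClasses (FreeGroup X)) : Prop :=
  usedLetters v ∪ usedLetters w ≠ Set.univ

/-- The pair `(v, w)` is disjoint: `v` and `w` share no letters. -/
def DisjPair {X : Type} [DecidableEq X] (v w : ConjClasses (FreeGroup X)) : Prop :=
  usedLetters v ∩ usedLetters w = ∅

/-- A pair is good if it is frugal or disjoint. -/
def GoodPair {X : Type} [DecidableEq X] (v w : ConjClasses (FreeGroup X)) : Prop :=
  Frugal v w ∨ DisjPair v w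

/-- `(v, w)` has minimal length in its orbit under `Aut(F)`. -/
def MinLenPair {X : Type} [DecidableEq X] (v w : ConjClasses (FreeGroup X)) : Prop :=
  ∀ φ : FreeGroup X ≃* FreeGroup X,
    cycLen v + cycLen w ≤ cycLen (actC φ v) + cycLen (actC φ w)

section Letters

variable {X : Type}

/-- The formal inverse of a letter. -/
def letterInv (d : X × Bool) : X × Bool := (d.1, !d.2)

/-- The element of the free group represented by a letter. -/
def letter (d : X × Bool) : FreeGroup X := FreeGroup.mk [d]

@[simp] lemma letterInv_letterInv (d : X × Bool) : letterInv (letterInv d) = d := by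
  simp [letterInv]

lemma letterInv_ne (d : X × Bool) : letterInv d ≠ d := by
  rcases d with ⟨x, b⟩
  cases b <;> simp [letterInv]

lemma letterInv_eq_comm {d e : X × Bool} : letterInv d = e ↔ d = letterInv e := by
  constructor <;> rintro rfl <;> simp

lemma fst_eq_iff {d e : X × Bool} : d.1 = e.1 ↔ d = e ∨ d = letterInv e := by
  rcases d with ⟨x, b⟩
  rcases e with ⟨y, c⟩
  cases b <;> cases c <;> simp [letterInv]

@[simp] lemma letter_letterInv (d : X × Bool) : letter (letterInv d) = (letter d)⁻¹ := by
  simp [letter, letterInv, FreeGroup.inv_mk, FreeGroup.invRev]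

lemma letter_true (x : X) : letter (x, true) = of x := rfl

lemma letter_false (x : X) : letter (x, false) = (of x)⁻¹ := by
  rw [← letter_true, ← letter_letterInv]; rfl

/-- The exponent of the multiplier of the Whitehead automorphism given by `A` and `a ∈ A`. -/
def multExp (a : X × Bool) : ℤ := if a.2 then -1 else 1

lemma of_zpow_multExp (a : X × Bool) : of a.1 ^ multExp a = (letter a)⁻¹ := by
  rcases a with ⟨x, b⟩
  cases b <;> simp [multExp, letter_true, letter_false]

variable [DecidableEq X]

lemma norm_letter_le (d : X × Bool) : norm (letter d) ≤ 1 := norm_mk_le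

/-- The edge of the Cayley tree issuing from `g` in the direction `d` leads towards the
identity. -/
def Backward (g : FreeGroup X) (d : X × Bool) : Prop := (g⁻¹).toWord.head? = some d

lemma Backward.unique {g : FreeGroup X} {d e : X × Bool} (hd : Backward g d)
    (he : Backward g e) : d = e := by
  unfold Backward at *
  simp_all

lemma not_backward_one (d : X × Bool) : ¬ Backward 1 d := by
  simp [Backward]

lemma exists_backward {g : FreeGroup X} (hg : g ≠ 1) : ∃ b, Backward g b := by
  unfold Backward
  rw [← Option.isSome_iff_exists, List.isSome_head?]
  simpa only [ne_eq, FreeGroup.toWord_eq_nil_iff, inv_eq_one] using hg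

lemma toWord_inv_mul_letter (g : FreeGroup X) (d : X × Bool) (h : ¬ Backward g d) :
    ((g * letter d)⁻¹).toWord = letterInv d :: (g⁻¹).toWord := by
  have h1 : (g * letter d)⁻¹ = FreeGroup.mk (letterInv d :: (g⁻¹).toWord) := by
    rw [mul_inv_rev, ← letter_letterInv, letter]
    conv_lhs => rw [← FreeGroup.mk_toWord (x := g⁻¹)]
    rw [FreeGroup.mul_mk]; rfl
  rw [h1, FreeGroup.toWord_mk, FreeGroup.reduce.cons, FreeGroup.reduce_toWord]
  unfold Backward at h
  rcases hw : (g⁻¹).toWord with _ | ⟨e, L⟩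
  · rfl
  · rw [hw] at h
    have hne : ¬ ((letterInv d).1 = e.1 ∧ (letterInv d).2 = !e.2) := by
      rintro ⟨h1, h2⟩
      apply h
      rcases d with ⟨x, b⟩
      rcases e with ⟨y, c⟩
      cases b <;> cases c <;> simp_all [letterInv]
    simp [hne]

lemma backward_mul_letter_iff (g : FreeGroup X) (d : X × Bool) :
    Backward (g * letter d) (letterInv d) ↔ ¬ Backward g d := by
  constructor
  · intro h hb
    have h1 : ¬ ∃ M, (g⁻¹).toWord = d :: letterInv d :: M := by
      rintro ⟨M, hM⟩
      have h2 := FreeGroup.isReduced_toWord (x := g⁻¹)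
      rw [hM, FreeGroup.IsReduced.eq_def, List.isChain_cons_cons] at h2
      have := h2.1 rfl
      simp [letterInv] at this
    have h2 : (g⁻¹) = letter d * (g * letter d)⁻¹ := by group
    have h3 : ∃ L, ((g * letter d)⁻¹).toWord = letterInv d :: L := by
      unfold Backward at h
      exact List.head?_eq_some_iff.mp h
    obtain ⟨L, hL⟩ := h3
    have h4 : g⁻¹ = FreeGroup.mk L := by
      rw [h2]
      conv_lhs => rw [← FreeGroup.mk_toWord (x := (g * letter d)⁻¹), hL]
      have : FreeGroup.mk (letterInv d :: L) = letter (letterInv d) * FreeGroup.mk L := by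
        rw [letter, FreeGroup.mul_mk]; rfl
      rw [this, letter_letterInv]; group
    have hLr : FreeGroup.IsReduced L := by
      have := FreeGroup.isReduced_toWord (x := (g * letter d)⁻¹)
      rw [hL] at this
      exact this.infix ⟨[letterInv d], [], by simp⟩
    have h5 : (g⁻¹).toWord = L := by rw [h4, FreeGroup.toWord_mk, hLr.reduce_eq]
    unfold Backward at hb
    rw [h5] at hb
    obtain ⟨M, hM⟩ := List.head?_eq_some_iff.mp hb
    have h6 := FreeGroup.isReduced_toWord (x := (g * letter d)⁻¹)
    rw [hL, hM, FreeGroup.IsReduced.eq_def, List.isChain_cons_cons] at h6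
    have := h6.1 rfl
    simp [letterInv] at this
  · intro h
    rw [Backward, toWord_inv_mul_letter g d h]
    rfl

lemma norm_mul_letter (g : FreeGroup X) (d : X × Bool) (h : ¬ Backward g d) :
    norm (g * letter d) = norm g + 1 := by
  rw [← norm_inv_eq (x := g * letter d), FreeGroup.norm, toWord_inv_mul_letter g d h, List.length_cons,
    ← norm_inv_eq (x := g), FreeGroup.norm]

lemma toWord_mul_letter (g : FreeGroup X) (d : X × Bool) (h : ¬ Backward g d) :
    (g * letter d).toWord = g.toWord ++ [d] := by
  have h1 := toWord_inv_mul_letter g d h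
  rw [FreeGroup.toWord_inv, FreeGroup.toWord_inv] at h1
  have h2 := congrArg FreeGroup.invRev h1
  rw [FreeGroup.invRev_invRev] at h2
  rw [h2]
  have : ∀ L : List (X × Bool), FreeGroup.invRev (letterInv d :: L) = FreeGroup.invRev L ++ [d] := by
    intro L
    simp [FreeGroup.invRev, letterInv]
  rw [this, FreeGroup.invRev_invRev]

end Letters

section Lines

variable {X : Type} {n : ℕ} (W : ZMod n → X × Bool)

/-- Incidences of lines with vertices of the Cayley tree: the line reading the periodic word `W`
passes through `g` at position `i`. The permutation moves one step along the line. -/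
def lineStep : Equiv.Perm (FreeGroup X × ZMod n) where
  toFun q := (q.1 * letter (W q.2), q.2 + 1)
  invFun q := (q.1 * (letter (W (q.2 - 1)))⁻¹, q.2 - 1)
  left_inv q := by simp
  right_inv q := by simp

lemma lineStep_apply (q : FreeGroup X × ZMod n) :
    lineStep W q = (q.1 * letter (W q.2), q.2 + 1) := rfl

lemma lineStep_inv_apply (q : FreeGroup X × ZMod n) :
    (lineStep W)⁻¹ q = (q.1 * (letter (W (q.2 - 1)))⁻¹, q.2 - 1) := rfl

lemma lineStep_zpow_succ (k : ℤ) (q : FreeGroup X × ZMod n) :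
    (lineStep W ^ (k + 1)) q = lineStep W ((lineStep W ^ k) q) := by
  rw [add_comm, zpow_add, zpow_one, Equiv.Perm.mul_apply]

lemma lineStep_zpow_snd (k : ℤ) (q : FreeGroup X × ZMod n) :
    ((lineStep W ^ k) q).2 = q.2 + k := by
  induction k using Int.induction_on with
  | zero => simp
  | succ k ih =>
    rw [lineStep_zpow_succ, lineStep_apply, ih]; push_cast; ring
  | pred k ih =>
    have h := lineStep_zpow_succ W (-(k : ℤ) - 1) q
    rw [sub_add_cancel] at h
    rw [h, lineStep_apply] at ih
    have : ((lineStep W ^ (-(k : ℤ) - 1)) q).2 + 1 = q.2 + ((-(k : ℤ) : ℤ) : ZMod n) := ih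
    rw [← sub_eq_iff_eq_add.mpr this.symm]; push_cast; ring

lemma lineStep_zpow_mul (k : ℤ) (a g : FreeGroup X) (i : ZMod n) :
    (lineStep W ^ k) (a * g, i) =
      (a * ((lineStep W ^ k) (g, i)).1, ((lineStep W ^ k) (g, i)).2) := by
  induction k using Int.induction_on with
  | zero => simp
  | succ k ih =>
    rw [lineStep_zpow_succ, lineStep_zpow_succ, ih]; simp [lineStep_apply, mul_assoc]
  | pred k ih =>
    have h := lineStep_zpow_succ W (-(k : ℤ) - 1)
    simp only [sub_add_cancel] at h
    apply (lineStep W).injective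
    rw [← h, ih, h, lineStep_apply, lineStep_apply]
    simp [mul_assoc]

/-- The element of the free group read off along one period of `W`. -/
def periodProd : FreeGroup X := ((lineStep W ^ (n : ℤ)) (1, 0)).1

lemma lineStep_zpow_period (k : ℤ) (a : FreeGroup X) :
    (lineStep W ^ ((n : ℤ) * k)) (a, 0) = (a * periodProd W ^ k, 0) := by
  have h1 : ∀ b : FreeGroup X, (lineStep W ^ (n : ℤ)) (b, 0) = (b * periodProd W, 0) := by
    intro b
    have := lineStep_zpow_mul W n b 1 0
    rw [mul_one] at this
    rw [this]
    refine Prod.ext rfl ?_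
    change ((lineStep W ^ (n : ℤ)) (1, 0)).2 = 0
    rw [lineStep_zpow_snd]; simp
  induction k using Int.induction_on with
  | zero => simp
  | succ k ih =>
    rw [mul_add, mul_one, add_comm, zpow_add, Equiv.Perm.mul_apply, ih, h1, zpow_add_one, mul_assoc]
  | pred k ih =>
    apply (lineStep W ^ (n : ℤ)).injective
    rw [h1, ← Equiv.Perm.mul_apply, ← zpow_add, mul_assoc, ← zpow_add_one, sub_add_cancel, ← ih]
    congr 2; ring

lemma exists_zpow_eq [NeZero n] (q : FreeGroup X × ZMod n) :
    ∃ a : FreeGroup X, ∃ m : ℤ, (lineStep W ^ m) (a, 0) = q := by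
  refine ⟨((lineStep W ^ (-(q.2.val : ℤ))) q).1, q.2.val, ?_⟩
  have h0 : ((lineStep W ^ (-(q.2.val : ℤ))) q).2 = 0 := by
    rw [lineStep_zpow_snd]; simp
  rw [← h0, Prod.mk.eta, ← Equiv.Perm.mul_apply, ← zpow_add]
  simp

variable [DecidableEq X]

/-- Along the line, the step at `q` leads away from the identity. -/
def Ascending (q : FreeGroup X × ZMod n) : Prop := ¬ Backward q.1 (W q.2)

lemma ascending_inv_iff (q : FreeGroup X × ZMod n) :
    Ascending W ((lineStep W)⁻¹ q) ↔ Backward q.1 (letterInv (W (q.2 - 1))) := by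
  rw [Ascending, lineStep_inv_apply, ← backward_mul_letter_iff]
  simp

variable {W}

lemma Ascending.step (hW : ∀ i, W (i + 1) ≠ letterInv (W i)) {q : FreeGroup X × ZMod n}
    (h : Ascending W q) : Ascending W (lineStep W q) := by
  have h1 : Backward (q.1 * letter (W q.2)) (letterInv (W q.2)) :=
    (backward_mul_letter_iff _ _).2 h
  intro h2
  exact hW _ (h2.unique h1)

lemma Ascending.norm_step {q : FreeGroup X × ZMod n} (h : Ascending W q) :
    FreeGroup.norm (lineStep W q).1 = FreeGroup.norm q.1 + 1 :=
  norm_mul_letter _ _ h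

lemma Ascending.zpow (hW : ∀ i, W (i + 1) ≠ letterInv (W i)) {q : FreeGroup X × ZMod n}
    (h : Ascending W q) (k : ℕ) :
    Ascending W ((lineStep W ^ (k : ℤ)) q) ∧
      FreeGroup.norm ((lineStep W ^ (k : ℤ)) q).1 = FreeGroup.norm q.1 + k := by
  induction k with
  | zero => simpa using h
  | succ k ih =>
    push_cast
    rw [lineStep_zpow_succ]
    exact ⟨ih.1.step hW, by rw [ih.1.norm_step, ih.2]; ring⟩

/-- On the descending part of the line, the distance from the identity grows backwards. -/
lemma norm_zpow_neg (hW : ∀ i, W (i + 1) ≠ letterInv (W i)) {q : FreeGroup X × ZMod n}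
    (h : ¬ Ascending W ((lineStep W ^ (-1 : ℤ)) q)) (k : ℕ) :
    ¬ Ascending W ((lineStep W ^ (-((k : ℤ) + 1))) q) ∧
      FreeGroup.norm ((lineStep W ^ (-(k : ℤ) - 1)) q).1 = FreeGroup.norm q.1 + k + 1 := by
  have key : ∀ p : FreeGroup X × ZMod n, ¬ Ascending W p →
      FreeGroup.norm p.1 = FreeGroup.norm (lineStep W p).1 + 1 := by
    intro p hp
    have h1 : Backward p.1 (W p.2) := not_not.mp hp
    have h2 : ¬ Backward (p.1 * letter (W p.2)) (letterInv (W p.2)) := by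
      rw [backward_mul_letter_iff]; exact not_not.mpr h1
    have := norm_mul_letter _ _ h2
    simpa [lineStep_apply] using this
  induction k with
  | zero =>
    refine ⟨by simpa using h, ?_⟩
    have h1 := key _ h
    rw [← lineStep_zpow_succ] at h1
    simpa using h1
  | succ k ih =>
    have h0 := lineStep_zpow_succ W (-((k : ℤ) + 1 + 1)) q
    have e1 : -((k : ℤ) + 1 + 1) + 1 = -((k : ℤ) + 1) := by ring
    rw [e1] at h0
    have h1 : ¬ Ascending W ((lineStep W ^ (-((k : ℤ) + 1 + 1))) q) := by
      intro h2
      apply ih.1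
      rw [h0]
      exact h2.step hW
    push_cast
    refine ⟨h1, ?_⟩
    have h2 := key _ h1
    rw [← h0] at h2
    have e2 : -((k : ℤ) + 1) - 1 = -((k : ℤ) + 1 + 1) := by ring
    have e3 : -(k : ℤ) - 1 = -((k : ℤ) + 1) := by ring
    rw [e2, h2, ← e3, ih.2]
    ring

variable (W) in
/-- The incidence at which the line is closest to the identity. -/
def IsApex (q : FreeGroup X × ZMod n) : Prop :=
  Ascending W q ∧ ¬ Ascending W ((lineStep W)⁻¹ q)

lemma IsApex.zpow_eq_zero (hW : ∀ i, W (i + 1) ≠ letterInv (W i)) {q : FreeGroup X × ZMod n}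
    (h : IsApex W q) {k : ℤ} (hk : IsApex W ((lineStep W ^ k) q)) : k = 0 := by
  have key : ∀ (p : FreeGroup X × ZMod n) (m : ℕ), Ascending W p →
      ¬ IsApex W ((lineStep W ^ ((m : ℤ) + 1)) p) := by
    intro p m hp ha
    apply ha.2
    have := lineStep_zpow_succ W m p
    rw [this, show ∀ r, (lineStep W)⁻¹ (lineStep W r) = r from (lineStep W).symm_apply_apply]
    exact (hp.zpow hW m).1
  rcases lt_trichotomy k 0 with hlt | h0 | hgt
  · exfalso
    obtain ⟨m, rfl⟩ : ∃ m : ℕ, k = -((m : ℤ) + 1) := ⟨(-k - 1).toNat, by omega⟩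
    apply key _ m hk.1
    rw [← Equiv.Perm.mul_apply, ← zpow_add]
    simpa using h
  · exact h0
  · exfalso
    obtain ⟨m, rfl⟩ : ∃ m : ℕ, k = (m : ℤ) + 1 := ⟨(k - 1).toNat, by omega⟩
    exact key _ m h.1 hk

end Lines

section Colorings

variable {X : Type} (h : FreeGroup X → Prop)

/-- The color at the end of the ray issuing from `g` with all letters equal to `d`. -/
def RayColor (g : FreeGroup X) (d : X × Bool) : Prop :=
  ∀ᶠ k : ℕ in Filter.atTop, h (g * letter d ^ k)

lemma rayColor_mul_letter (g : FreeGroup X) (d : X × Bool) :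
    RayColor h (g * letter d) d ↔ RayColor h g d := by
  unfold RayColor
  conv_rhs => rw [← Filter.map_add_atTop_eq_nat 1, Filter.eventually_map]
  simp [pow_succ', mul_assoc]

variable [DecidableEq X]

/-- The color of an edge of the Cayley tree: that of the straight ray which contains the edge and
leads away from the identity. -/
def EdgeColor (g : FreeGroup X) (d : X × Bool) : Prop :=
  (¬ Backward g d ∧ RayColor h g d) ∨ (Backward g d ∧ RayColor h g (letterInv d))

variable {h}

lemma edgeColor_of_not_backward {g : FreeGroup X} {d : X × Bool} (hd : ¬ Backward g d) :
    EdgeColor h g d ↔ RayColor h g d := by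
  simp [EdgeColor, hd]

lemma edgeColor_of_backward {g : FreeGroup X} {d : X × Bool} (hd : Backward g d) :
    EdgeColor h g d ↔ RayColor h g (letterInv d) := by
  simp [EdgeColor, hd]

lemma edgeColor_mul_letter (g : FreeGroup X) (d : X × Bool) :
    EdgeColor h (g * letter d) (letterInv d) ↔ EdgeColor h g d := by
  by_cases hd : Backward g d
  · have h1 : ¬ Backward (g * letter d) (letterInv d) := by
      rw [backward_mul_letter_iff]; exact not_not.mpr hd
    rw [edgeColor_of_backward hd, edgeColor_of_not_backward h1,
      ← rayColor_mul_letter h (g * letter d)]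
    simp
  · rw [edgeColor_of_not_backward hd, edgeColor_of_backward ((backward_mul_letter_iff g d).2 hd)]
    rw [letterInv_letterInv, rayColor_mul_letter]

lemma not_backward_letterInv {g : FreeGroup X} {d : X × Bool} (hd : Backward g d) :
    ¬ Backward g (letterInv d) :=
  fun h' => letterInv_ne d (h'.unique hd)

lemma edgeColor_letterInv_of_backward {g : FreeGroup X} {d : X × Bool} (hd : Backward g d) :
    EdgeColor h g (letterInv d) ↔ EdgeColor h g d := by
  rw [edgeColor_of_backward hd, edgeColor_of_not_backward (not_backward_letterInv hd)]

lemma rayColor_iff {N : ℕ} (hN : ∀ g d, N ≤ FreeGroup.norm g → (h (g * letter d) ↔ h g))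
    {g : FreeGroup X} {d : X × Bool} (hg : N ≤ FreeGroup.norm g) (hd : ¬ Backward g d) :
    RayColor h g d ↔ h g := by
  have key : ∀ k : ℕ, ¬ Backward (g * letter d ^ k) d ∧
      N ≤ FreeGroup.norm (g * letter d ^ k) ∧ (h (g * letter d ^ k) ↔ h g) := by
    intro k
    induction k with
    | zero => simp [hd, hg]
    | succ k ih =>
      obtain ⟨h1, h2, h3⟩ := ih
      rw [pow_succ, ← mul_assoc]
      refine ⟨?_, ?_, ?_⟩
      · intro h4
        exact letterInv_ne d (((backward_mul_letter_iff _ _).2 h1).unique h4)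
      · rw [norm_mul_letter _ _ h1]; omega
      · rw [hN _ _ h2, h3]
  unfold RayColor
  simp only [fun k => (key k).2.2, Filter.eventually_const]

lemma edgeColor_iff {N : ℕ} (hN : ∀ g d, N ≤ FreeGroup.norm g → (h (g * letter d) ↔ h g))
    {g : FreeGroup X} (d : X × Bool) (hg : N ≤ FreeGroup.norm g) :
    EdgeColor h g d ↔ h g := by
  by_cases hd : Backward g d
  · rw [edgeColor_of_backward hd, rayColor_iff hN hg (not_backward_letterInv hd)]
  · rw [edgeColor_of_not_backward hd, rayColor_iff hN hg hd]

variable {n : ℕ} {W : ZMod n → X × Bool}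

variable (h W) in
/-- The color of the edge along which the line leaves the incidence `q`. -/
def LineColor (q : FreeGroup X × ZMod n) : Prop := EdgeColor h q.1 (W q.2)

variable (h W) in
/-- The line changes its color at the incidence `q`. -/
def ColorChange (q : FreeGroup X × ZMod n) : Prop :=
  ¬ (LineColor h W ((lineStep W)⁻¹ q) ↔ LineColor h W q)

lemma lineColor_inv_iff (q : FreeGroup X × ZMod n) :
    LineColor h W ((lineStep W)⁻¹ q) ↔ EdgeColor h q.1 (letterInv (W (q.2 - 1))) := by
  rw [LineColor, lineStep_inv_apply, ← edgeColor_mul_letter]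
  simp

lemma ColorChange.norm_lt {N : ℕ}
    (hN : ∀ g d, N ≤ FreeGroup.norm g → (h (g * letter d) ↔ h g))
    {q : FreeGroup X × ZMod n} (hq : ColorChange h W q) : FreeGroup.norm q.1 < N := by
  by_contra hlt
  apply hq
  rw [lineColor_inv_iff, LineColor, edgeColor_iff hN _ (not_lt.mp hlt),
    edgeColor_iff hN _ (not_lt.mp hlt)]

/-- If the apex is the only incidence at which a line changes its color, then the two ends of the
line have different colors. -/
lemma ends_separated {N : ℕ} (hW : ∀ i, W (i + 1) ≠ letterInv (W i))
    (hN : ∀ g d, N ≤ FreeGroup.norm g → (h (g * letter d) ↔ h g))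
    {q : FreeGroup X × ZMod n} (hq : ColorChange h W q) (ha : IsApex W q)
    (hne : ∀ k : ℤ, ColorChange h W ((lineStep W ^ k) q) → IsApex W ((lineStep W ^ k) q)) :
    ∀ k : ℤ, (N ≤ k → (h ((lineStep W ^ k) q).1 ↔ LineColor h W q)) ∧
      (k ≤ -N - 1 → (h ((lineStep W ^ k) q).1 ↔ ¬ LineColor h W q)) := by
  have hstep : ∀ k : ℤ, k ≠ -1 → (LineColor h W ((lineStep W ^ (k + 1)) q) ↔
      LineColor h W ((lineStep W ^ k) q)) := by
    intro k hk
    by_contra hcon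
    have h1 : ColorChange h W ((lineStep W ^ (k + 1)) q) := by
      intro h2
      apply hcon
      rw [← h2, lineStep_zpow_succ,
        show ∀ r, (lineStep W)⁻¹ (lineStep W r) = r from (lineStep W).symm_apply_apply]
    have := ha.zpow_eq_zero hW (hne _ h1)
    omega
  have hpos : ∀ k : ℕ, LineColor h W ((lineStep W ^ (k : ℤ)) q) ↔ LineColor h W q := by
    intro k
    induction k with
    | zero => simp
    | succ k ih =>
      push_cast
      rw [hstep _ (by omega), ih]
  have hneg : ∀ k : ℕ, LineColor h W ((lineStep W ^ (-(k : ℤ) - 1)) q) ↔ ¬ LineColor h W q := by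
    intro k
    induction k with
    | zero =>
      have : ((lineStep W ^ (-((0 : ℕ) : ℤ) - 1)) q) = (lineStep W)⁻¹ q := by simp
      rw [this]
      rw [ColorChange, not_iff] at hq
      rw [← hq, not_not]
    | succ k ih =>
      rw [← ih, ← hstep _ (by omega)]
      push_cast
      rw [show -((k : ℤ) + 1) - 1 + 1 = -(k : ℤ) - 1 by ring]
  have hdesc : ¬ Ascending W ((lineStep W ^ (-1 : ℤ)) q) := by
    simpa using ha.2
  intro k
  constructor
  · intro hk
    obtain ⟨m, rfl⟩ : ∃ m : ℕ, k = m := ⟨k.toNat, by omega⟩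
    rw [← hpos m, LineColor, edgeColor_iff hN]
    rw [(ha.1.zpow hW m).2]; omega
  · intro hk
    obtain ⟨m, rfl⟩ : ∃ m : ℕ, k = -(m : ℤ) - 1 := ⟨(-k - 1).toNat, by omega⟩
    rw [← hneg m, LineColor, edgeColor_iff hN]
    rw [(norm_zpow_neg hW hdesc m).2]; omega

lemma isApex_iff (W : ZMod n → X × Bool) (g : FreeGroup X) (i : ZMod n) :
    IsApex W (g, i) ↔ ¬ Backward g (W i) ∧ ¬ Backward g (letterInv (W (i - 1))) := by
  rw [IsApex, ascending_inv_iff, Ascending]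

lemma colorChange_iff (h : FreeGroup X → Prop) (W : ZMod n → X × Bool) (g : FreeGroup X)
    (i : ZMod n) :
    ColorChange h W (g, i) ↔ ¬ (EdgeColor h g (letterInv (W (i - 1))) ↔ EdgeColor h g (W i)) := by
  rw [ColorChange, lineColor_inv_iff, LineColor]

end Colorings

section Counting

open scoped Classical

variable {X : Type} {n : ℕ} [NeZero n]

/-- The number of occurrences of `x`, up to inversion, in the periodic word `W`. -/
noncomputable def letterCount (W : ZMod n → X × Bool) (x : X) : ℕ :=
  Finset.card {i : ZMod n | (W i).1 = x}

/-- The number of turns of the periodic word `W` of which exactly one direction is in `A`. -/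
noncomputable def cutCount (W : ZMod n → X × Bool) (A : Set (X × Bool)) : ℕ :=
  Finset.card {i : ZMod n | ¬ (letterInv (W (i - 1)) ∈ A ↔ W i ∈ A)}

lemma letterCount_eq_zero {W : ZMod n → X × Bool} {Z : Set X} (hW : ∀ i, (W i).1 ∈ Z) {x : X}
    (hx : x ∉ Z) : letterCount W x = 0 := by
  rw [letterCount, Finset.card_eq_zero, Finset.filter_eq_empty_iff]
  rintro i - rfl
  exact hx (hW i)

lemma cutCount_congr {W : ZMod n → X × Bool} {A B : Set (X × Bool)}
    (h : ∀ i, W i ∈ A ↔ W i ∈ B) (h' : ∀ i, letterInv (W i) ∈ A ↔ letterInv (W i) ∈ B) :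
    cutCount W A = cutCount W B := by
  simp only [cutCount, h, h']

lemma letterCount_eq (W : ZMod n → X × Bool) (b : X × Bool) :
    letterCount W b.1 = Finset.card {i : ZMod n | W i = b} +
      Finset.card {i : ZMod n | letterInv (W (i - 1)) = b} := by
  have h1 : Finset.card {i : ZMod n | letterInv (W (i - 1)) = b} =
      Finset.card {i : ZMod n | W i = letterInv b} := by
    apply Finset.card_bij (fun i _ => i - 1)
    · intro i hi
      simpa [letterInv_eq_comm] using hi
    · intro i _ j _ hij
      simpa using hij
    · intro i hi
      refine ⟨i + 1, ?_, by simp⟩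
      simpa [letterInv_eq_comm] using hi
  rw [h1, ← Finset.card_union_of_disjoint, letterCount]
  · congr 1
    ext i
    simp [fst_eq_iff]
  · rw [Finset.disjoint_left]
    intro i hi hj
    simp only [Finset.mem_filter, Finset.mem_univ, true_and] at hi hj
    exact letterInv_ne b (hj.symm.trans hi)

variable [DecidableEq X] (h : FreeGroup X → Prop) (W : ZMod n → X × Bool)

/-- The number of color changes at apices located at `g`. -/
noncomputable def apexChanges (g : FreeGroup X) : ℕ :=
  Finset.card {i : ZMod n | ColorChange h W (g, i) ∧ IsApex W (g, i)}

/-- The number of color changes located at `g` and not at an apex. -/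
noncomputable def sideChanges (g : FreeGroup X) : ℕ :=
  Finset.card {i : ZMod n | ColorChange h W (g, i) ∧ ¬ IsApex W (g, i)}

lemma cutCount_add_sideChanges (hW : ∀ i, W (i + 1) ≠ letterInv (W i)) {g : FreeGroup X}
    {b : X × Bool} (hb : Backward g b) :
    cutCount W {d | d = b ∨ ¬ (EdgeColor h g d ↔ EdgeColor h g b)} + sideChanges h W g =
      letterCount W b.1 + apexChanges h W g := by
  have hB : ∀ d, Backward g d ↔ d = b := fun d => ⟨fun hd => hd.unique hb, fun hd => hd ▸ hb⟩
  rw [letterCount_eq, cutCount, sideChanges, apexChanges]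
  simp only [Finset.card_filter, ← Finset.sum_add_distrib, isApex_iff, colorChange_iff, hB,
    Set.mem_ofPred_eq]
  refine Finset.sum_congr rfl fun i _ => ?_
  have hne : W i ≠ letterInv (W (i - 1)) := by simpa using hW (i - 1)
  by_cases h1 : W i = b <;> by_cases h2 : letterInv (W (i - 1)) = b
  · exact absurd (h1.trans h2.symm) hne
  · by_cases c1 : EdgeColor h g (letterInv (W (i - 1))) <;> by_cases c2 : EdgeColor h g b <;>
      simp [h1, h2, c1, c2]
  · by_cases c1 : EdgeColor h g (W i) <;> by_cases c2 : EdgeColor h g b <;>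
      simp [h1, h2, c1, c2]
  · by_cases c1 : EdgeColor h g (W i) <;> by_cases c2 : EdgeColor h g b <;>
      by_cases c3 : EdgeColor h g (letterInv (W (i - 1))) <;> simp [h1, h2, c1, c2, c3]

lemma sideChanges_one : sideChanges h W 1 = 0 := by
  simp [sideChanges, isApex_iff, not_backward_one]

lemma cutCount_eq_apexChanges_one (c : Prop) :
    cutCount W {d | RayColor h 1 d ↔ c} = apexChanges h W 1 := by
  rw [cutCount, apexChanges]
  congr 1
  ext i
  simp only [Finset.mem_filter, Finset.mem_univ, true_and, Set.mem_ofPred_eq, isApex_iff,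
    colorChange_iff, not_backward_one, not_false_eq_true, and_self, and_true,
    edgeColor_of_not_backward (not_backward_one _)]
  tauto

variable {h W}

/-- The color changes at apices are accounted for by the other color changes and by the lines
which separate the two colors at infinity. -/
lemma sum_apexChanges_le (hW : ∀ i, W (i + 1) ≠ letterInv (W i)) {N : ℕ}
    (hN : ∀ g d, N ≤ FreeGroup.norm g → (h (g * letter d) ↔ h g))
    {S : Finset (FreeGroup X)} (hS : ∀ g, g ∈ S ↔ FreeGroup.norm g < N)
    {J : Type} [Fintype J] (R : FreeGroup X → J → Prop)
    (hR : ∀ a C, (∀ᶠ k : ℤ in Filter.atTop, (h (a * periodProd W ^ k) ↔ C)) →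
      (∀ᶠ k : ℤ in Filter.atBot, (h (a * periodProd W ^ k) ↔ ¬ C)) → ∃ j, R a j)
    (hR' : ∀ a a' j, R a j → R a' j → ∃ m : ℤ, a' = a * periodProd W ^ m) :
    ∑ g ∈ S, apexChanges h W g ≤ ∑ g ∈ S, sideChanges h W g + Fintype.card J := by
  set P : Finset (FreeGroup X × ZMod n) :=
    (S ×ˢ Finset.univ).filter fun q => ColorChange h W q ∧ IsApex W q with hP
  set M : Finset (FreeGroup X × ZMod n) :=
    (S ×ˢ Finset.univ).filter fun q => ColorChange h W q ∧ ¬ IsApex W q with hM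
  have e1 : ∑ g ∈ S, apexChanges h W g = P.card := by
    simp only [hP, apexChanges, Finset.card_filter, Finset.sum_product]
  have e2 : ∑ g ∈ S, sideChanges h W g = M.card := by
    simp only [hM, sideChanges, Finset.card_filter, Finset.sum_product]
  let r : P → M ⊕ J → Prop := fun p z => match z with
    | Sum.inl m => (lineStep W).SameCycle p.1 m.1
    | Sum.inr j => ∃ a, (lineStep W).SameCycle (a, 0) p.1 ∧ R a j
  have hex : ∀ p, ∃ z, r p z := by
    rintro ⟨p, hp⟩
    rw [hP, Finset.mem_filter] at hp
    by_cases hc : ∃ m ∈ M, (lineStep W).SameCycle p m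
    · obtain ⟨m, hm, hpm⟩ := hc
      exact ⟨Sum.inl ⟨m, hm⟩, hpm⟩
    · push Not at hc
      have hne : ∀ k : ℤ, ColorChange h W ((lineStep W ^ k) p) → IsApex W ((lineStep W ^ k) p) := by
        intro k hk
        by_contra hnot
        refine hc ((lineStep W ^ k) p) ?_ ⟨k, rfl⟩
        rw [hM, Finset.mem_filter, Finset.mem_product]
        exact ⟨⟨(hS _).2 (hk.norm_lt hN), Finset.mem_univ _⟩, hk, hnot⟩
      have hends := ends_separated hW hN hp.2.1 hp.2.2 hne
      obtain ⟨a, m, ham⟩ := exists_zpow_eq (W := W) p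
      have hak : ∀ k : ℤ, a * periodProd W ^ k = ((lineStep W ^ ((n : ℤ) * k - m)) p).1 := by
        intro k
        rw [← ham, ← Equiv.Perm.mul_apply, ← zpow_add, sub_add_cancel, lineStep_zpow_period]
      have hn : (0 : ℤ) < n := by exact_mod_cast NeZero.pos n
      obtain ⟨j, hj⟩ := hR a (LineColor h W p) (by
          filter_upwards [Filter.eventually_ge_atTop ((N : ℤ) + |m|)] with k hk
          rw [hak]
          apply (hends _).1
          have := le_abs_self m
          have := abs_nonneg m
          nlinarith) (by
          filter_upwards [Filter.eventually_le_atBot (-(N : ℤ) - 1 - |m|)] with k hk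
          rw [hak]
          apply (hends _).2
          have := neg_abs_le m
          have := abs_nonneg m
          nlinarith)
      exact ⟨Sum.inr j, a, ⟨m, ham⟩, hj⟩
  choose f hf using hex
  have hinj : Function.Injective f := by
    rintro ⟨p, hp⟩ ⟨p', hp'⟩ hpp
    rw [hP, Finset.mem_filter] at hp hp'
    have h1 := hf ⟨p, by rw [hP, Finset.mem_filter]; exact hp⟩
    have h2 := hf ⟨p', by rw [hP, Finset.mem_filter]; exact hp'⟩
    rw [hpp] at h1
    have hsame : (lineStep W).SameCycle p p' := by
      rcases hz : f ⟨p', by rw [hP, Finset.mem_filter]; exact hp'⟩ with m | j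
      · rw [hz] at h1 h2
        exact Equiv.Perm.SameCycle.trans h1 h2.symm
      · rw [hz] at h1 h2
        obtain ⟨a, ha, hja⟩ := h1
        obtain ⟨a', ha', hja'⟩ := h2
        obtain ⟨m, rfl⟩ := hR' _ _ _ hja hja'
        refine ha.symm.trans (Equiv.Perm.SameCycle.trans ⟨(n : ℤ) * m, ?_⟩ ha')
        exact lineStep_zpow_period W m a
    obtain ⟨k, hk⟩ := hsame
    have hk0 := hp.2.2.zpow_eq_zero hW (k := k) (by rw [hk]; exact hp'.2.2)
    subst hk0
    simpa using hk
  have := Fintype.card_le_of_injective f hinj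
  rw [Fintype.card_sum, Fintype.card_coe, Fintype.card_coe] at this
  rw [e1, e2]
  exact this

end Counting

section HalfSpaces

variable {X : Type}

/-- A coloring of the free group that every right translation changes at finitely many elements
only. -/
def AlmostInvariant (h : FreeGroup X → Prop) : Prop :=
  ∀ s, {g | ¬ (h g ↔ h (g * s))}.Finite

lemma AlmostInvariant.of_letters {h : FreeGroup X → Prop}
    (hl : ∀ d, {g | ¬ (h g ↔ h (g * letter d))}.Finite) : AlmostInvariant h := by
  intro s
  induction s using FreeGroup.induction_on with
  | C1 => simp
  | of x => exact hl (x, true)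
  | inv_of x _ => rw [← letter_false]; exact hl (x, false)
  | mul s t hs ht =>
    refine (hs.union (ht.preimage (mul_left_injective s).injOn)).subset ?_
    intro g hg
    simp only [Set.mem_ofPred_eq, Set.mem_union, Set.mem_preimage] at hg ⊢
    rw [← mul_assoc] at hg
    tauto

lemma AlmostInvariant.comp {h : FreeGroup X → Prop} (hh : AlmostInvariant h) (t : FreeGroup X)
    (φ : FreeGroup X ≃* FreeGroup X) : AlmostInvariant fun g => h (t * φ g) := by
  intro s
  refine ((hh (φ s)).preimage (f := fun g => t * φ g) ?_).subset ?_
  · intro a _ b _ hab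
    simpa using hab
  · intro g hg
    simpa [mul_assoc] using hg

lemma AlmostInvariant.eventually {h : FreeGroup X → Prop} (hh : AlmostInvariant h)
    (f c s : FreeGroup X) (hc : c ≠ 1) :
    ∀ᶠ k : ℤ in Filter.cofinite, (h (f * c ^ k) ↔ h (f * c ^ k * s)) := by
  have hinj : Function.Injective fun k : ℤ => f * c ^ k := by
    intro k m hkm
    exact injective_zpow_iff_not_isOfFinOrder.mpr (not_isOfFinOrder_of_isMulTorsionFree hc)
      (mul_left_cancel hkm)
  have := ((hh s).preimage hinj.injOn)
  rw [Filter.eventually_cofinite]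
  exact this

variable [DecidableEq X]

lemma AlmostInvariant.exists_norm [Fintype X] {h : FreeGroup X → Prop} (hh : AlmostInvariant h) :
    ∃ N, ∀ g d, N ≤ FreeGroup.norm g → (h (g * letter d) ↔ h g) := by
  have hfin : (⋃ d : X × Bool, {g | ¬ (h g ↔ h (g * letter d))}).Finite :=
    Set.finite_iUnion fun d => hh (letter d)
  obtain ⟨N, hN⟩ := (hfin.image FreeGroup.norm).bddAbove
  refine ⟨N + 1, fun g d hg => ?_⟩
  by_contra hcon
  have : FreeGroup.norm g ≤ N :=
    hN ⟨g, Set.mem_iUnion.mpr ⟨d, fun h' => hcon h'.symm⟩, rfl⟩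
  omega

lemma finite_norm_lt [Finite X] (N : ℕ) : {g : FreeGroup X | FreeGroup.norm g < N}.Finite :=
  (List.finite_length_lt (X × Bool) N).preimage FreeGroup.toWord_injective.injOn

/-- The set of elements whose reduced word starts with `y`. -/
def HalfSpace (y : X) (f : FreeGroup X) : Prop := f.toWord.head? = some (y, true)

/-- The initial vertex, before the letter `d`, of the edge bounding the half-space of `d.1`. -/
def edgeStart (d : X × Bool) : FreeGroup X := if d.2 then 1 else of d.1

lemma eq_edgeStart {y : X} {f : FreeGroup X} {d : X × Bool}
    (hd : ¬ (HalfSpace y f ↔ HalfSpace y (f * letter d))) : d.1 = y ∧ f = edgeStart d := by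
  have key : ∀ (g : FreeGroup X) (e : X × Bool), ¬ Backward g e →
      ¬ (HalfSpace y g ↔ HalfSpace y (g * letter e)) → g = 1 ∧ e = (y, true) := by
    intro g e he hne
    unfold HalfSpace at hne
    rw [toWord_mul_letter g e he] at hne
    rcases hw : g.toWord with _ | ⟨b, L⟩
    · rw [hw] at hne
      refine ⟨FreeGroup.toWord_eq_nil_iff.mp hw, ?_⟩
      simpa using hne
    · rw [hw] at hne
      simp at hne
  by_cases hb : Backward f d
  · have h1 : ¬ Backward (f * letter d) (letterInv d) := by
      rw [backward_mul_letter_iff]; exact not_not.mpr hb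
    obtain ⟨h2, h3⟩ := key _ _ h1 (by
      rw [letter_letterInv, mul_inv_cancel_right]
      exact fun h' => hd h'.symm)
    rw [letterInv_eq_comm] at h3
    subst h3
    refine ⟨rfl, ?_⟩
    rw [mul_eq_one_iff_eq_inv] at h2
    rw [h2]
    rw [← letter_letterInv, letterInv_letterInv]; rfl
  · obtain ⟨rfl, rfl⟩ := key f d hb hd
    simp [edgeStart]

lemma halfSpace_almostInvariant (y : X) : AlmostInvariant (HalfSpace y) :=
  .of_letters fun d => (Set.finite_singleton (edgeStart d)).subset fun _ hg => (eq_edgeStart hg).2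

lemma exists_crossing {y : X} (L : List (X × Bool)) (f : FreeGroup X)
    (hf : ¬ (HalfSpace y f ↔ HalfSpace y (f * FreeGroup.mk L))) :
    ∃ j : Fin L.length, (L.get j).1 = y ∧ f * FreeGroup.mk (L.take j) = edgeStart (L.get j) := by
  induction L generalizing f with
  | nil => simp [← FreeGroup.one_eq_mk] at hf
  | cons d L ih =>
    have hmk : ∀ M, FreeGroup.mk (d :: M) = letter d * FreeGroup.mk M := by
      intro M; rw [letter, FreeGroup.mul_mk]; rfl
    by_cases hd : HalfSpace y f ↔ HalfSpace y (f * letter d)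
    · rw [hmk, ← mul_assoc, hd] at hf
      obtain ⟨j, h1, h2⟩ := ih _ hf
      refine ⟨j.succ, by simpa using h1, ?_⟩
      simpa [hmk, mul_assoc] using h2
    · obtain ⟨h1, h2⟩ := eq_edgeStart hd
      refine ⟨⟨0, by simp⟩, by simpa using h1, ?_⟩
      simpa [← FreeGroup.one_eq_mk] using h2

lemma exists_crossing_zpow {y : X} (L : List (X × Bool)) (f : FreeGroup X) (C : Prop)
    (h1 : ∀ᶠ k : ℤ in Filter.atTop, (HalfSpace y (f * FreeGroup.mk L ^ k) ↔ C))
    (h2 : ∀ᶠ k : ℤ in Filter.atBot, (HalfSpace y (f * FreeGroup.mk L ^ k) ↔ ¬ C)) :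
    ∃ j : Fin L.length, (L.get j).1 = y ∧
      ∃ k : ℤ, f * FreeGroup.mk L ^ k * FreeGroup.mk (L.take j) = edgeStart (L.get j) := by
  by_contra! hcon
  have hstep : ∀ k : ℤ, HalfSpace y (f * FreeGroup.mk L ^ k) ↔
      HalfSpace y (f * FreeGroup.mk L ^ (k + 1)) := by
    intro k
    by_contra hk
    rw [zpow_add_one, ← mul_assoc] at hk
    obtain ⟨j, hj, hj'⟩ := exists_crossing L _ hk
    exact hcon j hj k hj'
  have hconst : ∀ k : ℤ, HalfSpace y (f * FreeGroup.mk L ^ k) ↔ HalfSpace y f := by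
    intro k
    induction k using Int.induction_on with
    | zero => simp
    | succ k ih => rw [← hstep, ih]
    | pred k ih => rw [hstep, sub_add_cancel, ih]
  obtain ⟨k, hk⟩ := h1.exists
  obtain ⟨m, hm⟩ := h2.exists
  rw [hconst] at hk hm
  tauto

end HalfSpaces

section Separation

variable {X : Type} [DecidableEq X]

lemma eventually_atTop_and_atBot {p : ℤ → Prop} (hp : ∀ᶠ k in Filter.cofinite, p k) :
    (∀ᶠ k in Filter.atTop, p k) ∧ ∀ᶠ k in Filter.atBot, p k := by
  rw [Int.cofinite_eq, Filter.eventually_sup] at hp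
  exact hp.symm

/-- The number of occurrences of `y`, up to inversion, in a word. -/
def occurrences (L : List (X × Bool)) (y : X) : ℕ :=
  Finset.card {j : Fin L.length | (L.get j).1 = y}

lemma sum_occurrences [Fintype X] (L : List (X × Bool)) : ∑ y, occurrences L y = L.length := by
  have := Finset.card_eq_sum_card_fiberwise (s := (Finset.univ : Finset (Fin L.length)))
    (t := (Finset.univ : Finset X)) (f := fun j => (L.get j).1) (by intro _ _; simp)
  rw [Finset.card_univ, Fintype.card_fin] at this
  exact this.symm

lemma sum_apexChanges_le_occurrences {n : ℕ} [NeZero n] {W : ZMod n → X × Bool}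
    (hW : ∀ i, W (i + 1) ≠ letterInv (W i)) (hW1 : periodProd W ≠ 1) {y : X} {t : FreeGroup X}
    {φ : FreeGroup X ≃* FreeGroup X} {N : ℕ}
    (hN : ∀ g d, N ≤ FreeGroup.norm g →
      (HalfSpace y (t * φ (g * letter d)) ↔ HalfSpace y (t * φ g)))
    {S : Finset (FreeGroup X)} (hS : ∀ g, g ∈ S ↔ FreeGroup.norm g < N)
    {u : FreeGroup X} {L : List (X × Bool)} (hL : φ (periodProd W) = u * FreeGroup.mk L * u⁻¹) :
    ∑ g ∈ S, apexChanges (fun g => HalfSpace y (t * φ g)) W g ≤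
      ∑ g ∈ S, sideChanges (fun g => HalfSpace y (t * φ g)) W g + occurrences L y := by
  have hL1 : FreeGroup.mk L ≠ 1 := by
    intro h1
    rw [h1, mul_one, mul_inv_cancel] at hL
    exact hW1 ((map_eq_one_iff φ φ.injective).mp hL)
  have hzpow : ∀ (a : FreeGroup X) (k : ℤ),
      t * φ (a * periodProd W ^ k) = t * φ a * u * FreeGroup.mk L ^ k * u⁻¹ := by
    intro a k
    rw [_root_.map_mul, map_zpow, hL, conj_zpow]; group
  have := sum_apexChanges_le (h := fun g => HalfSpace y (t * φ g)) hW hN hS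
    (J := {j : Fin L.length // (L.get j).1 = y})
    (fun a j => ∃ k : ℤ, t * φ a * u * FreeGroup.mk L ^ k * FreeGroup.mk (L.take j.1) =
      edgeStart (L.get j.1)) ?_ ?_
  · rwa [Fintype.card_subtype] at this
  · intro a C h1 h2
    simp only [hzpow] at h1 h2
    obtain ⟨e1, e2⟩ := eventually_atTop_and_atBot
      ((halfSpace_almostInvariant y).eventually (t * φ a * u) (FreeGroup.mk L) u⁻¹ hL1)
    obtain ⟨j, hj, hk⟩ := exists_crossing_zpow (y := y) L (t * φ a * u) C
      (by filter_upwards [h1, e1] with k hk hk'; rw [hk', hk])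
      (by filter_upwards [h2, e2] with k hk hk'; rw [hk', hk])
    exact ⟨⟨j, hj⟩, hk⟩
  · rintro a a' j ⟨k, hk⟩ ⟨k', hk'⟩
    refine ⟨k - k', φ.injective ?_⟩
    rw [_root_.map_mul, map_zpow, hL, conj_zpow, zpow_sub]
    have h1 := mul_right_cancel (hk.trans hk'.symm)
    have h2 : φ a' * u * FreeGroup.mk L ^ k' = φ a * u * FreeGroup.mk L ^ k := by
      simp only [mul_assoc] at h1 ⊢
      exact (mul_left_cancel h1).symm
    have h3 : φ a' = φ a * u * FreeGroup.mk L ^ k * (FreeGroup.mk L ^ k')⁻¹ * u⁻¹ := by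
      rw [← h2]; group
    rw [h3]; group

/-- The exponent sum of `y`. -/
def expSum (y : X) : FreeGroup X →* Multiplicative ℤ :=
  FreeGroup.lift fun x => Multiplicative.ofAdd (if x = y then 1 else 0)

lemma exists_mem_of_expSum_ne {y : X} {L : List (X × Bool)} (hL : expSum y (FreeGroup.mk L) ≠ 1) :
    ∃ b, (y, b) ∈ L := by
  induction L with
  | nil => exact absurd (_root_.map_one _) hL
  | cons d L ih =>
    have hmk : FreeGroup.mk (d :: L) = letter d * FreeGroup.mk L := by
      rw [letter, FreeGroup.mul_mk]; rfl
    rcases d with ⟨x, c⟩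
    by_cases hx : x = y
    · exact ⟨c, by simp [hx]⟩
    · have h1 : expSum y (letter (x, c)) = 1 := by
        cases c <;> simp [letter_true, letter_false, expSum, hx]
      rw [hmk, _root_.map_mul, h1, one_mul] at hL
      obtain ⟨b, hb⟩ := ih hL
      exact ⟨b, List.mem_cons_of_mem _ hb⟩

lemma eq_conj_reduceCyclically (f : FreeGroup X) :
    f = FreeGroup.mk (reduceCyclically.conjugator f.toWord) *
      FreeGroup.mk (reduceCyclically f.toWord) *
      (FreeGroup.mk (reduceCyclically.conjugator f.toWord))⁻¹ := by
  conv_lhs => rw [← FreeGroup.mk_toWord (x := f),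
    ← reduceCyclically.conj_conjugator_reduceCyclically f.toWord]
  rw [FreeGroup.inv_mk, FreeGroup.mul_mk, FreeGroup.mul_mk]

lemma isReduced_invRev {L : List (X × Bool)} (hL : IsReduced L) :
    IsReduced (FreeGroup.invRev L) := by
  rw [FreeGroup.isReduced_iff_reduce_eq] at *
  rw [FreeGroup.reduce_invRev, hL]

/-- Up to conjugation and inversion, an element with nonzero exponent sum of `y` is represented by
a cyclically reduced word which starts with `y`. -/
lemma exists_conj_cons {y : X} {f : FreeGroup X} (hf : expSum y f ≠ 1) :
    ∃ s M, IsReduced ((y, true) :: M ++ [(y, true)]) ∧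
      (f = s * FreeGroup.mk ((y, true) :: M) * s⁻¹ ∨
        f⁻¹ = s * FreeGroup.mk ((y, true) :: M) * s⁻¹) := by
  set c := FreeGroup.mk (reduceCyclically.conjugator f.toWord)
  set R := reduceCyclically f.toWord with hR
  have hfc : f = c * FreeGroup.mk R * c⁻¹ := eq_conj_reduceCyclically f
  have hRred : IsCyclicallyReduced R :=
    reduceCyclically.isCyclicallyReduced FreeGroup.isReduced_toWord
  obtain ⟨b, hb⟩ : ∃ b, (y, b) ∈ R := by
    apply exists_mem_of_expSum_ne
    intro h1
    apply hf
    rw [hfc, _root_.map_mul, _root_.map_mul, h1, _root_.map_inv, mul_one, mul_inv_cancel]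
  obtain ⟨R₁, R₂, hRR⟩ := List.append_of_mem hb
  have hred : IsReduced ((y, b) :: (R₂ ++ R₁) ++ [(y, b)]) := by
    have h2 := (hRred.flatten_replicate 2).isReduced
    refine h2.infix ⟨R₁, R₂, ?_⟩
    simp [List.replicate_succ, hRR]
  cases b with
  | true =>
    refine ⟨c * FreeGroup.mk R₁, R₂ ++ R₁, hred, Or.inl ?_⟩
    rw [hfc, hRR, ← List.cons_append, ← FreeGroup.mul_mk, ← FreeGroup.mul_mk]; group
  | false =>
    refine ⟨c * FreeGroup.mk (R₁ ++ [(y, false)]), FreeGroup.invRev (R₂ ++ R₁), ?_, Or.inr ?_⟩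
    · have := isReduced_invRev hred
      simpa [FreeGroup.invRev] using this
    · have h1 : FreeGroup.mk ((y, true) :: FreeGroup.invRev (R₂ ++ R₁)) =
          (FreeGroup.mk R₂ * FreeGroup.mk R₁ * FreeGroup.mk [(y, false)])⁻¹ := by
        rw [FreeGroup.mul_mk, FreeGroup.mul_mk, FreeGroup.inv_mk]
        congr 1
        simp [FreeGroup.invRev]
      have h2 : FreeGroup.mk R =
          FreeGroup.mk R₁ * FreeGroup.mk [(y, false)] * FreeGroup.mk R₂ := by
        rw [hRR, FreeGroup.mul_mk, FreeGroup.mul_mk]; simp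
      rw [h1, hfc, h2, ← FreeGroup.mul_mk]; group

lemma halfSpace_zpow {y : X} {M : List (X × Bool)}
    (hM : IsReduced ((y, true) :: M ++ [(y, true)])) (k : ℕ) :
    HalfSpace y (FreeGroup.mk ((y, true) :: M) ^ ((k : ℤ) + 1)) ∧
      ¬ HalfSpace y (FreeGroup.mk ((y, true) :: M) ^ (-((k : ℤ) + 1))) := by
  set V := (y, true) :: M with hV
  have hcyc : IsCyclicallyReduced V := by
    rw [IsReduced.eq_def, List.isChain_append] at hM
    refine ⟨hM.1, fun a ha b hb => ?_⟩
    have : b = (y, true) := by simpa [hV, eq_comm] using hb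
    subst this
    exact hM.2.2 a ha _ (by simp)
  have hword : (FreeGroup.mk V ^ (k + 1)).toWord = (List.replicate (k + 1) V).flatten := by
    rw [FreeGroup.toWord_pow, FreeGroup.toWord_mk, hcyc.isReduced.reduce_eq,
      (hcyc.flatten_replicate _).isReduced.reduce_eq]
  constructor
  · rw [HalfSpace]
    norm_cast
    rw [hword, List.head?_flatten_replicate (by omega)]
    rfl
  · rw [HalfSpace, zpow_neg]
    norm_cast
    rw [FreeGroup.toWord_inv, hword, FreeGroup.invRev, List.head?_reverse, List.getLast?_map,
      List.getLast?_flatten_replicate (by omega)]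
    intro h1
    rw [Option.map_eq_some_iff] at h1
    obtain ⟨a, ha, ha'⟩ := h1
    have h2 := hcyc.2 a ha (y, true) (by simp [hV]) (by simpa using congrArg Prod.fst ha')
    have h3 := congrArg Prod.snd ha'
    simp [h2] at h3

lemma eventually_halfSpace {y : X} {f s : FreeGroup X} {M : List (X × Bool)}
    (hM : IsReduced ((y, true) :: M ++ [(y, true)]))
    (hf : f = s * FreeGroup.mk ((y, true) :: M) * s⁻¹) :
    (∀ᶠ k : ℤ in Filter.atTop, HalfSpace y (s⁻¹ * f ^ k)) ∧
      ∀ᶠ k : ℤ in Filter.atBot, ¬ HalfSpace y (s⁻¹ * f ^ k) := by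
  have h1 : FreeGroup.mk ((y, true) :: M) ≠ 1 := by
    intro h1
    have h2 := (halfSpace_zpow hM 0).1
    rw [h1] at h2
    simp [HalfSpace] at h2
  have hpow : ∀ k : ℤ, s⁻¹ * f ^ k = 1 * FreeGroup.mk ((y, true) :: M) ^ k * s⁻¹ := by
    intro k
    rw [hf, conj_zpow]; group
  obtain ⟨e1, e2⟩ := eventually_atTop_and_atBot
    ((halfSpace_almostInvariant y).eventually 1 (FreeGroup.mk ((y, true) :: M)) s⁻¹ h1)
  constructor
  · filter_upwards [e1, Filter.eventually_ge_atTop 1] with k hk hk1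
    rw [hpow, ← hk, one_mul]
    obtain ⟨m, rfl⟩ : ∃ m : ℕ, k = (m : ℤ) + 1 := ⟨(k - 1).toNat, by omega⟩
    exact (halfSpace_zpow hM m).1
  · filter_upwards [e2, Filter.eventually_le_atBot (-1)] with k hk hk1
    rw [hpow, ← hk, one_mul]
    obtain ⟨m, rfl⟩ : ∃ m : ℕ, k = -((m : ℤ) + 1) := ⟨(-k - 1).toNat, by omega⟩
    exact (halfSpace_zpow hM m).2

lemma exists_rayColor_ne {x y : X} {φ : FreeGroup X ≃* FreeGroup X}
    (hφ : expSum y (φ (of x)) ≠ 1) :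
    ∃ t, ¬ (RayColor (fun g => HalfSpace y (t * φ g)) 1 (x, true) ↔
      RayColor (fun g => HalfSpace y (t * φ g)) 1 (x, false)) := by
  have key : ∀ (d : X × Bool) (s : FreeGroup X),
      ((∀ᶠ k : ℤ in Filter.atTop, HalfSpace y (s⁻¹ * φ (letter d) ^ k)) ∧
        ∀ᶠ k : ℤ in Filter.atBot, ¬ HalfSpace y (s⁻¹ * φ (letter d) ^ k)) →
      RayColor (fun g => HalfSpace y (s⁻¹ * φ g)) 1 d ∧
      ¬ RayColor (fun g => HalfSpace y (s⁻¹ * φ g)) 1 (letterInv d) := by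
    rintro d s ⟨h1, h2⟩
    constructor
    · filter_upwards [tendsto_natCast_atTop_atTop.eventually h1] with k hk
      simpa using hk
    · intro h3
      have h4 := (Filter.tendsto_neg_atTop_atBot.comp
        (tendsto_natCast_atTop_atTop (R := ℤ))).eventually h2
      obtain ⟨k, hk, hk'⟩ := (h4.and h3).exists
      simp at hk hk'
      exact hk hk'
  obtain ⟨s, M, hM, hf | hf⟩ := exists_conj_cons hφ
  · have := key (x, true) s (eventually_halfSpace hM hf)
    refine ⟨s⁻¹, fun h1 => this.2 ?_⟩
    exact h1.mp this.1
  · have := key (x, false) s (eventually_halfSpace hM (by rw [letter_false, _root_.map_inv, hf]))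
    refine ⟨s⁻¹, fun h1 => this.2 ?_⟩
    exact h1.mpr this.1

end Separation

section Comparison

variable {X : Type} [DecidableEq X] [Fintype X] {m n : ℕ} [NeZero m] [NeZero n]
  {V : ZMod m → X × Bool} {W : ZMod n → X × Bool}

lemma letterCount_le_occurrences (hV : ∀ i, V (i + 1) ≠ letterInv (V i))
    (hW : ∀ i, W (i + 1) ≠ letterInv (W i)) (hV1 : periodProd V ≠ 1) (hW1 : periodProd W ≠ 1)
    (hmin : ∀ (A : Set (X × Bool)) (a : X × Bool), a ∈ A → letterInv a ∉ A →
      letterCount V a.1 + letterCount W a.1 ≤ cutCount V A + cutCount W A)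
    {φ : FreeGroup X ≃* FreeGroup X} {s t : FreeGroup X} {K L : List (X × Bool)}
    (hK : φ (periodProd V) = s * FreeGroup.mk K * s⁻¹)
    (hL : φ (periodProd W) = t * FreeGroup.mk L * t⁻¹) {x y : X}
    (hxy : expSum y (φ (of x)) ≠ 1) :
    letterCount V x + letterCount W x ≤ occurrences K y + occurrences L y := by
  obtain ⟨r, hr⟩ := exists_rayColor_ne hxy
  set h : FreeGroup X → Prop := fun g => HalfSpace y (r * φ g) with hh
  obtain ⟨M, hM⟩ := ((halfSpace_almostInvariant y).comp r φ).exists_norm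
  have hN : ∀ g d, M + 1 ≤ FreeGroup.norm g → (h (g * letter d) ↔ h g) :=
    fun g d hg => hM g d (by omega)
  set S : Finset (FreeGroup X) := (finite_norm_lt (X := X) (M + 1)).toFinset with hSdef
  have hS : ∀ g, g ∈ S ↔ FreeGroup.norm g < M + 1 := by simp [hSdef]
  have h1S : (1 : FreeGroup X) ∈ S := by simp [hS]
  have e1 := sum_apexChanges_le_occurrences hV hV1 hN hS hK
  have e2 := sum_apexChanges_le_occurrences hW hW1 hN hS hL
  rw [← hh, ← Finset.add_sum_erase S _ h1S, ← Finset.add_sum_erase S _ h1S, sideChanges_one]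
    at e1 e2
  have e3 : ∑ g ∈ S.erase 1, (sideChanges h V g + sideChanges h W g) ≤
      ∑ g ∈ S.erase 1, (apexChanges h V g + apexChanges h W g) := by
    refine Finset.sum_le_sum fun g hg => ?_
    obtain ⟨b, hb⟩ := exists_backward (Finset.ne_of_mem_erase hg)
    have h1 := cutCount_add_sideChanges h V hV hb
    have h2 := cutCount_add_sideChanges h W hW hb
    have h3 := hmin {d | d = b ∨ ¬ (EdgeColor h g d ↔ EdgeColor h g b)} b (Or.inl rfl) (by
      rintro (h4 | h4)
      · exact letterInv_ne b h4
      · exact h4 (edgeColor_letterInv_of_backward hb))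
    omega
  have e4 := hmin {d | RayColor h 1 d ↔ RayColor h 1 (x, true)} (x, true) Iff.rfl
    (fun h4 => hr (Iff.symm h4))
  rw [cutCount_eq_apexChanges_one, cutCount_eq_apexChanges_one] at e4
  rw [Finset.sum_add_distrib, Finset.sum_add_distrib] at e3
  simp only at e4
  omega

lemma exists_perm_expSum_ne (φ : FreeGroup X ≃* FreeGroup X) :
    ∃ σ : Equiv.Perm X, ∀ x, expSum (σ x) (φ (of x)) ≠ 1 := by
  let M : (FreeGroup X ≃* FreeGroup X) → Matrix X X ℤ :=
    fun ψ => Matrix.of fun x y => (expSum y (ψ (of x))).toAdd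
  have key : ∀ (ψ : FreeGroup X ≃* FreeGroup X) (g : FreeGroup X) (z : X),
      (expSum z (ψ g)).toAdd = ∑ y, (expSum y g).toAdd * M ψ y z := by
    intro ψ g z
    induction g using FreeGroup.induction_on with
    | C1 => simp
    | of x => simp [expSum, M, Finset.sum_ite_eq]
    | inv_of x ih => simpa using ih
    | mul a b ha hb => simp [ha, hb, add_mul, Finset.sum_add_distrib]
  have hprod : M φ * M φ.symm = 1 := by
    ext x z
    rw [Matrix.mul_apply]
    have := key φ.symm (φ (of x)) z
    rw [φ.symm_apply_apply] at this
    refine Eq.trans this.symm ?_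
    simp [expSum, Matrix.one_apply]
  have hdet : (M φ).det ≠ 0 := by
    intro h0
    have := congrArg Matrix.det hprod
    simp [h0] at this
  by_contra! hcon
  apply hdet
  rw [← Matrix.det_transpose, Matrix.det_apply]
  refine Finset.sum_eq_zero fun σ _ => ?_
  obtain ⟨x, hx⟩ := hcon σ
  rw [Finset.prod_eq_zero (Finset.mem_univ x) (by simp [M, hx]), smul_zero]

lemma sum_letterCount (W : ZMod n → X × Bool) : ∑ x, letterCount W x = n := by
  have := Finset.card_eq_sum_card_fiberwise (s := (Finset.univ : Finset (ZMod n)))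
    (t := (Finset.univ : Finset X)) (f := fun j => (W j).1) (by intro _ _; simp)
  rw [Finset.card_univ, ZMod.card] at this
  refine Eq.trans (Finset.sum_congr rfl fun x _ => ?_) this.symm
  rw [letterCount]
  congr

/-- If no Whitehead automorphism shortens a pair of cyclically reduced words, then no automorphism
does. -/
lemma add_le_length_add_length (hV : ∀ i, V (i + 1) ≠ letterInv (V i))
    (hW : ∀ i, W (i + 1) ≠ letterInv (W i)) (hV1 : periodProd V ≠ 1) (hW1 : periodProd W ≠ 1)
    (hmin : ∀ (A : Set (X × Bool)) (a : X × Bool), a ∈ A → letterInv a ∉ A →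
      letterCount V a.1 + letterCount W a.1 ≤ cutCount V A + cutCount W A)
    {φ : FreeGroup X ≃* FreeGroup X} {s t : FreeGroup X} {K L : List (X × Bool)}
    (hK : φ (periodProd V) = s * FreeGroup.mk K * s⁻¹)
    (hL : φ (periodProd W) = t * FreeGroup.mk L * t⁻¹) :
    m + n ≤ K.length + L.length := by
  obtain ⟨σ, hσ⟩ := exists_perm_expSum_ne φ
  rw [← sum_letterCount V, ← sum_letterCount W, ← sum_occurrences K, ← sum_occurrences L,
    ← Finset.sum_add_distrib, ← Finset.sum_add_distrib,
    ← Equiv.sum_comp σ fun y => occurrences K y + occurrences L y]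
  exact Finset.sum_le_sum fun x _ =>
    letterCount_le_occurrences hV hW hV1 hW1 hmin hK hL (hσ x)

end Comparison

section CyclicWords

variable {X : Type} {n : ℕ}

lemma lineStep_natCast_fst (W : ZMod n → X × Bool) (k : ℕ) :
    ((lineStep W ^ (k : ℤ)) (1, 0)).1 = ((List.range k).map fun j : ℕ => letter (W j)).prod := by
  induction k with
  | zero => simp
  | succ k ih =>
    push_cast
    rw [lineStep_zpow_succ, lineStep_apply, lineStep_zpow_snd, ih, List.range_succ]
    simp

lemma prod_map_letter (L : List (X × Bool)) : (L.map letter).prod = FreeGroup.mk L := by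
  induction L with
  | nil => rfl
  | cons d L ih =>
    rw [List.map_cons, List.prod_cons, ih, letter, FreeGroup.mul_mk]; rfl

lemma exists_mk_of_mem_closure {Z : Set X} {g : FreeGroup X}
    (hg : g ∈ Subgroup.closure (of '' Z)) : ∃ L, FreeGroup.mk L = g ∧ ∀ d ∈ L, d.1 ∈ Z := by
  induction hg using Subgroup.closure_induction with
  | mem g hg =>
    obtain ⟨x, hx, rfl⟩ := hg
    exact ⟨[(x, true)], rfl, by simpa using hx⟩
  | one => exact ⟨[], rfl, by simp⟩
  | mul g h _ _ ihg ihh =>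
    obtain ⟨K, rfl, hK⟩ := ihg
    obtain ⟨L, rfl, hL⟩ := ihh
    refine ⟨K ++ L, FreeGroup.mul_mk.symm, fun d hd => ?_⟩
    rcases List.mem_append.mp hd with h | h
    exacts [hK d h, hL d h]
  | inv g _ ih =>
    obtain ⟨K, rfl, hK⟩ := ih
    refine ⟨FreeGroup.invRev K, FreeGroup.inv_mk.symm, fun d hd => ?_⟩
    simp only [FreeGroup.invRev, List.mem_reverse, List.mem_map] at hd
    obtain ⟨e, he, rfl⟩ := hd
    exact hK e he

lemma letter_mem_closure {Z : Set X} {d : X × Bool} (hd : d.1 ∈ Z) :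
    letter d ∈ Subgroup.closure (of '' Z) := by
  have h1 : of d.1 ∈ Subgroup.closure (of '' Z) :=
    Subgroup.subset_closure (Set.mem_image_of_mem _ hd)
  rcases d with ⟨x, b⟩
  cases b with
  | true => exact h1
  | false => rw [letter_false]; exact inv_mem h1

variable [DecidableEq X] {c : ConjClasses (FreeGroup X)}

lemma cycLen_le {g : FreeGroup X} (hg : ConjClasses.mk g = c) : cycLen c ≤ FreeGroup.norm g :=
  Nat.sInf_le ⟨g, hg, rfl⟩

lemma isCycRed_iff (g : FreeGroup X) : IsCycRed g ↔ IsCyclicallyReduced g.toWord := by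
  rw [IsCycRed, IsCyclicallyReduced]
  constructor
  · refine fun h => ⟨FreeGroup.isReduced_toWord, fun a ha b hb hab => ?_⟩
    by_contra hne
    refine h b hb ?_
    rw [Option.mem_def.mp ha, ← hab, ← Bool.eq_not_of_ne hne]
  · rintro ⟨-, h⟩ x hx hx'
    have := h _ hx' _ hx rfl
    simp at this

lemma exists_isCycRed (c : ConjClasses (FreeGroup X)) :
    ∃ g, ConjClasses.mk g = c ∧ FreeGroup.norm g = cycLen c ∧ IsCycRed g := by
  obtain ⟨g, hg, hgl⟩ := Nat.sInf_mem (s := {n | ∃ g : FreeGroup X, ConjClasses.mk g = c ∧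
    (FreeGroup.toWord g).length = n}) (by
      obtain ⟨g, hg⟩ := ConjClasses.exists_rep c
      exact ⟨_, g, hg, rfl⟩)
  refine ⟨g, hg, hgl, ?_⟩
  rw [isCycRed_iff]
  have h1 : ConjClasses.mk (FreeGroup.mk (reduceCyclically g.toWord)) = c := by
    rw [← hg, ConjClasses.mk_eq_mk_iff_isConj, isConj_iff]
    exact ⟨_, (eq_conj_reduceCyclically g).symm⟩
  have h2 : cycLen c ≤ (reduceCyclically g.toWord).length := (cycLen_le h1).trans norm_mk_le
  have h3 := reduceCyclically.conj_conjugator_reduceCyclically g.toWord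
  have h4 := congrArg List.length h3
  rw [List.length_append, List.length_append, hgl] at h4
  have h5 : reduceCyclically.conjugator g.toWord = [] := List.length_eq_zero_iff.mp (by
    change _ = cycLen c at h4
    omega)
  rw [h5] at h3
  simp only [FreeGroup.invRev_empty, List.append_nil, List.nil_append] at h3
  rw [← h3]
  exact reduceCyclically.isCyclicallyReduced FreeGroup.isReduced_toWord

/-- A nontrivial cyclic word is represented by a cyclically reduced periodic word. -/
lemma exists_periodProd (hc : c ≠ ConjClasses.mk 1) :
    ∃ W : ZMod (cycLen c) → X × Bool, NeZero (cycLen c) ∧ (∀ i, W (i + 1) ≠ letterInv (W i)) ∧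
      ConjClasses.mk (periodProd W) = c ∧ ∀ i, (W i).1 ∈ usedLetters c := by
  obtain ⟨g, hg, hgl, hred⟩ := exists_isCycRed c
  have hlen : g.toWord.length = cycLen c := hgl
  have h0 : cycLen c ≠ 0 := by
    rw [← hgl]
    intro h1
    rw [FreeGroup.norm_eq_zero] at h1
    exact hc (by rw [← hg, h1])
  have hne : NeZero (cycLen c) := ⟨h0⟩
  refine ⟨fun i => g.toWord[i.val]'(by rw [hlen]; exact ZMod.val_lt i), hne, ?_, ?_, ?_⟩
  · intro i h1
    have hi := ZMod.val_lt i
    have hcyc := (isCycRed_iff g).mp hred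
    by_cases hi' : i.val + 1 < cycLen c
    · have h2 : (i + 1).val = i.val + 1 := by
        rw [← ZMod.val_cast_of_lt hi', Nat.cast_add_one, ZMod.natCast_zmod_val]
      have h3 := List.isChain_iff_getElem.mp hcyc.isReduced i.val (by omega)
      simp only [h2] at h1
      rw [h1] at h3
      simpa [letterInv] using h3 rfl
    · have h2 : i + 1 = 0 := by
        rw [← ZMod.natCast_zmod_val i]
        have : i.val + 1 = cycLen c := by omega
        rw [← Nat.cast_add_one, this, ZMod.natCast_self]
      have h3 := hcyc.2 (g.toWord[i.val]'(by omega)) (by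
        rw [List.getLast?_eq_getElem?, Option.mem_def, List.getElem?_eq_some_iff]
        exact ⟨by omega, by congr 1; omega⟩) (g.toWord[0]'(by omega)) (by
        rw [List.head?_eq_getElem?, Option.mem_def, List.getElem?_eq_some_iff]
        exact ⟨by omega, rfl⟩)
      simp only [h2, ZMod.val_zero] at h1
      rw [h1] at h3
      simpa [letterInv] using h3 rfl
  · refine Eq.trans (congrArg _ ?_) hg
    rw [periodProd, lineStep_natCast_fst]
    refine Eq.trans (congrArg List.prod ?_) ((prod_map_letter _).trans FreeGroup.mk_toWord)
    apply List.ext_getElem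
    · simp [hlen]
    · intro j hj _
      have hj' : j < cycLen c := by simpa using hj
      simp [ZMod.val_natCast, Nat.mod_eq_of_lt hj']
  · exact fun i => ⟨g, hg, hred, (g.toWord[i.val]'(by rw [hlen]; exact ZMod.val_lt i)).2,
      List.getElem_mem _⟩

lemma usedLetters_subset {Z : Set X} {g : FreeGroup X} (hg : ConjClasses.mk g = c)
    (hgZ : g ∈ Subgroup.closure (of '' Z)) : usedLetters c ⊆ Z := by
  rintro z ⟨f, hf, hred, b, hb⟩
  by_contra hz
  obtain ⟨L, rfl, hL⟩ := exists_mk_of_mem_closure hgZ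
  rw [← hg, ConjClasses.mk_eq_mk_iff_isConj, isConj_comm, isConj_iff] at hf
  obtain ⟨u, rfl⟩ := hf
  rw [isCycRed_iff] at hred
  set f := u * FreeGroup.mk L * u⁻¹ with hf
  set p : X × Bool → Bool := fun d => d.1 = z with hp
  set k := u.toWord.countP p + u⁻¹.toWord.countP p + 1 with hk
  have h1 : (f ^ k).toWord = (List.replicate k f.toWord).flatten := by
    rw [FreeGroup.toWord_pow, (hred.flatten_replicate _).isReduced.reduce_eq]
  have h2 : (f ^ k) = FreeGroup.mk (u.toWord ++ (List.replicate k L).flatten ++ u⁻¹.toWord) := by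
    rw [hf, conj_pow, FreeGroup.pow_mk, ← FreeGroup.mul_mk, ← FreeGroup.mul_mk,
      FreeGroup.mk_toWord, FreeGroup.mk_toWord]
  have h3 : (f ^ k).toWord.Sublist (u.toWord ++ (List.replicate k L).flatten ++ u⁻¹.toWord) := by
    rw [h2, FreeGroup.toWord_mk]
    exact FreeGroup.Red.sublist FreeGroup.reduce.red
  have h4 := h3.countP_le (p := p)
  have h5 : L.countP p = 0 := by
    rw [List.countP_eq_zero]
    intro d hd hpd
    exact hz (by simpa [hp] using (of_decide_eq_true hpd) ▸ hL d hd)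
  have h6 : 0 < f.toWord.countP p := List.countP_pos_iff.mpr ⟨(z, b), hb, by simp [hp]⟩
  rw [h1, List.countP_append, List.countP_append, List.countP_flatten, List.countP_flatten,
    List.map_replicate, List.map_replicate, h5, List.sum_replicate, List.sum_replicate] at h4
  simp only [smul_eq_mul, mul_zero] at h4
  nlinarith

lemma usedLetters_actC_subset {Z : Set X} (hc : usedLetters c ⊆ Z)
    {τ : FreeGroup X ≃* FreeGroup X} (hτ : ∀ x ∈ Z, τ (of x) ∈ Subgroup.closure (of '' Z)) :
    usedLetters (actC τ c) ⊆ Z := by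
  obtain ⟨g, hg, -, hred⟩ := exists_isCycRed c
  have h1 : g ∈ Subgroup.closure (of '' Z) := by
    rw [← FreeGroup.mk_toWord (x := g), ← prod_map_letter]
    refine list_prod_mem fun f hf => ?_
    obtain ⟨d, hd, rfl⟩ := List.mem_map.mp hf
    exact letter_mem_closure (hc ⟨g, hg, hred, d.2, hd⟩)
  refine usedLetters_subset (g := τ g) (by rw [← hg]; rfl) ?_
  have h2 : Subgroup.closure (of '' Z) ≤
      (Subgroup.closure (of '' Z)).comap (τ : FreeGroup X →* FreeGroup X) := by
    rw [Subgroup.closure_le]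
    rintro _ ⟨x, hx, rfl⟩
    exact hτ x hx
  exact h2 h1

end CyclicWords

section WhiteheadAutomorphisms

open scoped Classical

variable {X : Type} [DecidableEq X] (A : Set (X × Bool)) (z : X)

/-- The endomorphism which fixes `z` and multiplies the ends of the other letters that lie in `A`
by the `k`-th power of `z`. -/
noncomputable def twist (k : ℤ) : FreeGroup X →* FreeGroup X :=
  FreeGroup.lift fun x => if x = z then of x else
    (if (x, true) ∈ A then of z ^ k else 1)⁻¹ * of x * if (x, false) ∈ A then of z ^ k else 1

@[simp] lemma twist_self (k : ℤ) : twist A z k (of z) = of z := by simp [twist]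

lemma twist_of_ne {x : X} (hx : x ≠ z) (k : ℤ) :
    twist A z k (of x) =
      (if (x, true) ∈ A then of z ^ k else 1)⁻¹ * of x *
        if (x, false) ∈ A then of z ^ k else 1 := by
  simp [twist, hx]

lemma twist_comp_twist {j k : ℤ} (hjk : j + k = 0) :
    (twist A z j).comp (twist A z k) = MonoidHom.id _ := by
  obtain rfl : j = -k := by omega
  refine FreeGroup.ext_hom _ _ fun x => ?_
  by_cases hx : x = z
  · subst hx; simp
  · rw [MonoidHom.comp_apply, twist_of_ne A z hx, _root_.map_mul, _root_.map_mul, _root_.map_inv,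
      twist_of_ne A z hx]
    split_ifs <;> simp [mul_assoc]

/-- `twist` as an automorphism. -/
noncomputable def twistEquiv (k : ℤ) : FreeGroup X ≃* FreeGroup X :=
  (twist A z k).toMulEquiv (twist A z (-k)) (twist_comp_twist A z (by omega))
    (twist_comp_twist A z (by omega))

lemma twistEquiv_apply (k : ℤ) (g : FreeGroup X) : twistEquiv A z k g = twist A z k g := rfl

lemma twistEquiv_mem_closure {Z : Set X} (hz : z ∈ Z) {x : X} (hx : x ∈ Z) (k : ℤ) :
    twistEquiv A z k (of x) ∈ Subgroup.closure (of '' Z) := by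
  have h1 : ∀ y ∈ Z, of y ∈ Subgroup.closure (of '' Z) :=
    fun y hy => Subgroup.subset_closure (Set.mem_image_of_mem _ hy)
  have h2 : ∀ p : Prop, (if p then of z ^ k else 1) ∈ Subgroup.closure (of '' Z) := by
    intro p
    split
    exacts [zpow_mem (h1 z hz) k, one_mem _]
  rw [twistEquiv_apply]
  by_cases hxz : x = z
  · subst hxz; simpa using h1 x hx
  · rw [twist_of_ne A z hxz]
    exact mul_mem (mul_mem (inv_mem (h2 _)) (h1 x hx)) (h2 _)

lemma twistEquiv_eq_self {Z : Set X} (hA : ∀ d ∈ A, d.1 ∈ Z) {x : X} (hx : x ∉ Z) (k : ℤ) :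
    twistEquiv A z k (of x) = of x := by
  rw [twistEquiv_apply]
  by_cases hxz : x = z
  · subst hxz; simp
  · rw [twist_of_ne A z hxz, if_neg fun h => hx (hA _ h), if_neg fun h => hx (hA _ h)]
    simp

variable {z}

lemma isWhiteheadMult_twistEquiv (a : X × Bool) :
    IsWhiteheadMult (letterInv a) (twistEquiv A a.1 (multExp a)) := by
  intro x
  have h1 : FreeGroup.mk [letterInv a] = of a.1 ^ multExp a := by
    rw [of_zpow_multExp, ← letter_letterInv]; rfl
  rw [twistEquiv_apply, h1]
  by_cases hx : x = a.1
  · subst hx; simp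
  · rw [twist_of_ne A _ hx]
    split_ifs <;> simp

variable {A}

/-- The factor by which the automorphism changes the end of the letter `d`. -/
noncomputable def endFactor (A : Set (X × Bool)) (a d : X × Bool) : FreeGroup X :=
  if letterInv d ∈ A then (letter a)⁻¹ else 1

lemma twist_letter {a : X × Bool} (ha : a ∈ A) (ha' : letterInv a ∉ A) (d : X × Bool) :
    twist A a.1 (multExp a) (letter d) =
      (endFactor A a (letterInv d))⁻¹ * (if d.1 = a.1 then 1 else letter d) *
        endFactor A a d := by
  by_cases hd : d.1 = a.1
  · have h1 : twist A a.1 (multExp a) (letter d) = letter d := by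
      rcases d with ⟨x, b⟩
      simp only at hd
      subst hd
      cases b <;> simp [letter_true, letter_false]
    rw [h1, if_pos hd]
    rcases fst_eq_iff.mp hd with rfl | rfl <;> simp [endFactor, ha, ha']
  · rw [if_neg hd]
    rcases d with ⟨x, b⟩
    cases b <;>
      simp [letter_true, letter_false, twist_of_ne A _ hd, of_zpow_multExp, endFactor, letterInv]
    split_ifs <;> simp [mul_assoc]

variable {n : ℕ}

lemma norm_le_of_natCast (W : ZMod n → X × Bool) {a : X × Bool} (ha : a ∈ A)
    (ha' : letterInv a ∉ A) (k : ℕ) :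
    FreeGroup.norm (endFactor A a (W (-1)) *
        twist A a.1 (multExp a) ((lineStep W ^ (k : ℤ)) (1, 0)).1 *
        (endFactor A a (W (k - 1)))⁻¹) ≤
      ∑ j ∈ Finset.range k,
        ((if ¬ (letterInv (W (j - 1)) ∈ A ↔ W j ∈ A) then 1 else 0) +
          if (W j).1 = a.1 then 0 else 1) := by
  induction k with
  | zero => simp
  | succ k ih =>
    rw [Finset.sum_range_succ]
    push_cast
    rw [lineStep_zpow_succ, lineStep_apply, lineStep_zpow_snd]
    simp only [zero_add, Int.cast_natCast, add_sub_cancel_right]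
    rw [_root_.map_mul, twist_letter ha ha']
    set P := twist A a.1 (multExp a) ((lineStep W ^ (k : ℤ)) (1, 0)).1
    have h1 : endFactor A a (W (-1)) * (P * ((endFactor A a (letterInv (W k)))⁻¹ *
        (if (W k).1 = a.1 then 1 else letter (W k)) * endFactor A a (W k))) *
          (endFactor A a (W k))⁻¹ =
        (endFactor A a (W (-1)) * P * (endFactor A a (W (k - 1)))⁻¹) *
          ((endFactor A a (W (k - 1)) * (endFactor A a (letterInv (W k)))⁻¹) *
            (if (W k).1 = a.1 then 1 else letter (W k))) := by group
    rw [h1]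
    refine (FreeGroup.norm_mul_le _ _).trans
      (Nat.add_le_add ih ((FreeGroup.norm_mul_le _ _).trans (Nat.add_le_add ?_ ?_)))
    · have h2 : FreeGroup.norm (letter a) ≤ 1 := norm_letter_le a
      unfold endFactor
      rw [letterInv_letterInv]
      by_cases h3 : letterInv (W (k - 1)) ∈ A <;> by_cases h4 : W k ∈ A <;> simp [h3, h4, h2]
    · split
      · simp
      · exact norm_letter_le _

lemma cycLen_actC_twistEquiv_add_le [NeZero n] (W : ZMod n → X × Bool) {a : X × Bool}
    (ha : a ∈ A) (ha' : letterInv a ∉ A) :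
    cycLen (actC (twistEquiv A a.1 (multExp a)) (ConjClasses.mk (periodProd W))) +
      letterCount W a.1 ≤ n + cutCount W A := by
  have h1 := norm_le_of_natCast W ha ha' n
  have h2 : cycLen (actC (twistEquiv A a.1 (multExp a)) (ConjClasses.mk (periodProd W))) ≤
      FreeGroup.norm (endFactor A a (W (-1)) *
        twist A a.1 (multExp a) (periodProd W) * (endFactor A a (W (n - 1)))⁻¹) := by
    refine cycLen_le ?_
    rw [ZMod.natCast_self, zero_sub]
    refine Eq.trans ?_ (rfl : ConjClasses.mk (twist A a.1 (multExp a) (periodProd W)) = _)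
    rw [ConjClasses.mk_eq_mk_iff_isConj, isConj_comm, isConj_iff]
    exact ⟨_, rfl⟩
  have h3 : ∀ f : ZMod n → ℕ, ∑ j ∈ Finset.range n, f j = ∑ i, f i := by
    intro f
    refine Finset.sum_nbij' (fun j => (j : ZMod n)) ZMod.val ?_ ?_ ?_ ?_ ?_
    · simp
    · simp [ZMod.val_lt]
    · intro j hj; exact ZMod.val_cast_of_lt (by simpa using hj)
    · simp
    · simp
  have h4 := h3 fun i => (if ¬ (letterInv (W (i - 1)) ∈ A ↔ W i ∈ A) then 1 else 0) +
          if (W i).1 = a.1 then 0 else 1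
  have h5 : (∑ i, if (W i).1 = a.1 then 0 else 1) + letterCount W a.1 = n := by
    rw [letterCount, Finset.card_filter, ← Finset.sum_add_distrib]
    conv_rhs => rw [← ZMod.card n, ← Finset.card_univ, Finset.card_eq_sum_ones]
    refine Finset.sum_congr rfl fun i _ => ?_
    split_ifs <;> rfl
  have h6 : ∑ i, (if ¬ (letterInv (W (i - 1)) ∈ A ↔ W i ∈ A) then 1 else 0) = cutCount W A := by
    rw [cutCount, Finset.card_filter]
  rw [Finset.sum_add_distrib (s := Finset.univ), h6] at h4
  have h7 := h2.trans h1
  rw [h4] at h7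
  omega

end WhiteheadAutomorphisms

section GoodPairs

variable {X : Type} [DecidableEq X]

lemma usedLetters_actC_of_disjoint {c : ConjClasses (FreeGroup X)} {Z : Set X}
    (hc : Disjoint (usedLetters c) Z) {A : Set (X × Bool)} (hA : ∀ d ∈ A, d.1 ∈ Z) (z : X)
    (k : ℤ) : usedLetters (actC (twistEquiv A z k) c) ⊆ usedLetters c := by
  refine usedLetters_actC_subset subset_rfl fun x hx => ?_
  rw [twistEquiv_eq_self A z hA (hc.notMem_of_mem_left hx)]
  exact Subgroup.subset_closure (Set.mem_image_of_mem _ hx)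

variable {m n : ℕ} [NeZero m] [NeZero n] {V : ZMod m → X × Bool} {W : ZMod n → X × Bool}

/-- A disjoint pair which is shortened by some Whitehead automorphism whose multiplier occurs in
the first word is shortened by one which only changes letters of the first word. -/
lemma exists_twist_of_disjoint {v w : ConjClasses (FreeGroup X)}
    (hvw : Disjoint (usedLetters v) (usedLetters w))
    (hV : ∀ i, (V i).1 ∈ usedLetters v) (hW : ∀ i, (W i).1 ∈ usedLetters w)
    {A : Set (X × Bool)} {a : X × Bool} (ha : a ∈ A) (ha' : letterInv a ∉ A)
    (hav : a.1 ∈ usedLetters v)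
    (hlt : cutCount V A + cutCount W A < letterCount V a.1 + letterCount W a.1) :
    ∃ B : Set (X × Bool), a ∈ B ∧ letterInv a ∉ B ∧
      cutCount V B + cutCount W B < letterCount V a.1 + letterCount W a.1 ∧
      Disjoint (usedLetters (actC (twistEquiv B a.1 (multExp a)) v))
        (usedLetters (actC (twistEquiv B a.1 (multExp a)) w)) := by
  refine ⟨{d | d ∈ A ∧ d.1 ∈ usedLetters v}, ⟨ha, hav⟩, fun h => ha' h.1, ?_, ?_⟩
  · have h1 : cutCount V {d | d ∈ A ∧ d.1 ∈ usedLetters v} = cutCount V A :=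
      cutCount_congr (fun i => by simp [hV]) (fun i => by simp [letterInv, hV])
    have h2 : cutCount W {d | d ∈ A ∧ d.1 ∈ usedLetters v} = 0 := by
      simp [cutCount, letterInv, fun i => hvw.notMem_of_mem_right (hW i)]
    omega
  · exact hvw.mono
      (usedLetters_actC_subset subset_rfl fun x hx => twistEquiv_mem_closure _ _ hav hx _)
      (usedLetters_actC_of_disjoint hvw.symm (fun d hd => hd.2) _ _)

lemma exists_twist_of_goodPair {v w : ConjClasses (FreeGroup X)} (hvw : GoodPair v w)
    (hV : ∀ i, (V i).1 ∈ usedLetters v) (hW : ∀ i, (W i).1 ∈ usedLetters w)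
    {A : Set (X × Bool)} {a : X × Bool} (ha : a ∈ A) (ha' : letterInv a ∉ A)
    (hlt : cutCount V A + cutCount W A < letterCount V a.1 + letterCount W a.1) :
    ∃ B : Set (X × Bool), a ∈ B ∧ letterInv a ∉ B ∧
      cutCount V B + cutCount W B < letterCount V a.1 + letterCount W a.1 ∧
      GoodPair (actC (twistEquiv B a.1 (multExp a)) v) (actC (twistEquiv B a.1 (multExp a)) w) := by
  rcases hvw with hf | hd
  · refine ⟨A, ha, ha', hlt, Or.inl ?_⟩
    obtain ⟨z, hz⟩ := (Set.ne_univ_iff_exists_notMem _).mp hf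
    rw [Set.mem_union, not_or] at hz
    have haz : a.1 ≠ z := by
      rintro rfl
      rw [letterCount_eq_zero hV hz.1, letterCount_eq_zero hW hz.2] at hlt
      omega
    have key : ∀ c, z ∉ usedLetters c →
        z ∉ usedLetters (actC (twistEquiv A a.1 (multExp a)) c) := by
      intro c hc hc'
      refine usedLetters_actC_subset (Z := {z}ᶜ) ?_ (fun x hx => ?_) hc' rfl
      · rintro x hx rfl; exact hc hx
      · exact twistEquiv_mem_closure _ _ haz hx _
    exact (Set.ne_univ_iff_exists_notMem _).mpr ⟨z, fun h => h.elim (key v hz.1) (key w hz.2)⟩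
  · have hd' : Disjoint (usedLetters v) (usedLetters w) := Set.disjoint_iff_inter_eq_empty.mpr hd
    by_cases hav : a.1 ∈ usedLetters v
    · obtain ⟨B, h1, h2, h3, h4⟩ := exists_twist_of_disjoint hd' hV hW ha ha' hav hlt
      exact ⟨B, h1, h2, h3, Or.inr h4.inter_eq⟩
    by_cases haw : a.1 ∈ usedLetters w
    · obtain ⟨B, h1, h2, h3, h4⟩ := exists_twist_of_disjoint hd'.symm hW hV ha ha' haw (by omega)
      exact ⟨B, h1, h2, by omega, Or.inr h4.symm.inter_eq⟩
    rw [letterCount_eq_zero hV hav, letterCount_eq_zero hW haw] at hlt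
    omega

lemma exists_eq_conj_toWord {c : ConjClasses (FreeGroup X)} {g : FreeGroup X}
    (hg : ConjClasses.mk g = c) (φ : FreeGroup X ≃* FreeGroup X) :
    ∃ (s : FreeGroup X) (K : List (X × Bool)), φ g = s * FreeGroup.mk K * s⁻¹ ∧
      K.length = cycLen (actC φ c) := by
  obtain ⟨f, hf, hfl, -⟩ := exists_isCycRed (actC φ c)
  have h1 : ConjClasses.mk f = ConjClasses.mk (φ g) := by rw [hf, ← hg]; rfl
  rw [ConjClasses.mk_eq_mk_iff_isConj, isConj_iff] at h1
  obtain ⟨s, hs⟩ := h1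
  exact ⟨s, f.toWord, by rw [FreeGroup.mk_toWord, hs], hfl⟩

end GoodPairs

/-- If `(v, w)` is a good pair of nontrivial cyclic words that does not have
minimal length in its `Aut(F)`-orbit, then some Whitehead automorphism `τ` makes
`(τ(v), τ(w))` a good pair of strictly smaller total length. -/
theorem good_pair_length_reduction {X : Type} [DecidableEq X] [Fintype X]
    (v w : ConjClasses (FreeGroup X))
    (hv : v ≠ ConjClasses.mk 1) (hw : w ≠ ConjClasses.mk 1)
    (hgood : GoodPair v w) (hmin : ¬ MinLenPair v w) :
    ∃ τ : FreeGroup X ≃* FreeGroup X, IsWhitehead τ ∧ GoodPair (actC τ v) (actC τ w) ∧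
      cycLen (actC τ v) + cycLen (actC τ w) < cycLen v + cycLen w := by
  obtain ⟨V, _, hV, hVv, hVu⟩ := exists_periodProd hv
  obtain ⟨W, _, hW, hWw, hWu⟩ := exists_periodProd hw
  by_contra hcon
  apply hmin
  intro φ
  obtain ⟨s, K, hK, hKl⟩ := exists_eq_conj_toWord hVv φ
  obtain ⟨t, L, hL, hLl⟩ := exists_eq_conj_toWord hWw φ
  rw [← hKl, ← hLl]
  refine add_le_length_add_length hV hW (fun h => hv (by rw [← hVv, h]))
    (fun h => hw (by rw [← hWw, h])) (fun A a ha ha' => ?_) hK hL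
  by_contra! hlt
  obtain ⟨B, hB, hB', hltB, hgoodB⟩ := exists_twist_of_goodPair hgood hVu hWu ha ha' hlt
  refine hcon ⟨_, Or.inr ⟨_, isWhiteheadMult_twistEquiv B a⟩, hgoodB, ?_⟩
  have h1 := cycLen_actC_twistEquiv_add_le V hB hB'
  have h2 := cycLen_actC_twistEquiv_add_le W hB hB'
  rw [hVv] at h1
  rw [hWw] at h2
  omega
end

section
/- Let F = F(X) with X finite, let (v, w) be a good pair of cyclic words of minimal length in its Aut(F)-orbit, and let τ be a Whitehead automorphism such that (τ(v), τ(w)) also has minimal length. Then (τ(v), τ(w)) is good. -/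
open FreeGroup

open FreeGroup

section ConjClasses

variable {G H K : Type*} [Monoid G] [Monoid H] [Monoid K]

theorem ConjClasses.map_mk (f : G →* H) (g : G) :
    ConjClasses.map f (ConjClasses.mk g) = ConjClasses.mk (f g) := rfl

theorem ConjClasses.map_map (f : G →* H) (k : H →* K) (c : ConjClasses G) :
    ConjClasses.map k (ConjClasses.map f c) = ConjClasses.map (k.comp f) c := by
  induction c using Quotient.inductionOn; rfl

theorem ConjClasses.map_id (c : ConjClasses G) : ConjClasses.map (MonoidHom.id G) c = c := by
  induction c using Quotient.inductionOn; rfl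

end ConjClasses

section CyclicWords

variable {X : Type}

theorem FreeGroup.map_mk_congr {G : Type*} [Group G] {f g : FreeGroup X →* G}
    (L : List (X × Bool)) (h : ∀ p ∈ L, f (of p.1) = g (of p.1)) : f (mk L) = g (mk L) := by
  induction L with
  | nil => rw [← one_eq_mk, _root_.map_one, _root_.map_one]
  | cons p L ih =>
    have hp : f (mk [p]) = g (mk [p]) := by
      have h1 := h p (by simp)
      obtain ⟨x, b⟩ := p
      cases b
      · have h2 : (mk [(x, false)] : FreeGroup X) = (of x)⁻¹ := rfl
        rw [h2, _root_.map_inv, _root_.map_inv, h1]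
      · exact h1
    have h2 : (mk (p :: L) : FreeGroup X) = mk [p] * mk L := by rw [mul_mk]; rfl
    rw [h2, _root_.map_mul, _root_.map_mul, hp, ih fun q hq => h q (by simp [hq])]

variable [DecidableEq X]

theorem isCyclicallyReduced_toWord_iff {g : FreeGroup X} :
    IsCyclicallyReduced g.toWord ↔ IsCycRed g := by
  simp only [isCyclicallyReduced_iff, isReduced_toWord, true_and, IsCycRed, Option.mem_def]
  constructor
  · intro h x hx hl
    simpa using h _ hl _ hx rfl
  · rintro h ⟨a, s⟩ ha ⟨b, t⟩ hb hab
    have := h _ hb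
    rw [ha] at this
    simp only at hab
    subst hab
    cases s <;> cases t <;> simp_all

theorem exists_isCycRed_rep (c : ConjClasses (FreeGroup X)) :
    ∃ g, ConjClasses.mk g = c ∧ IsCycRed g := by
  obtain ⟨g, rfl⟩ := ConjClasses.mk_surjective c
  have hred := reduceCyclically.isCyclicallyReduced (isReduced_toWord (x := g))
  refine ⟨mk (reduceCyclically g.toWord), ?_, ?_⟩
  · rw [ConjClasses.mk_eq_mk_iff_isConj, isConj_iff]
    refine ⟨mk (reduceCyclically.conjugator g.toWord), ?_⟩
    rw [inv_mk, mul_mk, mul_mk, reduceCyclically.conj_conjugator_reduceCyclically, mk_toWord]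
  · rwa [← isCyclicallyReduced_toWord_iff, toWord_mk, hred.isReduced.reduce_eq]

theorem IsCycRed.norm_pow {g : FreeGroup X} (hg : IsCycRed g) (n : ℕ) :
    (g ^ n).norm = n * g.norm := by
  rw [← isCyclicallyReduced_toWord_iff] at hg
  rw [FreeGroup.norm, toWord_pow, (hg.flatten_replicate n).isReduced.reduce_eq]
  simp [FreeGroup.norm]

theorem FreeGroup.norm_pow_le (g : FreeGroup X) (n : ℕ) : (g ^ n).norm ≤ n * g.norm := by
  induction n with
  | zero => simp
  | succ n ih =>
    rw [pow_succ, add_mul, one_mul]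
    exact (norm_mul_le _ _).trans (by omega)

theorem IsCycRed.norm_le_of_isConj {g h : FreeGroup X} (hg : IsCycRed g) (hgh : IsConj h g) :
    g.norm ≤ h.norm := by
  obtain ⟨k, rfl⟩ := isConj_iff.1 hgh
  by_contra! hlt
  set n := 2 * k.norm + 1 with hn
  have h1 := hg.norm_pow n
  rw [conj_pow] at h1
  have h2 := norm_mul_le (k * h ^ n) k⁻¹
  have h3 := norm_mul_le k (h ^ n)
  have h4 := FreeGroup.norm_pow_le h n
  have h5 : n * (h.norm + 1) ≤ n * (k * h * k⁻¹).norm := Nat.mul_le_mul_left n hlt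
  rw [norm_inv_eq] at h2
  rw [mul_add, mul_one] at h5
  omega

theorem cycLen_mk_le (g : FreeGroup X) : cycLen (ConjClasses.mk g) ≤ g.norm :=
  Nat.sInf_le ⟨g, rfl, rfl⟩

theorem IsCycRed.cycLen_mk {g : FreeGroup X} (hg : IsCycRed g) :
    cycLen (ConjClasses.mk g) = g.norm := by
  refine le_antisymm (cycLen_mk_le g) (le_csInf ⟨_, g, rfl, rfl⟩ ?_)
  rintro _ ⟨h, hh, rfl⟩
  exact hg.norm_le_of_isConj (ConjClasses.mk_eq_mk_iff_isConj.1 hh)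

theorem map_congr_of_usedLetters {G : Type*} [Group G] {f g : FreeGroup X →* G}
    {c : ConjClasses (FreeGroup X)} (h : ∀ x ∈ usedLetters c, f (of x) = g (of x)) :
    ConjClasses.map f c = ConjClasses.map g c := by
  obtain ⟨u, hu, hred⟩ := exists_isCycRed_rep c
  have huv : f u = g u := by
    rw [← mk_toWord (x := u)]
    exact map_mk_congr _ fun p hp => h _ ⟨u, hu, hred, p.2, hp⟩
  rw [← hu, ConjClasses.map_mk, ConjClasses.map_mk, huv]

/-- The endomorphism of the free group sending the generator `z` to `1` and fixing the others. -/
def killLetter (z : X) : FreeGroup X →* FreeGroup X :=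
  FreeGroup.lift fun x => if x = z then 1 else of x

theorem killLetter_of_ne {x z : X} (h : x ≠ z) : killLetter z (of x) = of x := by
  simp [killLetter, h]

theorem killLetter_of_self (z : X) : killLetter z (of z) = 1 := by
  simp [killLetter]

theorem killLetter_mk (z : X) (L : List (X × Bool)) :
    killLetter z (mk L) = mk (L.filter fun p => p.1 ≠ z) := by
  induction L with
  | nil => rfl
  | cons p L ih =>
    have h2 : (mk (p :: L) : FreeGroup X) = mk [p] * mk L := by rw [mul_mk]; rfl
    rw [h2, _root_.map_mul, ih]
    obtain ⟨x, b⟩ := p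
    by_cases hx : x = z <;> cases b <;> simp [killLetter, hx, invRev, of]

theorem norm_killLetter_lt {z : X} {b : Bool} {g : FreeGroup X} (h : (z, b) ∈ g.toWord) :
    (killLetter z g).norm < g.norm := by
  conv_lhs => rw [← mk_toWord (x := g), killLetter_mk]
  refine norm_mk_le.trans_lt (List.length_filter_lt_length_iff_exists.2 ⟨(z, b), h, by simp⟩)

theorem cycLen_map_killLetter_lt {z : X} {c : ConjClasses (FreeGroup X)}
    (hz : z ∈ usedLetters c) : cycLen (ConjClasses.map (killLetter z) c) < cycLen c := by
  obtain ⟨g, rfl, hred, b, hb⟩ := hz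
  rw [hred.cycLen_mk, ConjClasses.map_mk]
  exact (cycLen_mk_le _).trans_lt (norm_killLetter_lt hb)

theorem map_killLetter_of_notMem {z : X} {c : ConjClasses (FreeGroup X)}
    (hz : z ∉ usedLetters c) : ConjClasses.map (killLetter z) c = c := by
  conv_rhs => rw [← ConjClasses.map_id c]
  exact map_congr_of_usedLetters fun x hx => killLetter_of_ne fun h => hz (h ▸ hx)

theorem cycLen_map_killLetter_le (z : X) (c : ConjClasses (FreeGroup X)) :
    cycLen (ConjClasses.map (killLetter z) c) ≤ cycLen c := by
  by_cases hz : z ∈ usedLetters c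
  · exact (cycLen_map_killLetter_lt hz).le
  · rw [map_killLetter_of_notMem hz]

theorem notMem_usedLetters_map {z : X} {f : FreeGroup X →* FreeGroup X}
    {c : ConjClasses (FreeGroup X)}
    (h : ∀ x ∈ usedLetters c, killLetter z (f (of x)) = f (of x)) :
    z ∉ usedLetters (ConjClasses.map f c) := by
  intro hz
  have hlt := cycLen_map_killLetter_lt hz
  rw [ConjClasses.map_map, map_congr_of_usedLetters (g := f) h] at hlt
  exact hlt.false

end CyclicWords

section Transvections

variable {X : Type}

/-- The endomorphism of the free group sending each generator `x` to `a ^ m x * x * a ^ n x`,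
where `a` is a fixed generator. -/
def zpowMulHom (a : X) (m n : X → ℤ) : FreeGroup X →* FreeGroup X :=
  FreeGroup.lift fun x => of a ^ m x * of x * of a ^ n x

theorem zpowMulHom_of (a : X) (m n : X → ℤ) (x : X) :
    zpowMulHom a m n (of x) = of a ^ m x * of x * of a ^ n x := by
  simp [zpowMulHom]

theorem zpowMulHom_comp_neg {a : X} {m n : X → ℤ} (hm : m a = 0) (hn : n a = 0) :
    (zpowMulHom a m n).comp (zpowMulHom a (-m) (-n)) = MonoidHom.id _ := by
  ext x
  simp only [MonoidHom.comp_apply, zpowMulHom_of, _root_.map_mul, _root_.map_zpow, hm, hn, MonoidHom.id_apply,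
    Pi.neg_apply, zpow_zero, one_mul, mul_one]
  group

/-- The automorphism of the free group sending each generator `x` to `a ^ m x * x * a ^ n x`,
where `a` is a generator that is fixed. -/
def zpowMulEquiv (a : X) (m n : X → ℤ) (hm : m a = 0) (hn : n a = 0) :
    FreeGroup X ≃* FreeGroup X :=
  MonoidHom.toMulEquiv (zpowMulHom a m n) (zpowMulHom a (-m) (-n))
    (by simpa using zpowMulHom_comp_neg (m := -m) (n := -n) (by simp [hm]) (by simp [hn]))
    (zpowMulHom_comp_neg hm hn)

theorem zpowMulEquiv_of (a : X) (m n : X → ℤ) (hm : m a = 0) (hn : n a = 0) (x : X) :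
    zpowMulEquiv a m n hm hn (of x) = of a ^ m x * of x * of a ^ n x :=
  zpowMulHom_of a m n x

theorem FreeGroup.sq_ne_of (y : FreeGroup X) (a : X) : y ^ 2 ≠ of a := by
  intro h
  have h1 := congrArg (FreeGroup.lift fun _ : X => Multiplicative.ofAdd (1 : ℤ)) h
  rw [_root_.map_pow, lift_apply_of] at h1
  have h2 := congrArg Multiplicative.toAdd h1
  rw [toAdd_pow, toAdd_ofAdd, nsmul_eq_mul] at h2
  push_cast at h2
  omega

theorem IsWhiteheadMult.apply_of_self {a : X × Bool} {τ : FreeGroup X ≃* FreeGroup X}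
    (h : IsWhiteheadMult a τ) : τ (of a.1) = of a.1 := by
  have key : τ (of a.1) ≠ 1 := by
    rw [Ne, EmbeddingLike.map_eq_one_iff]
    exact of_ne_one _
  have key2 : τ (of a.1) ≠ of a.1 * of a.1 := by
    intro h2
    have h3 := congrArg τ.symm h2
    rw [_root_.map_mul, τ.symm_apply_apply, ← pow_two] at h3
    exact sq_ne_of _ _ h3.symm
  have h1 := h a.1
  obtain ⟨x, b⟩ := a
  have hf : (mk [(x, false)] : FreeGroup X) = (of x)⁻¹ := rfl
  have ht : (mk [(x, true)] : FreeGroup X) = of x := rfl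
  cases b <;>
  simp only [hf, ht, Set.mem_insert_iff, Set.mem_singleton_iff, inv_inv, mul_inv_cancel,
    inv_mul_cancel, one_mul, mul_assoc, mul_one] at h1 key key2 ⊢ <;> tauto

theorem IsWhiteheadMult.exists_zpow {a : X × Bool} {τ : FreeGroup X ≃* FreeGroup X}
    (h : IsWhiteheadMult a τ) :
    ∃ m n : X → ℤ, m a.1 = 0 ∧ n a.1 = 0 ∧ ∀ x, τ (of x) = of a.1 ^ m x * of x * of a.1 ^ n x := by
  have key : ∀ x, ∃ i j : ℤ, (x = a.1 → i = 0 ∧ j = 0) ∧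
      τ (of x) = of a.1 ^ i * of x * of a.1 ^ j := by
    intro x
    by_cases hx : x = a.1
    · subst hx
      exact ⟨0, 0, by simp, by simp [h.apply_of_self]⟩
    obtain ⟨k, hk⟩ : ∃ k : ℤ, mk [a] = of a.1 ^ k := by
      obtain ⟨y, b⟩ := a
      cases b
      · exact ⟨-1, (zpow_neg_one (of y)).symm⟩
      · exact ⟨1, (zpow_one _).symm⟩
    have h1 := h x
    rw [hk] at h1
    rcases h1 with h1 | h1 | h1 | h1
    · exact ⟨0, 0, by simp [hx], by simp [h1]⟩
    · exact ⟨0, k, by simp [hx], by simp [h1]⟩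
    · exact ⟨-k, 0, by simp [hx], by simp [h1]⟩
    · exact ⟨-k, k, by simp [hx], by rw [h1, zpow_neg]⟩
  choose m n h0 h1 using key
  exact ⟨m, n, (h0 _ rfl).1, (h0 _ rfl).2, h1⟩

end Transvections

section Goodness

variable {X : Type}

theorem actC_actC (φ ψ : FreeGroup X ≃* FreeGroup X) (c : ConjClasses (FreeGroup X)) :
    actC φ (actC ψ c) = actC (ψ.trans φ) c :=
  ConjClasses.map_map _ _ c

theorem actC_refl (c : ConjClasses (FreeGroup X)) : actC (MulEquiv.refl _) c = c :=
  ConjClasses.map_id c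

variable [DecidableEq X]

theorem DisjPair.symm {v w : ConjClasses (FreeGroup X)} (h : DisjPair v w) : DisjPair w v := by
  rwa [DisjPair, Set.inter_comm]

theorem frugal_iff {v w : ConjClasses (FreeGroup X)} :
    Frugal v w ↔ ∃ z, z ∉ usedLetters v ∧ z ∉ usedLetters w := by
  simp [Frugal, Set.ne_univ_iff_exists_notMem]

theorem MinLenPair.symm {v w : ConjClasses (FreeGroup X)} (h : MinLenPair v w) :
    MinLenPair w v := fun φ => by
  rw [add_comm, add_comm (cycLen (actC φ w))]
  exact h φ

theorem MinLenPair.le_of_actC {v w : ConjClasses (FreeGroup X)} {τ : FreeGroup X ≃* FreeGroup X}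
    (h : MinLenPair (actC τ v) (actC τ w)) (ψ : FreeGroup X ≃* FreeGroup X) :
    cycLen (actC τ v) + cycLen (actC τ w) ≤ cycLen (actC ψ v) + cycLen (actC ψ w) := by
  have h1 := h (τ.symm.trans ψ)
  rw [actC_actC, actC_actC] at h1
  have h2 : τ.trans (τ.symm.trans ψ) = ψ := by ext; simp
  rwa [h2] at h1

theorem IsRelabeling.goodPair_actC {v w : ConjClasses (FreeGroup X)}
    {τ : FreeGroup X ≃* FreeGroup X} (hτ : IsRelabeling τ) (h : GoodPair v w) :
    GoodPair (actC τ v) (actC τ w) := by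
  choose σ hσ using hτ
  have hinj : ∀ x y, (σ x).1 = (σ y).1 → x = y := by
    intro x y hxy
    have hx := hσ x
    have hy := hσ y
    have : τ (of x) = τ (of y) ∨ τ (of x) = τ (of y)⁻¹ := by
      rw [_root_.map_inv, hx, hy]
      generalize σ x = p at *
      generalize σ y = q at *
      obtain ⟨p, b⟩ := p
      obtain ⟨q, d⟩ := q
      obtain rfl : p = q := hxy
      cases b <;> cases d <;> simp [invRev]
    rcases this with h1 | h1
    · exact of_injective (τ.injective h1)
    · have h2 := congrArg toWord (τ.injective h1)
      simp [invRev] at h2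
  have hkill : ∀ z x, (σ x).1 ≠ z → killLetter z (τ (of x)) = τ (of x) := by
    intro z x hz
    rw [hσ, killLetter_mk]
    simp [hz]
  have himage : ∀ c z, z ∈ usedLetters (actC τ c) → ∃ x ∈ usedLetters c, (σ x).1 = z := by
    intro c z hz
    by_contra! hno
    exact notMem_usedLetters_map (f := (τ : FreeGroup X →* FreeGroup X))
      (fun x hx => hkill z x (hno x hx)) hz
  rcases h with h | h
  · obtain ⟨z, hv, hw⟩ := frugal_iff.1 h
    refine Or.inl (frugal_iff.2 ⟨(σ z).1, fun hz => ?_, fun hz => ?_⟩)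
    all_goals
      obtain ⟨x, hx, hxz⟩ := himage _ _ hz
      obtain rfl := hinj _ _ hxz
      contradiction
  · refine Or.inr (Set.eq_empty_of_forall_notMem fun z hz => ?_)
    obtain ⟨x, hx, hxz⟩ := himage _ _ hz.1
    obtain ⟨y, hy, hyz⟩ := himage _ _ hz.2
    obtain rfl := hinj x y (hxz.trans hyz.symm)
    exact (h ▸ ⟨hx, hy⟩ : x ∈ (∅ : Set X))

/-- The behaviour of an automorphism which multiplies each generator on both sides by powers of
a fixed generator `a`. -/
structure IsZPowMul (a : X) (m n : X → ℤ) (τ : FreeGroup X ≃* FreeGroup X) : Prop where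
  left_self : m a = 0
  right_self : n a = 0
  apply_of : ∀ x, τ (of x) = of a ^ m x * of x * of a ^ n x

namespace IsZPowMul

variable {a : X} {m n : X → ℤ} {τ : FreeGroup X ≃* FreeGroup X}

theorem usedLetters_actC_subset (h : IsZPowMul a m n τ) (c : ConjClasses (FreeGroup X)) :
    usedLetters (actC τ c) ⊆ insert a (usedLetters c) := by
  intro z hz
  by_contra hno
  rw [Set.mem_insert_iff, not_or] at hno
  refine notMem_usedLetters_map (f := (τ : FreeGroup X →* FreeGroup X)) (fun x hx => ?_) hz
  have hxz : x ≠ z := fun e => hno.2 (e ▸ hx)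
  simp [h.apply_of, killLetter_of_ne hxz, killLetter_of_ne (Ne.symm hno.1)]

theorem map_killLetter_actC (h : IsZPowMul a m n τ) {c : ConjClasses (FreeGroup X)}
    (ha : a ∉ usedLetters c) : ConjClasses.map (killLetter a) (actC τ c) = c := by
  conv_rhs => rw [← ConjClasses.map_id c]
  rw [actC, ConjClasses.map_map]
  refine map_congr_of_usedLetters fun x hx => ?_
  have hxa : x ≠ a := fun e => ha (e ▸ hx)
  simp [h.apply_of, killLetter_of_ne hxa, killLetter_of_self]

theorem cycLen_le_actC (h : IsZPowMul a m n τ) {c : ConjClasses (FreeGroup X)}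
    (ha : a ∉ usedLetters c) : cycLen c ≤ cycLen (actC τ c) := by
  conv_lhs => rw [← h.map_killLetter_actC ha]
  exact cycLen_map_killLetter_le _ _

theorem notMem_usedLetters_actC (h : IsZPowMul a m n τ) {c : ConjClasses (FreeGroup X)}
    (ha : a ∉ usedLetters c) (hle : cycLen (actC τ c) ≤ cycLen c) :
    a ∉ usedLetters (actC τ c) := by
  intro hmem
  have := cycLen_map_killLetter_lt hmem
  rw [h.map_killLetter_actC ha] at this
  omega

theorem frugal_actC (h : IsZPowMul a m n τ) {v w : ConjClasses (FreeGroup X)}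
    (hvw : Frugal v w) (hmin : MinLenPair (actC τ v) (actC τ w)) :
    Frugal (actC τ v) (actC τ w) := by
  obtain ⟨z, hv, hw⟩ := frugal_iff.1 hvw
  refine frugal_iff.2 ⟨z, ?_⟩
  by_cases hz : z = a
  · subst hz
    have h1 := hmin.le_of_actC (MulEquiv.refl _)
    rw [actC_refl, actC_refl] at h1
    have h2 := h.cycLen_le_actC hv
    have h3 := h.cycLen_le_actC hw
    exact ⟨h.notMem_usedLetters_actC hv (by omega), h.notMem_usedLetters_actC hw (by omega)⟩
  · exact ⟨fun hm => ((h.usedLetters_actC_subset v) hm).elim hz hv,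
      fun hm => ((h.usedLetters_actC_subset w) hm).elim hz hw⟩

theorem disjPair_actC (h : IsZPowMul a m n τ) {v w : ConjClasses (FreeGroup X)}
    (hvw : DisjPair v w) (hmin : MinLenPair (actC τ v) (actC τ w)) (ha : a ∈ usedLetters v) :
    DisjPair (actC τ v) (actC τ w) := by
  classical
  have hdisj : ∀ x, x ∈ usedLetters v → x ∉ usedLetters w := fun x hx hy =>
    (hvw ▸ ⟨hx, hy⟩ : x ∈ (∅ : Set X))
  let ψ := zpowMulEquiv a ((usedLetters v).indicator m) ((usedLetters v).indicator n)
    (by simp [h.left_self]) (by simp [h.right_self])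
  have hψv : actC ψ v = actC τ v :=
    map_congr_of_usedLetters fun x hx => by
      simp [ψ, zpowMulEquiv_of, h.apply_of, hx]
  have hψw : actC ψ w = w := by
    conv_rhs => rw [← ConjClasses.map_id w]
    refine map_congr_of_usedLetters fun x hx => ?_
    have hxv : x ∉ usedLetters v := fun e => hdisj x e hx
    simp [ψ, zpowMulEquiv_of, hxv]
  have hle := hmin.le_of_actC ψ
  rw [hψv, hψw] at hle
  have haw := h.notMem_usedLetters_actC (hdisj a ha) (by omega)
  refine Set.eq_empty_of_forall_notMem fun z hz => ?_
  have hzv : z ∈ usedLetters v := by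
    have := h.usedLetters_actC_subset v hz.1
    rwa [Set.insert_eq_of_mem ha] at this
  rcases h.usedLetters_actC_subset w hz.2 with rfl | hzw
  · exact haw hz.2
  · exact hdisj z hzv hzw

theorem goodPair_actC (h : IsZPowMul a m n τ) {v w : ConjClasses (FreeGroup X)}
    (hvw : GoodPair v w) (hmin : MinLenPair (actC τ v) (actC τ w)) :
    GoodPair (actC τ v) (actC τ w) := by
  rcases hvw with hf | hd
  · exact Or.inl (h.frugal_actC hf hmin)
  · by_cases hv : a ∈ usedLetters v
    · exact Or.inr (h.disjPair_actC hd hmin hv)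
    by_cases hw : a ∈ usedLetters w
    · exact Or.inr (h.disjPair_actC hd.symm hmin.symm hw).symm
    · exact Or.inl (h.frugal_actC (frugal_iff.2 ⟨a, hv, hw⟩) hmin)

end IsZPowMul

end Goodness

/-- If `(v, w)` is a good pair of minimal length and `τ` is a Whitehead
automorphism such that `(τ(v), τ(w))` also has minimal length, then `(τ(v), τ(w))` is good. -/
theorem good_pair_preserved {X : Type} [DecidableEq X] [Fintype X]
    (v w : ConjClasses (FreeGroup X)) (τ : FreeGroup X ≃* FreeGroup X)
    (hgood : GoodPair v w) (hmin : MinLenPair v w)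
    (hτ : IsWhitehead τ) (hmin' : MinLenPair (actC τ v) (actC τ w)) :
    GoodPair (actC τ v) (actC τ w) := by
  rcases hτ with hr | ⟨a, ha⟩
  · exact hr.goodPair_actC hgood
  · obtain ⟨m, n, hm, hn, h⟩ := ha.exists_zpow
    exact (IsZPowMul.mk hm hn h).goodPair_actC hgood hmin'
end

section
/- Let F = F(X) be a finitely generated free group and let A * B and C * D be two free splittings of F such that A ∩ C ≠ 1. Then A ∩ C contains a primitive element of F. -/
open FreeGroup

/-- `g` is a primitive element of the free group `F(X)`: the image of a generator
under some automorphism. -/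
def IsPrimitive {X : Type} (g : FreeGroup X) : Prop :=
  ∃ (φ : FreeGroup X ≃* FreeGroup X) (x : X), g = φ (FreeGroup.of x)

universe u

namespace FreeGroupBasis

variable {Y : Type u} {F : Type u} [Group F]

theorem induction_on (b : FreeGroupBasis Y F) {P : F → Prop} (g : F) (one : P 1)
    (basis : ∀ y, P (b y)) (inv : ∀ g, P g → P g⁻¹) (mul : ∀ g h, P g → P h → P (g * h)) :
    P g := by
  have key : ∀ x : FreeGroup Y, P (b.repr.symm x) := by
    intro x
    induction x using FreeGroup.induction_on with
    | C1 => simpa using one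
    | of y => exact basis y
    | inv_of y h => exact _root_.map_inv b.repr.symm (FreeGroup.of y) ▸ inv _ (basis y)
    | mul x y hx hy => simpa using mul _ _ hx hy
  simpa using key (b.repr g)

/-- A function on the generators and the points of an action of a free group
extends to a cocycle. -/
theorem exists_cocycle (b : FreeGroupBasis Y F) {Ω H : Type*} [MulAction F Ω] [Group H]
    (f : Y → Ω → H) :
    ∃ s : F → Ω → H, (∀ g h ω, s (g * h) ω = s g (h • ω) * s h ω) ∧
      ∀ y ω, s (b y) ω = f y ω := by
  let Ψ : Y → Equiv.Perm (Ω × H) := fun y =>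
    { toFun := fun q => (b y • q.1, f y q.1 * q.2)
      invFun := fun q => ((b y)⁻¹ • q.1, (f y ((b y)⁻¹ • q.1))⁻¹ * q.2)
      left_inv := fun q => by simp
      right_inv := fun q => by simp }
  let Φ : F →* Equiv.Perm (Ω × H) := b.lift Ψ
  have hΦb : ∀ y ω x, Φ (b y) (ω, x) = (b y • ω, f y ω * x) := fun y ω x =>
    congr_arg (fun e : Equiv.Perm (Ω × H) => e (ω, x))
      (congr_fun (b.lift.symm_apply_apply Ψ) y)
  have hΦ : ∀ g ω, ∃ z, ∀ x, Φ g (ω, x) = (g • ω, z * x) := by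
    intro g
    refine b.induction_on (P := fun g => ∀ ω, ∃ z, ∀ x, Φ g (ω, x) = (g • ω, z * x)) g
      ?_ ?_ ?_ ?_
    · exact fun ω => ⟨1, by simp⟩
    · exact fun y ω => ⟨f y ω, hΦb y ω⟩
    · intro g hg ω
      obtain ⟨z, hz⟩ := hg (g⁻¹ • ω)
      refine ⟨z⁻¹, fun x => ?_⟩
      rw [_root_.map_inv, Equiv.Perm.inv_eq_iff_eq, hz]
      simp
    · intro g h hg hh ω
      obtain ⟨z, hz⟩ := hh ω
      obtain ⟨z', hz'⟩ := hg (h • ω)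
      exact ⟨z' * z, fun x => by simp [hz, hz', mul_smul, mul_assoc]⟩
  choose s hs using hΦ
  refine ⟨s, fun g h ω => ?_, fun y ω => ?_⟩
  · have := hs (g * h) ω 1
    rw [_root_.map_mul, Equiv.Perm.mul_apply, hs, hs] at this
    simpa using (congr_arg Prod.snd this).symm
  · have := hs (b y) ω 1
    rw [hΦb] at this
    simpa using (congr_arg Prod.snd this).symm

theorem cocycle_one {Ω H : Type*} [MulAction F Ω] [Group H] {s : F → Ω → H}
    (hs : ∀ g h ω, s (g * h) ω = s g (h • ω) * s h ω) (ω : Ω) : s 1 ω = 1 := by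
  simpa using hs 1 1 ω

theorem cocycle_inv {Ω H : Type*} [MulAction F Ω] [Group H] {s : F → Ω → H}
    (hs : ∀ g h ω, s (g * h) ω = s g (h • ω) * s h ω) (g : F) (ω : Ω) :
    s g⁻¹ ω = (s g (g⁻¹ • ω))⁻¹ := by
  have := hs g g⁻¹ ω
  rw [mul_inv_cancel, cocycle_one hs] at this
  exact (inv_eq_of_mul_eq_one_right this.symm).symm

theorem cocycle_ext (b : FreeGroupBasis Y F) {Ω H : Type*} [MulAction F Ω] [Group H]
    {s t : F → Ω → H} (hs : ∀ g h ω, s (g * h) ω = s g (h • ω) * s h ω)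
    (ht : ∀ g h ω, t (g * h) ω = t g (h • ω) * t h ω)
    (h : ∀ y ω, s (b y) ω = t (b y) ω) (g : F) : ∀ ω, s g ω = t g ω := by
  refine b.induction_on (P := fun g => ∀ ω, s g ω = t g ω) g ?_ h ?_ ?_
  · intro ω
    rw [cocycle_one hs, cocycle_one ht]
  · intro g hg ω
    rw [cocycle_inv hs, cocycle_inv ht, hg]
  · intro g k hg hk ω
    rw [hs, ht, hg, hk]

/-- The cosets joined to the base coset by edges of the Schreier graph that are compatible
with the transversal `p`. -/
inductive TreeReach (b : FreeGroupBasis Y F) {C : Subgroup F} (p : F ⧸ C → F) : F ⧸ C → Prop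
  | base : TreeReach b p ((1 : F) : F ⧸ C)
  | pos (y : Y) (ω : F ⧸ C) : TreeReach b p ω → p (b y • ω) = b y * p ω →
      TreeReach b p (b y • ω)
  | neg (y : Y) (ω : F ⧸ C) : TreeReach b p (b y • ω) → p (b y • ω) = b y * p ω →
      TreeReach b p ω

theorem transversal_smul_mem {C : Subgroup F} {p : F ⧸ C → F}
    (hp : ∀ ω, (p ω : F ⧸ C) = ω) (g : F) (ω : F ⧸ C) :
    (p (g • ω))⁻¹ * g * p ω ∈ C := by
  rw [mul_assoc, ← QuotientGroup.eq, hp, ← smul_eq_mul, ← MulAction.Quotient.smul_coe, hp]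

/-- A subgroup of a free group is free on the nontrivial Schreier generators of a
Schreier transversal. -/
theorem exists_schreier_basis (b : FreeGroupBasis Y F) {C : Subgroup F} {p : F ⧸ C → F}
    (hp : ∀ ω, (p ω : F ⧸ C) = ω) (hp1 : p ((1 : F) : F ⧸ C) = 1)
    (ht : ∀ ω, TreeReach b p ω) :
    ∃ β : FreeGroupBasis {q : Y × (F ⧸ C) // p (b q.1 • q.2) ≠ b q.1 * p q.2} C,
      ∀ q, (β q : F) = (p (b q.1.1 • q.1.2))⁻¹ * b q.1.1 * p q.1.2 := by
  classical
  refine ⟨FreeGroupBasis.ofUniqueLift _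
    (fun q => ⟨_, transversal_smul_mem hp (b q.1.1) q.1.2⟩) ?_, fun q => ?_⟩
  · intro H _ f
    let f' : Y → F ⧸ C → H := fun y ω =>
      if h : p (b y • ω) ≠ b y * p ω then f ⟨(y, ω), h⟩ else 1
    obtain ⟨s, hs, hsb⟩ := b.exists_cocycle f'
    have hstree : ∀ y ω, p (b y • ω) = b y * p ω → s (b y) ω = 1 := by
      intro y ω h
      simp [hsb, f', h]
    have hsp : ∀ ω, s (p ω) ((1 : F) : F ⧸ C) = 1 := by
      intro ω
      induction ht ω with
      | base => rw [hp1, cocycle_one hs]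
      | pos y ω _ h ih =>
        rw [h, hs, ih, mul_one, MulAction.Quotient.smul_coe, smul_eq_mul, mul_one, hp,
          hstree y ω h]
      | neg y ω _ h ih =>
        rw [h, hs, MulAction.Quotient.smul_coe, smul_eq_mul, mul_one, hp, hstree y ω h,
          one_mul] at ih
        exact ih
    have hC : ∀ c : C, (c : F) • ((1 : F) : F ⧸ C) = ((1 : F) : F ⧸ C) := by
      intro c
      rw [MulAction.Quotient.smul_coe, smul_eq_mul, mul_one]
      exact (QuotientGroup.eq.2 (by simp)).symm
    refine ⟨MonoidHom.mk' (fun c => s c ((1 : F) : F ⧸ C)) fun c d => ?_, ?_, ?_⟩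
    · simp only [Subgroup.coe_mul, hs, hC]
    · rintro ⟨⟨y, ω⟩, h⟩
      have h1 : (p (b y • ω))⁻¹ • (b y • ω) = ((1 : F) : F ⧸ C) := by
        rw [inv_smul_eq_iff, MulAction.Quotient.smul_coe, smul_eq_mul, mul_one, hp]
      have h2 : p ω • ((1 : F) : F ⧸ C) = ω := by
        rw [MulAction.Quotient.smul_coe, smul_eq_mul, mul_one, hp]
      simp only [MonoidHom.mk'_apply]
      rw [hs, hs, hsp, h2, cocycle_inv hs, h1, hsp, hsb]
      simp [f', h]
    · intro E hE
      ext c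
      let t : F → F ⧸ C → H := fun g ω => E ⟨_, transversal_smul_mem hp g ω⟩
      have htc : ∀ g h ω, t (g * h) ω = t g (h • ω) * t h ω := by
        intro g h ω
        simp only [t]
        rw [← _root_.map_mul]
        refine congr_arg E (Subtype.ext ?_)
        simp [mul_smul, mul_assoc]
      have := cocycle_ext b htc hs (fun y ω => ?_) c ((1 : F) : F ⧸ C)
      · rw [MonoidHom.mk'_apply, ← this]
        simp only [t]
        refine congr_arg E (Subtype.ext ?_)
        simp [hC, hp1]
      · rw [hsb]
        by_cases h : p (b y • ω) = b y * p ω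
        · have : (⟨_, transversal_smul_mem hp (b y) ω⟩ : C) = 1 := by
            ext
            simp [h, mul_assoc]
          simp only [t, this, _root_.map_one]
          simp [f', h]
        · simp only [t, f']
          rw [dif_pos h, ← hE]
  · exact congr_arg Subtype.val FreeGroup.lift_apply_of

/-- There is a Schreier transversal of `C` whose representatives of the cosets meeting
the subgroup generated by a part of the basis lie in that subgroup. -/
theorem exists_transversal (b : FreeGroupBasis Y F) (C : Subgroup F) (S : Set Y) :
    ∃ p : F ⧸ C → F, (∀ ω, (p ω : F ⧸ C) = ω) ∧ p ((1 : F) : F ⧸ C) = 1 ∧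
      (∀ ω, TreeReach b p ω) ∧
      ∀ a ∈ Subgroup.closure (b '' S), p (a : F ⧸ C) ∈ Subgroup.closure (b '' S) := by
  classical
  set A := Subgroup.closure (b '' S)
  let val : List (Y × Bool) → F := fun w => b.repr.symm (FreeGroup.mk w)
  have val_nil : val [] = 1 := _root_.map_one b.repr.symm
  have val_cons : ∀ l w, val (l :: w) = val [l] * val w := by
    intro l w
    rw [← _root_.map_mul, FreeGroup.mul_mk, List.singleton_append]
  have val_pos : ∀ y, val [(y, true)] = b y := fun y => rfl
  have val_neg : ∀ y, val [(y, false)] = (b y)⁻¹ := fun y =>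
    _root_.map_inv b.repr.symm (FreeGroup.of y)
  have val_letter_mem : ∀ l : Y × Bool, l.1 ∈ S → val [l] ∈ A := by
    rintro ⟨y, _ | _⟩ h
    · rw [val_neg]
      exact inv_mem (Subgroup.subset_closure ⟨y, h, rfl⟩)
    · exact Subgroup.subset_closure ⟨y, h, rfl⟩
  have val_mem : ∀ w : List (Y × Bool), (∀ l ∈ w, l.1 ∈ S) → val w ∈ A := by
    intro w
    induction w with
    | nil => intro _; rw [val_nil]; exact one_mem _
    | cons l w ih =>
      intro h
      rw [val_cons]
      exact mul_mem (val_letter_mem l (h l (by simp))) (ih fun l' hl' => h l' (by simp [hl']))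
  have val_append : ∀ w w', val (w ++ w') = val w * val w' := by
    intro w w'
    rw [← _root_.map_mul, FreeGroup.mul_mk]
  have val_inv : ∀ w, val (FreeGroup.invRev w) = (val w)⁻¹ := by
    intro w
    rw [← _root_.map_inv, FreeGroup.inv_mk]
  have exists_word : ∀ a ∈ A, ∃ w, (∀ l ∈ w, l.1 ∈ S) ∧ val w = a := by
    intro a ha
    induction ha using Subgroup.closure_induction with
    | mem x hx =>
      obtain ⟨y, hy, rfl⟩ := hx
      exact ⟨[(y, true)], by simpa using hy, rfl⟩
    | one => exact ⟨[], by simp, val_nil⟩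
    | mul x y _ _ hx hy =>
      obtain ⟨w, hw, rfl⟩ := hx
      obtain ⟨w', hw', rfl⟩ := hy
      refine ⟨w ++ w', ?_, val_append w w'⟩
      intro l hl
      rcases List.mem_append.1 hl with h | h
      exacts [hw l h, hw' l h]
    | inv x _ hx =>
      obtain ⟨w, hw, rfl⟩ := hx
      refine ⟨FreeGroup.invRev w, ?_, val_inv w⟩
      intro l hl
      simp only [FreeGroup.invRev, List.mem_reverse, List.mem_map] at hl
      obtain ⟨l', hl', rfl⟩ := hl
      exact hw l' hl'
  let weight : List (Y × Bool) → ℕ ×ₗ ℕ := fun w => toLex (w.countP fun l => l.1 ∉ S, w.length)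
  have weight_cons : ∀ l w, weight w < weight (l :: w) := by
    intro l w
    simp only [weight, Prod.Lex.toLex_lt_toLex, List.countP_cons, List.length_cons]
    split_ifs <;> simp
  have exists_min : ∀ ω : F ⧸ C, ∃ w, (val w : F ⧸ C) = ω ∧
      ∀ w', (val w' : F ⧸ C) = ω → weight w ≤ weight w' := by
    intro ω
    obtain ⟨w, hw, hmin⟩ := (InvImage.wf weight wellFounded_lt).has_min
      {w | (val w : F ⧸ C) = ω} (by
        obtain ⟨g, rfl⟩ := QuotientGroup.mk_surjective ω
        exact ⟨(b.repr g).toWord, by simp [val, FreeGroup.mk_toWord]⟩)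
    exact ⟨w, hw, fun w' hw' => not_lt.1 (hmin w' hw')⟩
  choose w hw hmin using exists_min
  let inOrbit : F ⧸ C → Prop := fun ω => ∃ a ∈ A, (a : F ⧸ C) = ω
  have exists_parent : ∀ ω : F ⧸ C, ω ≠ ((1 : F) : F ⧸ C) → ∃ l : Y × Bool,
      weight (w ((val [l])⁻¹ • ω)) < weight (w ω) ∧
      (inOrbit ω → val [l] ∈ A ∧ inOrbit ((val [l])⁻¹ • ω)) := by
    intro ω hω
    rcases h : w ω with _ | ⟨l, w'⟩
    · have := hw ω
      rw [h, val_nil] at this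
      exact absurd this.symm hω
    have hω' : (val [l])⁻¹ • ω = (val w' : F ⧸ C) := by
      rw [inv_smul_eq_iff, MulAction.Quotient.smul_coe, smul_eq_mul, ← val_cons, ← h, hw]
    refine ⟨l, ?_, ?_⟩
    · rw [hω']
      exact (hmin _ w' rfl).trans_lt (weight_cons l w')
    · rintro ⟨a, ha, rfl⟩
      obtain ⟨v, hv, rfl⟩ := exists_word a ha
      have hle := hmin _ v rfl
      have hv0 : v.countP (fun l => l.1 ∉ S) = 0 := by
        simpa [List.countP_eq_zero] using fun y c h => hv (y, c) h
      have hw0 : (w (val v : F ⧸ C)).countP (fun l => l.1 ∉ S) = 0 := by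
        simp only [weight, Prod.Lex.toLex_le_toLex, hv0] at hle
        omega
      have hS : ∀ l ∈ w (val v : F ⧸ C), l.1 ∈ S := by
        intro l hl
        simpa using List.countP_eq_zero.1 hw0 l hl
      rw [h] at hS
      refine ⟨val_letter_mem l (hS l (by simp)), ?_⟩
      rw [hω']
      exact ⟨_, val_mem w' fun l' hl' => hS l' (by simp [hl']), rfl⟩
  choose par par_lt par_orbit using exists_parent
  have wf : WellFounded fun ω ω' : F ⧸ C => weight (w ω) < weight (w ω') :=
    InvImage.wf (fun ω => weight (w ω)) wellFounded_lt
  obtain ⟨p, hp1, hp⟩ : ∃ p : F ⧸ C → F, p ((1 : F) : F ⧸ C) = 1 ∧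
      ∀ ω (h : ω ≠ ((1 : F) : F ⧸ C)), p ω = val [par ω h] * p ((val [par ω h])⁻¹ • ω) := by
    refine ⟨wf.fix fun ω rec => if h : ω ≠ ((1 : F) : F ⧸ C) then
      val [par ω h] * rec _ (par_lt ω h) else 1, ?_, fun ω h => ?_⟩
    · rw [WellFounded.fix_eq]
      simp
    · rw [WellFounded.fix_eq, dif_pos h]
  refine ⟨p, ?_, hp1, ?_, ?_⟩
  · intro ω
    induction ω using wf.induction with
    | _ ω ih =>
      by_cases h : ω = ((1 : F) : F ⧸ C)
      · rw [h, hp1]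
      · rw [hp ω h, ← smul_eq_mul, ← MulAction.Quotient.smul_coe, ih _ (par_lt ω h),
          smul_inv_smul]
  · intro ω
    induction ω using wf.induction with
    | _ ω ih =>
      by_cases h : ω = ((1 : F) : F ⧸ C)
      · rw [h]
        exact .base
      · have ih' := ih _ (par_lt ω h)
        have hp' := hp ω h
        rcases hl : par ω h with ⟨y, _ | _⟩
        · rw [hl, val_neg, inv_inv] at ih' hp'
          exact .neg y ω ih' (by rw [hp', mul_inv_cancel_left])
        · rw [hl, val_pos] at ih' hp'
          have := TreeReach.pos y _ ih' (by rw [smul_inv_smul, hp'])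
          rwa [smul_inv_smul] at this
  · have key : ∀ ω, inOrbit ω → p ω ∈ A := by
      intro ω
      induction ω using wf.induction with
      | _ ω ih =>
        intro hω
        by_cases h : ω = ((1 : F) : F ⧸ C)
        · rw [h, hp1]
          exact one_mem _
        · rw [hp ω h]
          exact mul_mem (par_orbit ω h hω).1 (ih _ (par_lt ω h) (par_orbit ω h hω).2)
    exact fun a ha => key _ ⟨a, ha, rfl⟩

/-- If a subgroup `C` of a free group meets the subgroup generated by a part of a basis
nontrivially, then some element of the intersection belongs to a basis of `C`. -/
theorem exists_basis_mem_closure (b : FreeGroupBasis Y F) (C : Subgroup F) (S : Set Y)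
    (hne : Subgroup.closure (b '' S) ⊓ C ≠ ⊥) :
    ∃ (ι : Type u) (β : FreeGroupBasis ι C) (i : ι), (β i : F) ∈ Subgroup.closure (b '' S) := by
  obtain ⟨p, hp, hp1, ht, hpS⟩ := b.exists_transversal C S
  obtain ⟨β, hβ⟩ := b.exists_schreier_basis hp hp1 ht
  suffices h : ∃ y ∈ S, ∃ a ∈ Subgroup.closure (b '' S),
      p (b y • (a : F ⧸ C)) ≠ b y * p (a : F ⧸ C) by
    obtain ⟨y, hy, a, ha, h⟩ := h
    have hby : b y ∈ Subgroup.closure (b '' S) := Subgroup.subset_closure ⟨y, hy, rfl⟩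
    refine ⟨_, β, ⟨(y, a), h⟩, ?_⟩
    rw [hβ]
    exact mul_mem (mul_mem (inv_mem (hpS _ (mul_mem hby ha))) hby) (hpS a ha)
  by_contra! hall
  refine hne ((Subgroup.eq_bot_iff_forall _).2 fun c hc => ?_)
  have key : ∀ g ∈ Subgroup.closure (b '' S), ∀ a ∈ Subgroup.closure (b '' S),
      p (g • (a : F ⧸ C)) = g * p (a : F ⧸ C) := by
    intro g hg
    induction hg using Subgroup.closure_induction with
    | mem x hx =>
      obtain ⟨y, hy, rfl⟩ := hx
      exact hall y hy
    | one => simp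
    | mul x y _ hy ihx ihy =>
      intro a ha
      have := ihx (y * a) (mul_mem hy ha)
      rw [← smul_eq_mul, ← MulAction.Quotient.smul_coe] at this
      rw [mul_smul, this, ihy a ha, mul_assoc]
    | inv x hx ih =>
      intro a ha
      have := ih (x⁻¹ * a) (mul_mem (inv_mem hx) ha)
      rw [← smul_eq_mul, ← MulAction.Quotient.smul_coe, smul_inv_smul] at this
      rw [this, inv_mul_cancel_left]
  have h := key c hc.1 1 (one_mem _)
  have hc1 : (c : F ⧸ C) = ((1 : F) : F ⧸ C) := (QuotientGroup.eq.2 (by simpa using hc.2)).symm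
  rwa [MulAction.Quotient.smul_coe, smul_eq_mul, mul_one, hc1, hp1, mul_one, eq_comm] at h

/-- The free product of two free groups is free on the disjoint union of the bases. -/
noncomputable def coprod {G H : Type*} [Group G] [Group H] {ι κ : Type*}
    (b : FreeGroupBasis ι G) (c : FreeGroupBasis κ H) :
    FreeGroupBasis (ι ⊕ κ) (Monoid.Coprod G H) :=
  .ofRepr <| MonoidHom.toMulEquiv
    (Monoid.Coprod.lift (b.lift (FreeGroup.of ∘ Sum.inl)) (c.lift (FreeGroup.of ∘ Sum.inr)))
    (FreeGroup.lift (Sum.elim (Monoid.Coprod.inl ∘ b) (Monoid.Coprod.inr ∘ c)))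
    (by
      apply Monoid.Coprod.hom_ext
      · exact b.ext_hom _ _ fun i => by simp
      · exact c.ext_hom _ _ fun i => by simp)
    (by ext (i | i) <;> simp)

@[simp]
theorem coprod_inl {G H : Type*} [Group G] [Group H] {ι κ : Type*}
    (b : FreeGroupBasis ι G) (c : FreeGroupBasis κ H) (i : ι) :
    b.coprod c (Sum.inl i) = Monoid.Coprod.inl (b i) :=
  FreeGroup.lift_apply_of
    (f := Sum.elim (Monoid.Coprod.inl ∘ b) (Monoid.Coprod.inr ∘ c)) (x := Sum.inl i)

/-- Bases of the two factors of a free splitting form a basis of the whole group. -/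
theorem exists_basis_of_isFreeSplitting {F : Type} [Group F] {A B : Subgroup F}
    (h : IsFreeSplitting A B) {ι κ : Type} (b : FreeGroupBasis ι A) (c : FreeGroupBasis κ B) :
    ∃ β : FreeGroupBasis (ι ⊕ κ) F, ∀ i, β (Sum.inl i) = b i :=
  ⟨(b.coprod c).map (MulEquiv.ofBijective _ h), fun i => by
    rw [map_apply, coprod_inl]
    exact Monoid.Coprod.lift_apply_inl A.subtype B.subtype (b i)⟩

theorem closure_range (b : FreeGroupBasis Y F) : Subgroup.closure (Set.range b) = ⊤ :=
  (Subgroup.eq_top_iff' _).2 fun g => b.induction_on g (one_mem _)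
    (fun y => Subgroup.subset_closure ⟨y, rfl⟩) (fun _ => inv_mem) (fun _ _ => mul_mem)

theorem isPrimitive {X ι : Type} (β : FreeGroupBasis ι (FreeGroup X)) (i : ι) :
    IsPrimitive (β i) := by
  let e : ι ≃ X := Equiv.ofFreeGroupEquiv β.repr.symm
  exact ⟨(β.reindex e).repr.symm, e i, by
    change _ = β.reindex e (e i)
    simp⟩

end FreeGroupBasis

/-- If `A * B` and `C * D` are free splittings of the finitely generated
free group `F(X)` and `A ∩ C ≠ 1`, then `A ∩ C` contains a primitive element. -/
theorem primitive_in_intersection {X : Type} [Fintype X]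
    (A B C D : Subgroup (FreeGroup X))
    (hAB : IsFreeSplitting A B) (hCD : IsFreeSplitting C D)
    (hne : A ⊓ C ≠ ⊥) :
    ∃ g : FreeGroup X, g ∈ A ⊓ C ∧ IsPrimitive g := by
  obtain ⟨b, hb⟩ := FreeGroupBasis.exists_basis_of_isFreeSplitting hAB
    (IsFreeGroup.basis A) (IsFreeGroup.basis B)
  have hA : Subgroup.closure (b '' Set.range Sum.inl) = A := by
    have := congr_arg (Subgroup.map A.subtype) (IsFreeGroup.basis A).closure_range
    rw [MonoidHom.map_closure, ← MonoidHom.range_eq_map, Subgroup.range_subtype,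
      ← Set.range_comp] at this
    rw [← Set.range_comp]
    convert this using 3
    funext i
    exact hb i
  rw [← hA] at hne
  obtain ⟨ι, β, i, hi⟩ := b.exists_basis_mem_closure C _ hne
  rw [hA] at hi
  obtain ⟨γ, hγ⟩ := FreeGroupBasis.exists_basis_of_isFreeSplitting hCD β (IsFreeGroup.basis D)
  exact ⟨β i, ⟨hi, (β i).2⟩, hγ i ▸ γ.isPrimitive (Sum.inl i)⟩
end

section
/- Let F be a finitely generated free group and let [A*B] and [C*D] be classes of proper free splittings of F. If some nontrivial element f ∈ F is elliptic to both [A*B] and [C*D], then there exists a primitive element g of F elliptic to both [A*B] and [C*D]. -/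
open FreeGroup

/-- A Schreier transversal adapted to a subset of the generators. -/
theorem exists_adapted_schreier_transversal {X : Type} (S : Set X) (H : Subgroup (FreeGroup X)) :
    ∃ t : FreeGroup X ⧸ H → FreeGroup X,
      t (1 : FreeGroup X) = 1 ∧ (∀ v, (t v : FreeGroup X ⧸ H) = v) ∧
      (∀ a ∈ Subgroup.closure (FreeGroup.of '' S),
        t (a : FreeGroup X) ∈ Subgroup.closure (FreeGroup.of '' S)) ∧
      ∀ P : FreeGroup X ⧸ H → Prop, P (1 : FreeGroup X) →
        (∀ v x, t (FreeGroup.of x • v) = FreeGroup.of x * t v →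
          (P v ↔ P (FreeGroup.of x • v))) → ∀ v, P v := by
  classical
  let V := FreeGroup X ⧸ H
  let v₀ : V := ((1 : FreeGroup X) : V)
  let A := Subgroup.closure (FreeGroup.of '' S)
  let cost : List (X × Bool) → ℕ ×ₗ ℕ := fun w =>
    toLex (w.countP (fun l => decide (l.1 ∉ S)), w.length)
  have hwf : WellFounded (fun a b : ℕ ×ₗ ℕ => a < b) := wellFounded_lt
  have hmin : ∀ v : V, ∃ w : List (X × Bool), FreeGroup.mk w • v₀ = v ∧
      ∀ w', FreeGroup.mk w' • v₀ = v → cost w ≤ cost w' := by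
    intro v
    have hne : {w : List (X × Bool) | FreeGroup.mk w • v₀ = v}.Nonempty := by
      obtain ⟨g, rfl⟩ := QuotientGroup.mk_surjective v
      refine ⟨g.toWord, ?_⟩
      change ((FreeGroup.mk g.toWord * 1 : FreeGroup X) : V) = (g : V)
      rw [FreeGroup.mk_toWord, mul_one]
    obtain ⟨w, hw, hw'⟩ := (InvImage.wf cost hwf).has_min _ hne
    exact ⟨w, hw, fun w' h => not_lt.1 (hw' w' h)⟩
  choose m hm hmmin using hmin
  have hAword : ∀ a ∈ A, ∃ w : List (X × Bool), FreeGroup.mk w = a ∧ ∀ l ∈ w, l.1 ∈ S := by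
    intro a ha
    induction ha using Subgroup.closure_induction with
    | mem x hx =>
      obtain ⟨s, hs, rfl⟩ := hx
      exact ⟨[(s, true)], rfl, by simpa using hs⟩
    | one => exact ⟨[], rfl, by simp⟩
    | mul x y _ _ hx hy =>
      obtain ⟨w, rfl, hw⟩ := hx
      obtain ⟨w', rfl, hw'⟩ := hy
      refine ⟨w ++ w', by simp, ?_⟩
      intro l hl
      rcases List.mem_append.1 hl with h | h
      exacts [hw l h, hw' l h]
    | inv x _ hx =>
      obtain ⟨w, rfl, hw⟩ := hx
      refine ⟨FreeGroup.invRev w, by simp, ?_⟩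
      intro l hl
      simp only [FreeGroup.invRev, List.mem_reverse, List.mem_map] at hl
      obtain ⟨l', hl', rfl⟩ := hl
      exact hw l' hl'
  have hwordA : ∀ w : List (X × Bool), (∀ l ∈ w, l.1 ∈ S) → FreeGroup.mk w ∈ A := by
    intro w
    induction w with
    | nil => intro _; exact A.one_mem
    | cons l w ih =>
      intro h
      have h1 : FreeGroup.mk [l] ∈ A := by
        have hs : FreeGroup.of l.1 ∈ A :=
          Subgroup.subset_closure ⟨l.1, h l (by simp), rfl⟩
        obtain ⟨x, b⟩ := l
        cases b
        · exact A.inv_mem hs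
        · exact hs
      have := A.mul_mem h1 (ih fun l' hl' => h l' (by simp [hl']))
      simpa using this
  have hstep : ∀ v : V, ∃ (p : V) (g : FreeGroup X), v ≠ v₀ →
      (∃ x, g = FreeGroup.of x ∨ g = (FreeGroup.of x)⁻¹) ∧
      v = g • p ∧ cost (m p) < cost (m v) ∧
      ((∃ a ∈ A, v = a • v₀) → (∃ a ∈ A, p = a • v₀) ∧ g ∈ A) := by
    intro v
    cases hw : m v with
    | nil =>
      have := hm v
      rw [hw] at this
      exact ⟨v, 1, fun h => absurd (this.symm.trans (one_smul _ _)) h⟩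
    | cons l w =>
      have h1 := hm v
      rw [hw] at h1
      refine ⟨FreeGroup.mk w • v₀, FreeGroup.mk [l], fun _ => ⟨⟨l.1, ?_⟩, ?_, ?_, ?_⟩⟩
      · obtain ⟨x, b⟩ := l
        cases b
        exacts [Or.inr rfl, Or.inl rfl]
      · rw [smul_smul]; simpa using h1.symm
      · refine lt_of_le_of_lt (hmmin _ w rfl) ?_
        simp only [cost, Prod.Lex.toLex_lt_toLex, List.countP_cons, List.length_cons]
        split_ifs <;> omega
      · rintro ⟨a, ha, rfl⟩
        obtain ⟨u, rfl, hu⟩ := hAword a ha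
        have h2 := hmmin _ u rfl
        rw [hw] at h2
        have hu0 : u.countP (fun l => decide (l.1 ∉ S)) = 0 := by
          simpa [List.countP_eq_zero] using hu
        have h3 : (l :: w).countP (fun l => decide (l.1 ∉ S)) = 0 := by
          simp only [cost, Prod.Lex.toLex_le_toLex, hu0] at h2
          omega
        have h4 : ∀ l' ∈ l :: w, l'.1 ∈ S := by
          simpa [List.countP_eq_zero] using h3
        exact ⟨⟨_, hwordA w fun l' h => h4 l' (by simp [h]), rfl⟩,
          hwordA [l] fun l' h => h4 l' (by simp at h; simp [h])⟩
  choose p g hpg using hstep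
  have hrank : WellFounded (fun v w : V => cost (m v) < cost (m w)) :=
    InvImage.wf (fun v => cost (m v)) hwf
  obtain ⟨t, ht⟩ : ∃ t : V → FreeGroup X, ∀ v, t v = if v = v₀ then 1 else g v * t (p v) := by
    refine ⟨hrank.fix fun v rec =>
      if h : v = v₀ then 1 else g v * rec (p v) (hpg v h).2.2.1, fun v => ?_⟩
    rw [hrank.fix_eq]
    split_ifs <;> rfl
  have ht₀ : t v₀ = 1 := by rw [ht, if_pos rfl]
  have htp : ∀ v, v ≠ v₀ → t v = g v * t (p v) := fun v h => by rw [ht, if_neg h]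
  refine ⟨t, ht₀, fun v => ?_, fun a ha => ?_, fun P h₀ hP v => ?_⟩
  · induction v using hrank.induction with
    | _ v ih =>
      by_cases h : v = v₀
      · rw [h, ht₀]
      · obtain ⟨-, h2, h3, -⟩ := hpg v h
        rw [htp v h]
        change g v • ((t (p v) : FreeGroup X) : V) = v
        rw [ih _ h3, ← h2]
  · have key : ∀ v : V, (∃ a ∈ A, v = a • v₀) → t v ∈ A := by
      intro v
      induction v using hrank.induction with
      | _ v ih =>
        intro hv
        by_cases h : v = v₀
        · rw [h, ht₀]; exact A.one_mem
        · obtain ⟨-, -, h3, h4⟩ := hpg v h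
          rw [htp v h]
          exact A.mul_mem (h4 hv).2 (ih _ h3 (h4 hv).1)
    refine key _ ⟨a, ha, ?_⟩
    change (a : V) = ((a * 1 : FreeGroup X) : V)
    rw [mul_one]
  · induction v using hrank.induction with
    | _ v ih =>
      by_cases h : v = v₀
      · rwa [h]
      · obtain ⟨⟨x, hx⟩, h2, h3, -⟩ := hpg v h
        have h5 := htp v h
        rcases hx with hx | hx
        · rw [hx] at h2 h5
          have := hP (p v) x (by rw [← h2, h5])
          rw [← h2] at this
          exact this.1 (ih _ h3)
        · rw [hx] at h2 h5
          have h6 : FreeGroup.of x • v = p v := by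
            rw [← inv_inv (FreeGroup.of x), inv_smul_eq_iff]; exact h2
          have := hP v x (by rw [h6, h5, mul_inv_cancel_left])
          rw [h6] at this
          exact this.2 (ih _ h3)

/-- If a subgroup `H` of a free group meets the free factor generated by a set of generators
nontrivially, then some element of a free basis of `H` lies in that free factor. -/
theorem exists_basis_element_mem_closure {X : Type} (S : Set X) (H : Subgroup (FreeGroup X))
    (f : FreeGroup X) (hf : f ≠ 1) (hfH : f ∈ H)
    (hfA : f ∈ Subgroup.closure (FreeGroup.of '' S)) :
    ∃ (E : Type) (φ : FreeGroup E ≃* H) (e : E),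
      (φ (FreeGroup.of e) : FreeGroup X) ∈ Subgroup.closure (FreeGroup.of '' S) := by
  classical
  obtain ⟨t, ht₀, htv, htA, hind⟩ := exists_adapted_schreier_transversal S H
  set A := Subgroup.closure (FreeGroup.of '' S) with hA
  let V := FreeGroup X ⧸ H
  let v₀ : V := ((1 : FreeGroup X) : V)
  have hcoe : ∀ (a b : FreeGroup X), a • ((b : FreeGroup X) : V) = ((a * b : FreeGroup X) : V) :=
    fun _ _ => rfl
  have htv₀ : ∀ v : V, t v • v₀ = v := fun v => by rw [hcoe, mul_one, htv]
  have hmemH : ∀ a : FreeGroup X, a • v₀ = v₀ ↔ a ∈ H := fun a => by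
    rw [hcoe, mul_one, eq_comm, QuotientGroup.eq]; simp
  let E := {q : V × X // t (FreeGroup.of q.2 • q.1) ≠ FreeGroup.of q.2 * t q.1}
  let edge : V → X → FreeGroup X := fun v x =>
    (t (FreeGroup.of x • v))⁻¹ * FreeGroup.of x * t v
  have hedge : ∀ v x, edge v x ∈ H := fun v x => by
    rw [← hmemH, mul_smul, mul_smul, htv₀, inv_smul_eq_iff, htv₀]
  let α : FreeGroup E →* H := FreeGroup.lift fun e => ⟨edge e.1.1 e.1.2, hedge _ _⟩
  let label : V → X → FreeGroup E := fun v x =>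
    if h : t (FreeGroup.of x • v) ≠ FreeGroup.of x * t v then FreeGroup.of ⟨(v, x), h⟩ else 1
  have hαlabel : ∀ v x, (α (label v x) : FreeGroup X) = edge v x := by
    intro v x
    by_cases h : t (FreeGroup.of x • v) ≠ FreeGroup.of x * t v
    · have hl : label v x = FreeGroup.of ⟨(v, x), h⟩ := dif_pos h
      rw [hl]
      exact congrArg Subtype.val FreeGroup.lift_apply_of
    · have h' : t (FreeGroup.of x • v) = FreeGroup.of x * t v := not_not.1 h
      simp only [label, dif_neg h, edge]
      rw [h']
      simp [mul_assoc]
  let ρ : FreeGroup X →* Equiv.Perm (V × FreeGroup E) := FreeGroup.lift fun x =>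
    { toFun := fun q => (FreeGroup.of x • q.1, label q.1 x * q.2)
      invFun := fun q => ((FreeGroup.of x)⁻¹ • q.1, (label ((FreeGroup.of x)⁻¹ • q.1) x)⁻¹ * q.2)
      left_inv := fun q => by simp
      right_inv := fun q => by simp }
  have hρ : ∀ x v k, ρ (FreeGroup.of x) (v, k) = (FreeGroup.of x • v, label v x * k) :=
    fun x v k => by simp [ρ]
  -- Equivariance transfers from generators to the whole group.
  have hequiv : ∀ (T : Type) (σ : FreeGroup X →* Equiv.Perm T) (Φ : V × FreeGroup E → T),
      (∀ x q, Φ (ρ (FreeGroup.of x) q) = σ (FreeGroup.of x) (Φ q)) →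
      ∀ g q, Φ (ρ g q) = σ g (Φ q) := by
    intro T σ Φ h g
    induction g using FreeGroup.induction_on with
    | C1 => simp
    | of x => exact h x
    | inv_of x _ =>
      intro q
      rw [_root_.map_inv, _root_.map_inv, Equiv.Perm.eq_inv_iff_eq, ← h]
      simp
    | mul a b ha hb => intro q; simp [ha, hb]
  have hfst : ∀ g q, (ρ g q).1 = g • q.1 :=
    hequiv V (MulAction.toPermHom _ _) Prod.fst fun x q => by
      obtain ⟨v, k⟩ := q
      simp [hρ]
  have hΦ : ∀ g q, t (ρ g q).1 * (α (ρ g q).2 : FreeGroup X) = g * (t q.1 * α q.2) :=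
    hequiv (FreeGroup X) (MulAction.toPermHom _ _)
      (fun q => t q.1 * (α q.2 : FreeGroup X)) fun x q => by
        obtain ⟨v, k⟩ := q
        simp [hρ, hαlabel, edge, mul_assoc]
  have htree : ∀ v k, ρ (t v) (v₀, k) = (v, k) := by
    intro v
    refine hind (fun v => ∀ k, ρ (t v) (v₀, k) = (v, k)) (by simp [ht₀, v₀]) ?_ v
    intro v x h
    have hl : label v x = 1 := dif_neg (not_not.2 h)
    have hk : ∀ k, ρ (FreeGroup.of x) (v, k) = (FreeGroup.of x • v, k) := fun k => by
      rw [hρ, hl, one_mul]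
    refine forall_congr' fun k => ?_
    rw [h, _root_.map_mul, Equiv.Perm.mul_apply, ← hk, (ρ (FreeGroup.of x)).injective.eq_iff]
  have hα : ∀ k k', ρ (α k : FreeGroup X) (v₀, k') = (v₀, k * k') := by
    intro k
    induction k using FreeGroup.induction_on with
    | C1 => simp
    | of e =>
      intro k'
      have h1 : (α (FreeGroup.of e) : FreeGroup X) = edge e.1.1 e.1.2 := by simp [α]
      have h2 : label e.1.1 e.1.2 = FreeGroup.of e := dif_pos e.2
      rw [h1]
      simp only [edge, _root_.map_mul, _root_.map_inv, Equiv.Perm.mul_apply]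
      rw [htree, hρ, h2, Equiv.Perm.inv_eq_iff_eq, htree]
    | inv_of e h =>
      intro k'
      rw [_root_.map_inv, Subgroup.coe_inv, _root_.map_inv, Equiv.Perm.inv_eq_iff_eq, h,
        mul_inv_cancel_left]
    | mul a b ha hb => intro k'; simp [ha, hb, mul_assoc]
  have hαinj : Function.Injective α := by
    intro k k' h
    have h1 := hα k 1
    rw [h, hα] at h1
    simpa using h1.symm
  have hαsurj : Function.Surjective α := by
    rintro ⟨h, hh⟩
    refine ⟨(ρ h (v₀, 1)).2, Subtype.ext ?_⟩
    have h1 := hΦ h (v₀, 1)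
    rw [hfst] at h1
    simp only [(hmemH h).2 hh] at h1
    simpa [v₀, ht₀] using h1
  obtain ⟨v, hv, x, hx, hvx⟩ : ∃ v : V, (∃ a ∈ A, v = (a : V)) ∧
      ∃ x ∈ S, t (FreeGroup.of x • v) ≠ FreeGroup.of x * t v := by
    by_contra! hcon
    have hfix : ∀ a ∈ A, ∀ b ∈ A, ∀ k, ρ a ((b : V), k) = (((a * b : FreeGroup X) : V), k) := by
      intro a ha
      rw [hA] at ha
      induction ha using Subgroup.closure_induction with
      | mem y hy =>
        obtain ⟨x, hx, rfl⟩ := hy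
        intro b hb k
        have hl : label (b : V) x = 1 := dif_neg (not_not.2 (hcon _ ⟨b, hb, rfl⟩ x hx))
        rw [hρ, hl, one_mul, hcoe]
      | one => simp
      | mul a b ha hb iha ihb =>
        intro c hc k
        rw [_root_.map_mul, Equiv.Perm.mul_apply, ihb c hc, iha _ (A.mul_mem hb hc), mul_assoc]
      | inv a ha iha =>
        intro b hb k
        rw [_root_.map_inv, Equiv.Perm.inv_eq_iff_eq, iha _ (A.mul_mem (A.inv_mem ha) hb),
          mul_inv_cancel_left]
    have h1 := hΦ f (v₀, 1)
    rw [hfix f hfA 1 A.one_mem, mul_one, ← mul_one f, ← hcoe, (hmemH f).2 hfH] at h1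
    simp [v₀, ht₀] at h1
    exact hf h1.symm
  refine ⟨E, MulEquiv.ofBijective α ⟨hαinj, hαsurj⟩, ⟨(v, x), hvx⟩, ?_⟩
  obtain ⟨a, ha, rfl⟩ := hv
  have hxA : FreeGroup.of x ∈ A := Subgroup.subset_closure ⟨x, hx, rfl⟩
  have h1 : ((MulEquiv.ofBijective α ⟨hαinj, hαsurj⟩ (FreeGroup.of ⟨((a : V), x), hvx⟩) : H) :
      FreeGroup X) = edge (a : V) x := congrArg Subtype.val FreeGroup.lift_apply_of
  rw [h1]
  refine A.mul_mem (A.mul_mem (A.inv_mem ?_) hxA) (htA a ha)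
  rw [hcoe]
  exact htA _ (A.mul_mem hxA ha)

theorem IsFreeSplitting.symm {F : Type} [Group F] {A B : Subgroup F}
    (h : IsFreeSplitting A B) : IsFreeSplitting B A := by
  have h1 : Monoid.Coprod.lift B.subtype A.subtype =
      (Monoid.Coprod.lift A.subtype B.subtype).comp (Monoid.Coprod.swap B A) :=
    (Monoid.Coprod.lift_comp_swap _ _).symm
  rw [IsFreeSplitting, h1, MonoidHom.coe_comp]
  exact h.comp Monoid.Coprod.swap_bijective

/-- A free basis of a free factor of a free group extends to a free basis of the group. -/
theorem IsFreeSplitting.exists_basis_extending {F : Type} [Group F] [IsFreeGroup F]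
    {A B : Subgroup F} (h : IsFreeSplitting A B) {E : Type} (φ : FreeGroup E ≃* A) :
    ∃ (Z : Type) (ψ : FreeGroup (E ⊕ Z) ≃* F),
      ∀ e, ψ (FreeGroup.of (Sum.inl e)) = φ (FreeGroup.of e) := by
  let χ := (IsFreeGroup.toFreeGroup B).symm
  let i : FreeGroup (E ⊕ IsFreeGroup.Generators B) →*
      Monoid.Coprod (FreeGroup E) (FreeGroup (IsFreeGroup.Generators B)) :=
    FreeGroup.lift (Sum.elim (fun e => .inl (.of e)) (fun z => .inr (.of z)))
  let j : Monoid.Coprod (FreeGroup E) (FreeGroup (IsFreeGroup.Generators B)) →*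
      FreeGroup (E ⊕ IsFreeGroup.Generators B) :=
    Monoid.Coprod.lift (FreeGroup.map Sum.inl) (FreeGroup.map Sum.inr)
  let ι := MonoidHom.toMulEquiv i j
    (FreeGroup.ext_hom _ _ fun z => by cases z <;> simp [i, j])
    (Monoid.Coprod.hom_ext (FreeGroup.ext_hom _ _ fun z => by simp [i, j])
      (FreeGroup.ext_hom _ _ fun z => by simp [i, j]))
  refine ⟨_, (ι.trans (MulEquiv.coprodCongr φ χ)).trans (MulEquiv.ofBijective _ h), fun e => ?_⟩
  have hι : ι (of (Sum.inl e)) = .inl (of e) := by simp [ι, i]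
  change Monoid.Coprod.lift A.subtype B.subtype
    (Monoid.Coprod.map φ.toMonoidHom χ.toMonoidHom (ι (of (Sum.inl e)))) = _
  simp [hι]

theorem IsFreeSplitting.exists_primitive_mem {X : Type} {A B C D : Subgroup (FreeGroup X)}
    (hAB : IsFreeSplitting A B) (hCD : IsFreeSplitting C D) {f y : FreeGroup X} (hf : f ≠ 1)
    (hfA : y * f * y⁻¹ ∈ A) (hfC : f ∈ C) :
    ∃ g, IsPrimitive g ∧ y * g * y⁻¹ ∈ A ∧ g ∈ C := by
  obtain ⟨Z, ψ, hψ⟩ := hAB.exists_basis_extending (IsFreeGroup.toFreeGroup A).symm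
  let θ : FreeGroup X ≃* FreeGroup _ := (MulAut.conj y).trans ψ.symm
  have hA : ∀ g, θ g ∈ Subgroup.closure (FreeGroup.of '' Set.range Sum.inl) ↔
      y * g * y⁻¹ ∈ A := by
    intro g
    have h1 : (Subgroup.closure (FreeGroup.of '' Set.range Sum.inl)).map ψ.toMonoidHom = A := by
      have h2 : (ψ.toMonoidHom ∘ of) ∘ Sum.inl =
          A.subtype.comp (IsFreeGroup.toFreeGroup A).symm.toMonoidHom ∘ of := funext hψ
      rw [MonoidHom.map_closure, ← Set.image_comp, ← Set.range_comp, h2, Set.range_comp,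
        ← MonoidHom.map_closure, FreeGroup.closure_range_of, ← MonoidHom.range_eq_map,
        MonoidHom.range_comp,
        MonoidHom.range_eq_top.2 (IsFreeGroup.toFreeGroup A).symm.surjective,
        ← MonoidHom.range_eq_map, Subgroup.range_subtype]
    have h2 : y * g * y⁻¹ ∈ A ↔ ψ (θ g) ∈ A := by simp [θ]
    exact (Subgroup.mem_map_iff_mem ψ.injective).symm.trans
      ((SetLike.ext_iff.1 h1 (ψ (θ g))).trans h2.symm)
  obtain ⟨E, φ, e, he⟩ := exists_basis_element_mem_closure (Set.range Sum.inl)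
    (C.map θ.toMonoidHom) (θ f) (by simpa using hf) ⟨f, hfC, rfl⟩ ((hA f).2 hfA)
  let φ' : FreeGroup E ≃* C := φ.trans (C.equivMapOfInjective θ.toMonoidHom θ.injective).symm
  have hφ' : θ (φ' (FreeGroup.of e)) = φ (FreeGroup.of e) :=
    congrArg Subtype.val
      ((C.equivMapOfInjective θ.toMonoidHom θ.injective).apply_symm_apply (φ (FreeGroup.of e)))
  obtain ⟨Z', ψ', hψ'⟩ := hCD.exists_basis_extending φ'
  refine ⟨φ' (FreeGroup.of e),
    ⟨(FreeGroup.freeGroupCongr (Equiv.ofFreeGroupEquiv ψ')).symm.trans ψ',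
    Equiv.ofFreeGroupEquiv ψ' (Sum.inl e), ?_⟩, (hA _).1 (hφ' ▸ he), (φ' (FreeGroup.of e)).2⟩
  rw [← hψ']
  simp [FreeGroup.freeGroupCongr]

/-- If a nontrivial element `f` of the finitely generated free group `F(X)`
is elliptic to both proper free splittings `A * B` and `C * D`, then some primitive
element `g` is elliptic to both.  (Ellipticity is invariant under the equivalence of
splittings, so this is a statement about the classes `[A*B]` and `[C*D]`.) -/
theorem primitive_elliptic_common {X : Type} [Fintype X]
    (A B C D : Subgroup (FreeGroup X))
    (hAB : IsFreeSplitting A B) (hA : A ≠ ⊤) (hB : B ≠ ⊤)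
    (hCD : IsFreeSplitting C D) (hC : C ≠ ⊤) (hD : D ≠ ⊤)
    (f : FreeGroup X) (hf : f ≠ 1)
    (hf1 : Elliptic A B f) (hf2 : Elliptic C D f) :
    ∃ g : FreeGroup X, IsPrimitive g ∧ Elliptic A B g ∧ Elliptic C D g := by
  obtain ⟨y, hy⟩ := hf1
  obtain ⟨z, hz⟩ := hf2
  have hf' : z * f * z⁻¹ ≠ 1 := by simpa using hf
  have hy' : y * z⁻¹ * (z * f * z⁻¹) * (y * z⁻¹)⁻¹ = y * f * y⁻¹ := by group
  rw [← hy'] at hy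
  rcases hy with hy | hy <;> rcases hz with hz | hz
  · obtain ⟨g, h1, h2, h3⟩ := hAB.exists_primitive_mem hCD hf' hy hz
    exact ⟨g, h1, ⟨_, .inl h2⟩, 1, .inl (by simpa using h3)⟩
  · obtain ⟨g, h1, h2, h3⟩ := hAB.exists_primitive_mem hCD.symm hf' hy hz
    exact ⟨g, h1, ⟨_, .inl h2⟩, 1, .inr (by simpa using h3)⟩
  · obtain ⟨g, h1, h2, h3⟩ := hAB.symm.exists_primitive_mem hCD hf' hy hz
    exact ⟨g, h1, ⟨_, .inr h2⟩, 1, .inl (by simpa using h3)⟩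
  · obtain ⟨g, h1, h2, h3⟩ := hAB.symm.exists_primitive_mem hCD.symm hf' hy hz
    exact ⟨g, h1, ⟨_, .inr h2⟩, 1, .inr (by simpa using h3)⟩
end

section
/- Let F = F(X), let H and K be finitely generated subgroups of F, and let C = ⋃_{x,y ∈ F} (xHx⁻¹ ∩ yKy⁻¹). Then C ≠ {1} if and only if there exist vertices u of Type(Γ(H)) and v of Type(Γ(K)) such that L(Type(Γ(H)) × Type(Γ(K)), (u,v)) ≠ 1. -/
/-- An `X`-digraph: a directed graph whose edges are labeled by elements of `X`. -/
structure XDigraph (X : Type) where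
  V : Type
  E : Type
  o : E → V
  t : E → V
  lab : E → X

namespace XDigraph

variable {X : Type}

/-- `Γ` is folded: no vertex has two distinct outgoing edges with the same label, nor
two distinct incoming edges with the same label. -/
def Folded (Γ : XDigraph X) : Prop :=
  (∀ e f : Γ.E, Γ.o e = Γ.o f → Γ.lab e = Γ.lab f → e = f) ∧
  (∀ e f : Γ.E, Γ.t e = Γ.t f → Γ.lab e = Γ.lab f → e = f)

/-- A directed edge of `Γ̂`: an edge of `Γ` together with a direction of traversal
(`true` = forwards, `false` = backwards). -/
abbrev DEdge (Γ : XDigraph X) : Type := Γ.E × Bool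

/-- Origin of a directed edge. -/
def dO (Γ : XDigraph X) (d : DEdge Γ) : Γ.V := if d.2 then Γ.o d.1 else Γ.t d.1

/-- Terminus of a directed edge. -/
def dT (Γ : XDigraph X) (d : DEdge Γ) : Γ.V := if d.2 then Γ.t d.1 else Γ.o d.1

/-- `IsPath Γ u v p`: the list `p` of directed edges is a path from `u` to `v`. -/
def IsPath (Γ : XDigraph X) : Γ.V → Γ.V → List (DEdge Γ) → Prop
  | u, v, [] => u = v
  | u, v, d :: p => Γ.dO d = u ∧ IsPath Γ (Γ.dT d) v p

/-- A path is reduced if it never immediately backtracks along the same edge. -/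
def Reduced (Γ : XDigraph X) (p : List (DEdge Γ)) : Prop :=
  List.Chain' (fun d₁ d₂ => d₂ ≠ (d₁.1, !d₁.2)) p

/-- The label of a path, as an element of the free group `F(X)`: a reversed edge
contributes the inverse of its label. -/
def plabel (Γ : XDigraph X) (p : List (DEdge Γ)) : FreeGroup X :=
  FreeGroup.mk (p.map fun d => (Γ.lab d.1, d.2))

/-- The language `L(Γ, v)`: labels of reduced closed paths at `v`. -/
def LSet (Γ : XDigraph X) (v : Γ.V) : Set (FreeGroup X) :=
  {g | ∃ p : List (DEdge Γ), Γ.IsPath v v p ∧ Γ.Reduced p ∧ g = Γ.plabel p}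

/-- `Γ` is a core graph with respect to `v`: every vertex and every edge of `Γ` lies
on some reduced closed path at `v`. -/
def IsCore (Γ : XDigraph X) (v : Γ.V) : Prop :=
  (∀ u : Γ.V, u = v ∨ ∃ p : List (DEdge Γ), Γ.IsPath v v p ∧ Γ.Reduced p ∧
      ∃ d ∈ p, Γ.dO d = u ∨ Γ.dT d = u) ∧
  (∀ e : Γ.E, ∃ p : List (DEdge Γ), Γ.IsPath v v p ∧ Γ.Reduced p ∧ ∃ b : Bool, (e, b) ∈ p)

/-- The product of two `X`-digraphs: vertices are pairs of vertices, edges are pairs of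
equally-labeled edges. -/
def prod (Γ Δ : XDigraph X) : XDigraph X where
  V := Γ.V × Δ.V
  E := {ef : Γ.E × Δ.E // Γ.lab ef.1 = Δ.lab ef.2}
  o := fun ef => (Γ.o ef.1.1, Δ.o ef.1.2)
  t := fun ef => (Γ.t ef.1.1, Δ.t ef.1.2)
  lab := fun ef => Γ.lab ef.1.1

/-- The edges of `Core(Γ, v)`: edges lying on some reduced closed path at `v`. -/
def CoreEdges (Γ : XDigraph X) (v : Γ.V) : Set Γ.E :=
  {e | ∃ p : List (DEdge Γ), Γ.IsPath v v p ∧ Γ.Reduced p ∧ ∃ b : Bool, (e, b) ∈ p}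

/-- The edges of `Type(Γ) = ⋂_{u ∈ VΓ} Core(Γ, u)`. -/
def TypeEdges (Γ : XDigraph X) : Set Γ.E := ⋂ u : Γ.V, Γ.CoreEdges u

/-- The language of the subgraph of `Γ` spanned by the edge set `S`, at the vertex `v`:
labels of reduced closed paths at `v` using only edges of `S`. -/
def LSetIn (Γ : XDigraph X) (S : Set Γ.E) (v : Γ.V) : Set (FreeGroup X) :=
  {g | ∃ p : List (DEdge Γ), Γ.IsPath v v p ∧ Γ.Reduced p ∧
    (∀ d ∈ p, d.1 ∈ S) ∧ g = Γ.plabel p}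

/-! ### Cyclically reduced words and conjugation -/

theorem isCyclicallyReduced_cons_iff_concat {α : Type*} {a : α × Bool}
    {s : List (α × Bool)} :
    FreeGroup.IsCyclicallyReduced (a :: s) ↔ FreeGroup.IsCyclicallyReduced (s ++ [a]) := by
  cases s with
  | nil => simp
  | cons c s =>
    simp only [FreeGroup.IsCyclicallyReduced, FreeGroup.IsReduced, List.isChain_append,
      List.isChain_cons (x := a), List.getLast?_cons_cons, List.head?_cons,
      List.getLast?_concat, Option.mem_def, Option.some.injEq, List.head?_append,
      Option.some_or, forall_eq']
    tauto

theorem snd_eq_of_ne_inv {α : Type*} {a b : α × Bool} (h : b ≠ (a.1, !a.2)) :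
    a.1 = b.1 → a.2 = b.2 := fun he => by
  by_contra hne
  exact h (Prod.ext he.symm (Bool.eq_not.2 (Ne.symm hne)))

/-- The reduced form of a conjugate of a cyclically reduced word `p` is `r q r⁻¹` for some
rotation `q` of `p`. -/
theorem exists_reduced_conj {α : Type*} {p : List (α × Bool)}
    (hp : FreeGroup.IsCyclicallyReduced p) (hne : p ≠ []) (x : List (α × Bool)) :
    ∃ r q : List (α × Bool), q ~r p ∧ FreeGroup.IsCyclicallyReduced q ∧
      FreeGroup.IsReduced (r ++ q ++ FreeGroup.invRev r) ∧
      FreeGroup.mk (r ++ q ++ FreeGroup.invRev r) =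
        FreeGroup.mk x * FreeGroup.mk p * (FreeGroup.mk x)⁻¹ := by
  induction x with
  | nil => exact ⟨[], p, .refl p, hp, by simpa using hp.1, by simp [← FreeGroup.one_eq_mk]⟩
  | cons a x ih =>
    obtain ⟨r, q, hqp, hq, hr, he⟩ := ih
    have hqne : q ≠ [] := by rintro rfl; simp_all
    have hax : FreeGroup.mk (a :: x) = FreeGroup.mk [a] * FreeGroup.mk x := by simp
    have hconj : FreeGroup.mk (a :: x) * FreeGroup.mk p * (FreeGroup.mk (a :: x))⁻¹ =
        FreeGroup.mk [a] * FreeGroup.mk (r ++ q ++ FreeGroup.invRev r) *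
          (FreeGroup.mk [a])⁻¹ := by
      rw [he, hax]; group
    have hinv : FreeGroup.mk [(a.1, !a.2)] = (FreeGroup.mk [a])⁻¹ := by
      simp [FreeGroup.inv_mk, FreeGroup.invRev]
    simp only [hconj]
    cases r with
    | cons b r =>
      by_cases hb : b = (a.1, !a.2)
      · refine ⟨r, q, hqp, hq, hr.infix ⟨[b], FreeGroup.invRev [b], ?_⟩, ?_⟩
        · rw [FreeGroup.invRev_cons (L := r)]; simp
        · have : FreeGroup.mk (b :: r ++ q ++ FreeGroup.invRev (b :: r)) =
              FreeGroup.mk [b] * FreeGroup.mk (r ++ q ++ FreeGroup.invRev r) *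
                (FreeGroup.mk [b])⁻¹ := by
            rw [FreeGroup.inv_mk, FreeGroup.invRev_cons]; simp
          rw [this, hb, hinv]; group
      · refine ⟨a :: b :: r, q, hqp, hq, ?_, ?_⟩
        · have hab : a.1 = b.1 → a.2 = b.2 := snd_eq_of_ne_inv hb
          simp [FreeGroup.IsReduced, List.isChain_append, List.isChain_cons,
            FreeGroup.invRev] at hr ⊢
          grind
        · rw [FreeGroup.invRev_cons (a := a), FreeGroup.inv_mk]; simp
    | nil =>
      simp only [List.nil_append, FreeGroup.invRev_empty, List.append_nil] at hr he hconj ⊢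
      obtain ⟨c, s, rfl⟩ := List.exists_cons_of_ne_nil hqne
      by_cases hc : c = (a.1, !a.2)
      · have hs := isCyclicallyReduced_cons_iff_concat.1 hq
        refine ⟨[], s ++ [c], ?_, hs, by simpa using hs.1, ?_⟩
        · exact (List.isRotated_concat c s).trans hqp
        · have : FreeGroup.mk (c :: s) = FreeGroup.mk [c] * FreeGroup.mk s := by simp
          simp only [List.nil_append, FreeGroup.invRev_empty, List.append_nil]
          rw [this, ← FreeGroup.mul_mk, hc, hinv]; group
      · obtain hnil | ⟨t, d, ht⟩ := List.eq_nil_or_concat (c :: s)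
        · simp at hnil
        by_cases hd : d = a
        · subst hd
          rw [List.concat_eq_append] at ht
          rw [ht] at hq hqp hr ⊢
          have hs := isCyclicallyReduced_cons_iff_concat.2 hq
          refine ⟨[], d :: t, (List.isRotated_concat d t).symm.trans hqp, hs,
            by simpa using hs.1, ?_⟩
          have : FreeGroup.mk (d :: t) = FreeGroup.mk [d] * FreeGroup.mk t := by simp
          simp only [List.nil_append, FreeGroup.invRev_empty, List.append_nil]
          rw [this, ← FreeGroup.mul_mk]; group
        · refine ⟨[a], c :: s, hqp, hq, ?_, ?_⟩
          · have hac : a.1 = c.1 → a.2 = c.2 := snd_eq_of_ne_inv hc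
            have h1 : FreeGroup.IsReduced (c :: s ++ FreeGroup.invRev [a]) := by
              rw [ht] at hr ⊢
              simp [FreeGroup.IsReduced, List.isChain_append, FreeGroup.invRev] at hr ⊢
              grind
            simp only [FreeGroup.IsReduced] at h1 ⊢
            rw [List.append_assoc, List.singleton_append, List.isChain_cons]
            exact ⟨by simpa using hac, h1⟩
          · rw [FreeGroup.inv_mk]; simp

/-! ### Paths -/

theorem isPath_append {Γ : XDigraph X} {u v : Γ.V} {p q : List (DEdge Γ)} :
    Γ.IsPath u v (p ++ q) ↔ ∃ w, Γ.IsPath u w p ∧ Γ.IsPath w v q := by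
  induction p generalizing u with
  | nil => simp [IsPath]
  | cons d p ih => simp [IsPath, ih, and_assoc]

theorem IsPath.invRev {Γ : XDigraph X} {u v : Γ.V} {p : List (DEdge Γ)}
    (h : Γ.IsPath u v p) : Γ.IsPath v u (FreeGroup.invRev p) := by
  induction p generalizing u with
  | nil => simp_all [IsPath]
  | cons d p ih =>
    rw [FreeGroup.invRev_cons, isPath_append]
    obtain ⟨rfl, h⟩ := h
    refine ⟨_, ih h, ?_⟩
    obtain ⟨e, _ | _⟩ := d <;> simp [FreeGroup.invRev, IsPath, dO, dT]

theorem IsPath.red {Γ : XDigraph X} {u v : Γ.V} {p q : List (DEdge Γ)}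
    (hr : FreeGroup.Red p q) (h : Γ.IsPath u v p) : Γ.IsPath u v q := by
  induction hr with
  | refl => exact h
  | tail _ hs ih =>
    cases hs with
    | @not L₁ L₂ x b =>
      obtain ⟨w, h₁, rfl, h₂, h₃⟩ := isPath_append.1 ih
      refine isPath_append.2 ⟨_, h₁, ?_⟩
      cases b <;> simpa [dO, dT] using h₃

theorem IsPath.rotate {Γ : XDigraph X} {u : Γ.V} {p q : List (DEdge Γ)}
    (h : Γ.IsPath u u p) (hr : p ~r q) : ∃ v, Γ.IsPath v v q := by
  obtain ⟨n, rfl⟩ := hr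
  induction n generalizing u p with
  | zero => exact ⟨u, by simpa using h⟩
  | succ n ih =>
    cases p with
    | nil => exact ⟨u, by simpa using h⟩
    | cons d p =>
      rw [List.rotate_cons_succ]
      obtain ⟨rfl, h⟩ := h
      exact ih (isPath_append.2 ⟨_, h, rfl, rfl⟩)

theorem reduced_iff {Γ : XDigraph X} {p : List (DEdge Γ)} :
    Γ.Reduced p ↔ FreeGroup.IsReduced p := by
  refine List.IsChain.iff fun a b => ?_
  obtain ⟨a, _ | _⟩ := a <;> obtain ⟨b, _ | _⟩ := b <;> simp [eq_comm]

/-- The label of a path, as an unreduced word. -/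
def labelWord (Γ : XDigraph X) (p : List (DEdge Γ)) : List (X × Bool) :=
  p.map fun d => (Γ.lab d.1, d.2)

theorem plabel_eq_mk (Γ : XDigraph X) (p : List (DEdge Γ)) :
    Γ.plabel p = FreeGroup.mk (Γ.labelWord p) := rfl

theorem plabel_eq_map (Γ : XDigraph X) (p : List (DEdge Γ)) :
    Γ.plabel p = FreeGroup.map Γ.lab (FreeGroup.mk p) := by
  simp [plabel]

theorem isReduced_of_labelWord {Γ : XDigraph X} {p : List (DEdge Γ)}
    (h : FreeGroup.IsReduced (Γ.labelWord p)) : FreeGroup.IsReduced p :=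
  List.isChain_of_isChain_map _ (fun _ _ H e => H (congrArg Γ.lab e)) h

theorem isCyclicallyReduced_of_labelWord {Γ : XDigraph X} {p : List (DEdge Γ)}
    (h : FreeGroup.IsCyclicallyReduced (Γ.labelWord p)) : FreeGroup.IsCyclicallyReduced p := by
  refine ⟨isReduced_of_labelWord h.1, fun a ha b hb e => ?_⟩
  refine h.2 (Γ.lab a.1, a.2) ?_ (Γ.lab b.1, b.2) ?_ (congrArg Γ.lab e)
  · simp_all [labelWord]
  · simp_all [labelWord]

theorem Folded.eq_of_dO {Γ : XDigraph X} (hf : Γ.Folded) {d d' : DEdge Γ}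
    (ho : Γ.dO d = Γ.dO d') (hl : Γ.lab d.1 = Γ.lab d'.1) (hb : d.2 = d'.2) : d = d' := by
  obtain ⟨e, b⟩ := d
  obtain ⟨e', b'⟩ := d'
  obtain rfl : b = b' := hb
  cases b
  · rw [hf.2 e e' (by simpa [dO] using ho) hl]
  · rw [hf.1 e e' (by simpa [dO] using ho) hl]

theorem Folded.path_unique {Γ : XDigraph X} (hf : Γ.Folded) {u v v' : Γ.V}
    {p p' : List (DEdge Γ)} (h : Γ.IsPath u v p) (h' : Γ.IsPath u v' p')
    (hl : Γ.labelWord p = Γ.labelWord p') : v = v' := by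
  induction p generalizing u p' with
  | nil =>
    cases p' with
    | nil => exact h.symm.trans h'
    | cons => simp [labelWord] at hl
  | cons d p ih =>
    cases p' with
    | nil => simp [labelWord] at hl
    | cons d' p' =>
      simp only [labelWord, List.map_cons, List.cons.injEq, Prod.mk.injEq] at hl
      obtain rfl := hf.eq_of_dO (h.1.trans h'.1.symm) hl.1.1 hl.1.2
      exact ih h.2 h'.2 hl.2

theorem Folded.isReduced_labelWord {Γ : XDigraph X} (hf : Γ.Folded) {u v : Γ.V}
    {p : List (DEdge Γ)} (h : Γ.IsPath u v p) (hr : FreeGroup.IsReduced p) :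
    FreeGroup.IsReduced (Γ.labelWord p) := by
  induction p generalizing u with
  | nil => simp [labelWord, FreeGroup.IsReduced]
  | cons d p ih =>
    cases p with
    | nil => simp [labelWord, FreeGroup.IsReduced]
    | cons d' p =>
      have hr' := List.isChain_cons_cons.1 hr
      refine List.isChain_cons_cons.2 ⟨fun hl => ?_, ih h.2 hr'.2⟩
      by_contra hb
      have hdd : (d.1, !d.2) = d' := by
        refine hf.eq_of_dO ?_ hl ?_
        · rw [h.2.1]
          obtain ⟨e, _ | _⟩ := d <;> simp [dO, dT]
        · simpa [Bool.not_eq_eq_eq_not] using Bool.eq_not.2 hb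
      exact hb (hr'.1 (by rw [← hdd]))

theorem plabel_mem_LSet {Γ : XDigraph X} {u : Γ.V} {p : List (DEdge Γ)}
    (h : Γ.IsPath u u p) : Γ.plabel p ∈ Γ.LSet u := by
  classical
  refine ⟨FreeGroup.reduce p, h.red FreeGroup.reduce.red, ?_, ?_⟩
  · rw [reduced_iff, FreeGroup.isReduced_iff_reduce_eq, FreeGroup.reduce.idem]
  · rw [plabel_eq_map, plabel_eq_map, FreeGroup.reduce.self]

theorem IsCore.exists_path {Γ : XDigraph X} {b : Γ.V} (hc : Γ.IsCore b) (u : Γ.V) :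
    ∃ p, Γ.IsPath b u p := by
  obtain rfl | ⟨p, hp, -, d, hd, hu⟩ := hc.1 u
  · exact ⟨[], rfl⟩
  · obtain ⟨s, t, rfl⟩ := List.append_of_mem hd
    obtain ⟨w, h₁, h₂, h₃⟩ := isPath_append.1 hp
    obtain rfl | rfl := hu
    · exact ⟨s, h₂ ▸ h₁⟩
    · exact ⟨s ++ [d], isPath_append.2 ⟨w, h₁, h₂, rfl⟩⟩

theorem IsCore.mem_conj {Γ : XDigraph X} {b u : Γ.V} (hc : Γ.IsCore b) {p : List (DEdge Γ)}
    (h : Γ.IsPath u u p) : ∃ x : FreeGroup X, x⁻¹ * Γ.plabel p * x ∈ Γ.LSet b := by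
  obtain ⟨q, hq⟩ := hc.exists_path u
  refine ⟨(Γ.plabel q)⁻¹, ?_⟩
  have := plabel_mem_LSet (isPath_append.2 ⟨_, hq, isPath_append.2 ⟨_, h, hq.invRev⟩⟩)
  rw [plabel_eq_map, ← FreeGroup.mul_mk, ← FreeGroup.mul_mk, ← FreeGroup.inv_mk, map_mul,
    map_mul, map_inv, ← plabel_eq_map, ← plabel_eq_map, ← mul_assoc] at this
  rwa [inv_inv]

/-- A cyclically reduced word conjugate into the language of a folded graph labels a closed
path. -/
theorem Folded.exists_closed_path {Γ : XDigraph X} (hf : Γ.Folded) {b : Γ.V}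
    {W : List (X × Bool)} (hW : FreeGroup.IsCyclicallyReduced W) (hne : W ≠ [])
    {z : FreeGroup X} (hz : z * FreeGroup.mk W * z⁻¹ ∈ Γ.LSet b) :
    ∃ u p, Γ.IsPath u u p ∧ Γ.labelWord p = W := by
  classical
  obtain ⟨P, hP, hPr, hPl⟩ := hz
  obtain ⟨r, q, hq, -, hr, he⟩ := exists_reduced_conj hW hne z.toWord
  rw [FreeGroup.mk_toWord, hPl, plabel_eq_mk] at he
  have hw : Γ.labelWord P = r ++ q ++ FreeGroup.invRev r := by
    rw [← (hf.isReduced_labelWord hP (reduced_iff.1 hPr)).reduce_eq, ← hr.reduce_eq]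
    exact (FreeGroup.reduce.sound he).symm
  obtain ⟨P₁₂, P₃, rfl, h₁₂, h₃⟩ := List.map_eq_append_iff.1 hw
  obtain ⟨P₁, P₂, rfl, h₁, h₂⟩ := List.map_eq_append_iff.1 h₁₂
  obtain ⟨v, hv, hv₃⟩ := isPath_append.1 hP
  obtain ⟨u, hu₁, hu₂⟩ := isPath_append.1 hv
  have hlab : Γ.labelWord (FreeGroup.invRev P₃) = r := by
    rw [← FreeGroup.invRev_invRev (L₁ := r), ← h₃]
    simp [labelWord, FreeGroup.invRev, Function.comp_def]
  obtain rfl := hf.path_unique hu₁ hv₃.invRev (h₁.trans hlab.symm)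
  obtain ⟨n, hn⟩ := hq
  obtain ⟨w, hw⟩ := hu₂.rotate ⟨n, rfl⟩
  refine ⟨w, P₂.rotate n, hw, ?_⟩
  rw [labelWord, List.map_rotate, h₂, hn]

theorem IsCore.mem_typeEdges {Γ : XDigraph X} {b u : Γ.V} (hc : Γ.IsCore b)
    {p : List (DEdge Γ)} (h : Γ.IsPath u u p) (hp : FreeGroup.IsCyclicallyReduced p)
    {d : DEdge Γ} (hd : d ∈ p) : d.1 ∈ Γ.TypeEdges := by
  classical
  refine Set.mem_iInter.2 fun w => ?_
  obtain ⟨s, hs⟩ := hc.exists_path w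
  obtain ⟨t, ht⟩ := hc.exists_path u
  have hx := isPath_append.2 ⟨_, hs.invRev, ht⟩
  generalize FreeGroup.invRev s ++ t = x at hx
  obtain ⟨r, q, hq, -, hr, he⟩ := exists_reduced_conj hp (List.ne_nil_of_mem hd) x
  rw [FreeGroup.inv_mk, FreeGroup.mul_mk, FreeGroup.mul_mk] at he
  refine ⟨r ++ q ++ FreeGroup.invRev r, ?_, reduced_iff.2 hr, d.2, ?_⟩
  · rw [← hr.reduce_eq, FreeGroup.reduce.sound he]
    exact (isPath_append.2 ⟨_, isPath_append.2 ⟨_, hx, h⟩, hx.invRev⟩).red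
      FreeGroup.reduce.red
  · have := hq.mem_iff.2 hd
    simp [this]

/-! ### Paths in products -/

theorem IsPath.map_fst {Γ Δ : XDigraph X} {u v : (Γ.prod Δ).V} {p : List (DEdge (Γ.prod Δ))}
    (h : (Γ.prod Δ).IsPath u v p) :
    Γ.IsPath u.1 v.1 (p.map fun d => (d.1.1.1, d.2)) := by
  induction p generalizing u with
  | nil => exact congrArg Prod.fst h
  | cons d p ih =>
    obtain ⟨rfl, h⟩ := h
    have := ih h
    obtain ⟨e, _ | _⟩ := d <;> exact ⟨rfl, this⟩

theorem IsPath.map_snd {Γ Δ : XDigraph X} {u v : (Γ.prod Δ).V} {p : List (DEdge (Γ.prod Δ))}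
    (h : (Γ.prod Δ).IsPath u v p) :
    Δ.IsPath u.2 v.2 (p.map fun d => (d.1.1.2, d.2)) := by
  induction p generalizing u with
  | nil => exact congrArg Prod.snd h
  | cons d p ih =>
    obtain ⟨rfl, h⟩ := h
    have := ih h
    obtain ⟨e, _ | _⟩ := d <;> exact ⟨rfl, this⟩

theorem labelWord_map_fst {Γ Δ : XDigraph X} (p : List (DEdge (Γ.prod Δ))) :
    Γ.labelWord (p.map fun d => (d.1.1.1, d.2)) = (Γ.prod Δ).labelWord p :=
  List.map_map

theorem labelWord_map_snd {Γ Δ : XDigraph X} (p : List (DEdge (Γ.prod Δ))) :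
    Δ.labelWord (p.map fun d => (d.1.1.2, d.2)) = (Γ.prod Δ).labelWord p := by
  simp only [labelWord, List.map_map]
  exact List.map_congr_left fun d _ => Prod.ext d.1.2.symm rfl

theorem exists_prod_path {Γ Δ : XDigraph X} {u u' : Γ.V} {v v' : Δ.V}
    {p : List (DEdge Γ)} {q : List (DEdge Δ)} (hp : Γ.IsPath u u' p) (hq : Δ.IsPath v v' q)
    (hl : Γ.labelWord p = Δ.labelWord q) :
    ∃ P, (Γ.prod Δ).IsPath (u, v) (u', v') P ∧ (P.map fun d => (d.1.1.1, d.2)) = p ∧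
      (P.map fun d => (d.1.1.2, d.2)) = q := by
  induction p generalizing u v q with
  | nil =>
    obtain rfl : q = [] := by simpa [labelWord] using hl.symm
    exact ⟨[], Prod.ext hp hq, rfl, rfl⟩
  | cons d p ih =>
    cases q with
    | nil => simp [labelWord] at hl
    | cons d' q =>
      simp only [labelWord, List.map_cons, List.cons.injEq, Prod.mk.injEq] at hl
      obtain ⟨rfl, hp⟩ := hp
      obtain ⟨rfl, hq⟩ := hq
      obtain ⟨P, hP, rfl, rfl⟩ := ih hp hq hl.2
      obtain ⟨e, b⟩ := d
      obtain ⟨e', b'⟩ := d'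
      obtain ⟨⟨hl, rfl : b = b'⟩, -⟩ := hl
      refine ⟨(⟨(e, e'), hl⟩, b) :: P, ?_, rfl, rfl⟩
      cases b <;> exact ⟨rfl, hP⟩

end XDigraph

/-- Let `H`, `K` be finitely generated subgroups of `F(X)`, with Stallings
graphs `(Γ, b₁)` and `(Δ, b₂)` (finite folded core `X`-digraphs whose languages are `H`
and `K`).  Then `C = ⋃_{x,y} (xHx⁻¹ ∩ yKy⁻¹)` contains a nontrivial element iff there
are vertices `u` of `Type(Γ)` and `v` of `Type(Δ)` such that the language of
`Type(Γ) × Type(Δ)` at `(u, v)` is nontrivial. -/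
theorem common_conjugate_iff_type_product {X : Type} [Fintype X]
    (H K : Subgroup (FreeGroup X)) (hH : H.FG) (hK : K.FG)
    (Γ Δ : XDigraph X) [Finite Γ.V] [Finite Γ.E] [Finite Δ.V] [Finite Δ.E]
    (b₁ : Γ.V) (b₂ : Δ.V) (hΓf : Γ.Folded) (hΔf : Δ.Folded)
    (hΓc : Γ.IsCore b₁) (hΔc : Δ.IsCore b₂)
    (hΓL : Γ.LSet b₁ = (H : Set (FreeGroup X))) (hΔL : Δ.LSet b₂ = (K : Set (FreeGroup X))) :
    (∃ g : FreeGroup X, g ≠ 1 ∧ ∃ x y : FreeGroup X,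
        g ∈ (fun h => x * h * x⁻¹) '' (H : Set (FreeGroup X)) ∧
        g ∈ (fun h => y * h * y⁻¹) '' (K : Set (FreeGroup X))) ↔
    (∃ (u : Γ.V) (v : Δ.V) (g : FreeGroup X), g ≠ 1 ∧
      g ∈ (Γ.prod Δ).LSetIn
        {e : (Γ.prod Δ).E | e.1.1 ∈ Γ.TypeEdges ∧ e.1.2 ∈ Δ.TypeEdges} (u, v)) := by
  classical
  constructor
  · rintro ⟨g, hg, x, y, ⟨h, hh, rfl⟩, ⟨k, hk, hkg⟩⟩
    dsimp only at hg hkg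
    set g := x * h * x⁻¹ with hgx
    set W := FreeGroup.reduceCyclically g.toWord with hWdef
    set c := FreeGroup.mk (FreeGroup.reduceCyclically.conjugator g.toWord) with hc
    have hW : FreeGroup.IsCyclicallyReduced W :=
      FreeGroup.reduceCyclically.isCyclicallyReduced FreeGroup.isReduced_toWord
    have hgW : g = c * FreeGroup.mk W * c⁻¹ := by
      rw [hc, FreeGroup.inv_mk, FreeGroup.mul_mk, FreeGroup.mul_mk, hWdef,
        FreeGroup.reduceCyclically.conj_conjugator_reduceCyclically, FreeGroup.mk_toWord]
    have hne : W ≠ [] := by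
      intro h0
      rw [h0, ← FreeGroup.one_eq_mk] at hgW
      exact hg (by simpa using hgW)
    have hhΓ : (x⁻¹ * c) * FreeGroup.mk W * (x⁻¹ * c)⁻¹ ∈ Γ.LSet b₁ := by
      have : (x⁻¹ * c) * FreeGroup.mk W * (x⁻¹ * c)⁻¹ = h := by
        calc _ = x⁻¹ * (c * FreeGroup.mk W * c⁻¹) * x := by group
          _ = h := by rw [← hgW, hgx]; group
      rwa [hΓL, this]
    have hkΔ : (y⁻¹ * c) * FreeGroup.mk W * (y⁻¹ * c)⁻¹ ∈ Δ.LSet b₂ := by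
      have : (y⁻¹ * c) * FreeGroup.mk W * (y⁻¹ * c)⁻¹ = k := by
        calc _ = y⁻¹ * (c * FreeGroup.mk W * c⁻¹) * y := by group
          _ = k := by rw [← hgW, ← hkg]; group
      rwa [hΔL, this]
    obtain ⟨u, p, hp, hpW⟩ := hΓf.exists_closed_path hW hne hhΓ
    obtain ⟨v, q, hq, hqW⟩ := hΔf.exists_closed_path hW hne hkΔ
    obtain ⟨P, hP, rfl, rfl⟩ := XDigraph.exists_prod_path hp hq (hpW.trans hqW.symm)
    have hPW : (Γ.prod Δ).labelWord P = W := by rw [← hpW, XDigraph.labelWord_map_fst]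
    refine ⟨u, v, FreeGroup.mk W, ?_, P, hP, ?_, fun d hd => ⟨?_, ?_⟩, ?_⟩
    · intro h1
      rw [h1] at hgW
      exact hg (by simpa using hgW)
    · exact XDigraph.reduced_iff.2 (XDigraph.isReduced_of_labelWord (hPW ▸ hW.1))
    · exact hΓc.mem_typeEdges hp (XDigraph.isCyclicallyReduced_of_labelWord (hpW ▸ hW))
        (List.mem_map_of_mem hd)
    · exact hΔc.mem_typeEdges hq (XDigraph.isCyclicallyReduced_of_labelWord (hqW ▸ hW))
        (List.mem_map_of_mem hd)
    · rw [XDigraph.plabel_eq_mk, hPW]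
  · rintro ⟨u, v, g, hg, P, hP, -, -, rfl⟩
    obtain ⟨x, hx⟩ := hΓc.mem_conj hP.map_fst
    obtain ⟨y, hy⟩ := hΔc.mem_conj hP.map_snd
    rw [XDigraph.plabel_eq_mk, XDigraph.labelWord_map_fst, ← XDigraph.plabel_eq_mk, hΓL] at hx
    rw [XDigraph.plabel_eq_mk, XDigraph.labelWord_map_snd, ← XDigraph.plabel_eq_mk, hΔL] at hy
    exact ⟨_, hg, x, y, ⟨_, hx, by group⟩, ⟨_, hy, by group⟩⟩
end
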